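/- Let d ≥ 1, 1/2 ≤ s < 1, and let f : [−1,1] → ℝ be C^{1,α} with α > 0. Let u be a stable solution of (−Δ)^s u = f(u) in ℝ^d with |u| ≤ 1, and let M₀ ≥ 2 be an upper bound for the L^∞ norm of f on [−1,1]. Then there is a constant C₂ = C₂(d,s,f) such that for every x₀ ∈ ℝ^d and every R ≥ 1: J^s(u, B_R(x₀)) ≤ C₂ · R^{d+2s−2} · (log(M₀ R))². -/

import Mathlib

open MeasureTheory Metric Set
open scoped ENNReal NNReal

/-- The fractional `s`-energy `J^s(u,Ω)` of `u : ℝ^d → ℝ` on an open set `Ω`: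
`J^s(u,Ω) = ∬_{(ℝ^d×ℝ^d)∖(Ωᶜ×Ωᶜ)} |u(x)−u(y)|²/|x−y|^{d+2s} dy dx`, valued in `[0,∞]`. -/
noncomputable def Js (d : ℕ) (s : ℝ) (u : EuclideanSpace ℝ (Fin d) → ℝ)
    (Ω : Set (EuclideanSpace ℝ (Fin d))) : ℝ≥0∞ :=
  ∫⁻ p : EuclideanSpace ℝ (Fin d) × EuclideanSpace ℝ (Fin d) in (Ωᶜ ×ˢ Ωᶜ)ᶜ,
    ENNReal.ofReal ((u p.1 - u p.2)^2 / ‖p.1 - p.2‖ ^ ((d : ℝ) + 2*s))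

/-- The normalizing constant `C(d,s) = 2^{2s} Γ(d/2+s) / (π^{d/2} |Γ(−s)|)` of the fractional
Laplacian, which normalizes its Fourier symbol to `|ξ|^{2s}`. -/
noncomputable def fracC (d : ℕ) (s : ℝ) : ℝ :=
  2 ^ (2*s) * Real.Gamma ((d : ℝ)/2 + s) / (Real.pi ^ ((d : ℝ)/2) * |Real.Gamma (-s)|)

/-- `f : [−1,1] → ℝ` is `C^{1,α}`: it has derivative `f'` on `[−1,1]` and `f'` is
`α`-Hölder continuous on `[−1,1]`. -/
def IsC1Alpha (f f' : ℝ → ℝ) (α : ℝ) : Prop :=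
  (∀ x ∈ Set.Icc (-1 : ℝ) 1, HasDerivAt f (f' x) x) ∧
  ∃ Cα : ℝ, 0 ≤ Cα ∧ ∀ x ∈ Set.Icc (-1 : ℝ) 1, ∀ y ∈ Set.Icc (-1 : ℝ) 1,
    |f' x - f' y| ≤ Cα * |x - y| ^ α

/-- `u ∈ C²(ℝ^d)` with `|u| ≤ 1` is a stable solution of `(−Δ)^s u = f(u)` in `ℝ^d`:
the equation `(C(d,s)/2)∫ (2u(x)−u(x+y)−u(x−y))/|y|^{d+2s} dy = f(u(x))` holds pointwise and
for every `η ∈ C_c^∞(ℝ^d)` one has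
`(C(d,s)/2) ∬ |η(x)−η(y)|²/|x−y|^{d+2s} dx dy ≥ ∫ f'(u(x)) η(x)² dx`. -/
def IsStableSolution (d : ℕ) (s : ℝ) (f f' : ℝ → ℝ)
    (u : EuclideanSpace ℝ (Fin d) → ℝ) : Prop :=
  ContDiff ℝ 2 u ∧ (∀ x, |u x| ≤ 1) ∧
  (∀ x : EuclideanSpace ℝ (Fin d),
    fracC d s / 2 * ∫ y : EuclideanSpace ℝ (Fin d),
      (2 * u x - u (x + y) - u (x - y)) / ‖y‖ ^ ((d : ℝ) + 2*s) = f (u x)) ∧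
  (∀ η : EuclideanSpace ℝ (Fin d) → ℝ, ContDiff ℝ (⊤ : ℕ∞) η → HasCompactSupport η →
    ∫ x : EuclideanSpace ℝ (Fin d), f' (u x) * (η x)^2 ≤
      fracC d s / 2 * ∫ x : EuclideanSpace ℝ (Fin d), ∫ y : EuclideanSpace ℝ (Fin d),
        (η x - η y)^2 / ‖x - y‖ ^ ((d : ℝ) + 2*s))


section Aux

open Filter Topology

abbrev EE (d : ℕ) := EuclideanSpace ℝ (Fin d)

noncomputable def frk (d : ℕ) (s : ℝ) (z : EE d) : ℝ := (‖z‖ ^ ((d : ℝ) + 2*s))⁻¹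

noncomputable def mm (d : ℕ) (s : ℝ) (z : EE d) : ℝ := min 1 (‖z‖ ^ (1+s)) * frk d s z

lemma frk_nonneg (d : ℕ) (s : ℝ) (z : EE d) : 0 ≤ frk d s z := by
  unfold frk; positivity

lemma mm_nonneg (d : ℕ) (s : ℝ) (z : EE d) : 0 ≤ mm d s z := by
  unfold mm; have := frk_nonneg d s z; positivity

lemma frk_neg (d : ℕ) (s : ℝ) (z : EE d) : frk d s (-z) = frk d s z := by
  unfold frk; rw [norm_neg]

lemma mm_neg (d : ℕ) (s : ℝ) (z : EE d) : mm d s (-z) = mm d s z := by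
  unfold mm; rw [norm_neg, frk_neg]

lemma frk_meas (d : ℕ) (s : ℝ) : Measurable (frk d s) := by
  unfold frk; fun_prop

lemma mm_meas (d : ℕ) (s : ℝ) : Measurable (mm d s) := by
  unfold mm; have := frk_meas d s; fun_prop

lemma nontriv {d : ℕ} (hd : 1 ≤ d) : Nontrivial (EE d) := by
  have : Nonempty (Fin d) := ⟨⟨0, hd⟩⟩
  infer_instance

lemma radial_pow {d : ℕ} (hd : 1 ≤ d) (s t : ℝ) (ht : 0 < t) :
    t ^ (d - 1) * (t ^ ((d : ℝ) + 2*s))⁻¹ = t ^ (-1 - 2*s) := by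
  rw [← Real.rpow_natCast, ← Real.rpow_neg ht.le, ← Real.rpow_add ht]
  congr 1
  push_cast [Nat.cast_sub hd]; ring

lemma mm_integrable {d : ℕ} (hd : 1 ≤ d) {s : ℝ} (hs0 : 0 < s) (hs1 : s < 1) :
    Integrable (mm d s) := by
  have := nontriv hd
  have := (integrable_fun_norm_addHaar (volume : Measure (EE d))
    (f := fun t : ℝ => min 1 (t ^ (1+s)) * (t ^ ((d : ℝ) + 2*s))⁻¹))
  refine this.2 ?_
  simp only [finrank_euclideanSpace, Fintype.card_fin, smul_eq_mul]
  have h1 : IntegrableOn (fun t : ℝ => t ^ (-s)) (Ioc 0 1) := by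
    rw [← intervalIntegrable_iff_integrableOn_Ioc_of_le zero_le_one]
    exact intervalIntegral.intervalIntegrable_rpow' (by linarith)
  have h2 : IntegrableOn (fun t : ℝ => t ^ (-1-2*s)) (Ioi 1) :=
    integrableOn_Ioi_rpow_of_lt (by linarith) zero_lt_one
  rw [← Ioc_union_Ioi_eq_Ioi (zero_le_one (α := ℝ))]
  refine IntegrableOn.union ?_ ?_
  · refine h1.congr_fun ?_ measurableSet_Ioc
    intro t ht
    have h0 : 0 < t := ht.1
    have : min 1 (t ^ (1+s)) = t ^ (1+s) :=
      min_eq_right (Real.rpow_le_one h0.le ht.2 (by linarith))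
    simp only [this]
    rw [mul_left_comm, radial_pow hd s t h0, ← Real.rpow_add h0]
    congr 1; ring
  · refine h2.congr_fun ?_ measurableSet_Ioi
    intro t ht
    have h0 : 0 < t := lt_trans zero_lt_one ht
    have : min 1 (t ^ (1+s)) = 1 :=
      min_eq_left (Real.one_le_rpow (le_of_lt ht) (by linarith))
    simp only [this]
    rw [one_mul, radial_pow hd s t h0]

lemma mmR_eq {d : ℕ} {s R : ℝ} (hR : 0 < R) (z : EE d) :
    min 1 ((‖z‖ / R) ^ (1+s)) * frk d s z = R ^ (-((d:ℝ)+2*s)) * mm d s (R⁻¹ • z) := by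
  unfold mm frk
  rw [norm_smul, Real.norm_of_nonneg (inv_nonneg.2 hR.le), div_eq_inv_mul,
    Real.mul_rpow (x := R⁻¹) (z := (d:ℝ)+2*s) (by positivity) (by positivity),
    Real.inv_rpow hR.le, mul_inv, inv_inv, Real.rpow_neg hR.le]
  have : R ^ ((d:ℝ)+2*s) ≠ 0 := by positivity
  field_simp

lemma mmR_integrable {d : ℕ} (hd : 1 ≤ d) {s R : ℝ} (hs0 : 0 < s) (hs1 : s < 1) (hR : 0 < R) :
    Integrable (fun z : EE d => min 1 ((‖z‖ / R) ^ (1+s)) * frk d s z) := by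
  simp_rw [mmR_eq hR]
  exact ((mm_integrable hd hs0 hs1).comp_smul (inv_ne_zero hR.ne')).const_mul _

lemma mmR_integral {d : ℕ} {s R : ℝ} (hR : 0 < R) :
    ∫ z : EE d, min 1 ((‖z‖ / R) ^ (1+s)) * frk d s z = R ^ (-2*s) * ∫ z, mm d s z := by
  simp_rw [mmR_eq hR]
  rw [integral_const_mul, Measure.integral_comp_inv_smul_of_nonneg _ _ hR.le]
  simp only [finrank_euclideanSpace, Fintype.card_fin, smul_eq_mul]
  rw [← mul_assoc, ← Real.rpow_natCast, ← Real.rpow_add hR]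
  congr 2; ring

/-- the logarithmic integral -/
lemma log_int {d : ℕ} (hd : 1 ≤ d) {s : ℝ} (hs0 : 1/2 ≤ s) (hs1 : s < 1) :
    ∃ C : ℝ, 0 ≤ C ∧ ∀ R : ℝ, 1 ≤ R →
      Integrable (fun z : EE d =>
        (Iio R).indicator (fun t => min (t^2) t * (t ^ ((d : ℝ) + 2*s))⁻¹) ‖z‖) ∧
      ∫ z : EE d, (Iio R).indicator (fun t => min (t^2) t * (t ^ ((d : ℝ) + 2*s))⁻¹) ‖z‖
        ≤ C * (1 + Real.log R) := by
  have := nontriv hd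
  set ω := (volume : Measure (EE d)).real (ball 0 1)
  have hω : 0 ≤ ω := measureReal_nonneg
  refine ⟨d * (ω * (1 / (2 - 2*s) + 1)), ?_, ?_⟩
  · have : 0 < 2 - 2*s := by linarith
    positivity
  intro R hR
  set g : ℝ → ℝ := fun t => (Ioc 0 1).indicator (fun t : ℝ => t ^ (1-2*s)) t +
    (Ioc 1 R).indicator (fun t : ℝ => t⁻¹) t with hg
  have i1 : IntegrableOn (fun t : ℝ => t ^ (1-2*s)) (Ioc 0 1) := by
    rw [← intervalIntegrable_iff_integrableOn_Ioc_of_le zero_le_one]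
    exact intervalIntegral.intervalIntegrable_rpow' (by linarith)
  have i2 : IntegrableOn (fun t : ℝ => t⁻¹) (Ioc 1 R) := by
    rw [← intervalIntegrable_iff_integrableOn_Ioc_of_le hR]
    apply ContinuousOn.intervalIntegrable
    apply ContinuousOn.inv₀ continuousOn_id
    intro x hx
    rw [uIcc_of_le hR] at hx
    have := hx.1; simp only [id]; linarith
  have i3 : Integrable g :=
    ((integrable_indicator_iff measurableSet_Ioc).2 i1).add
      ((integrable_indicator_iff measurableSet_Ioc).2 i2)
  have hgi : ∫ t, g t = 1 / (2-2*s) + Real.log R := by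
    rw [hg, integral_add ((integrable_indicator_iff measurableSet_Ioc).2 i1)
      ((integrable_indicator_iff measurableSet_Ioc).2 i2),
      integral_indicator measurableSet_Ioc, integral_indicator measurableSet_Ioc,
      ← intervalIntegral.integral_of_le zero_le_one, ← intervalIntegral.integral_of_le hR,
      integral_rpow (Or.inl (by linarith)), integral_inv_of_pos one_pos (by linarith)]
    rw [Real.one_rpow, Real.zero_rpow (by linarith)]
    congr 1
    · congr 1 <;> ring
    · simp
  have hg0 : ∀ t, 0 ≤ g t := by
    intro t
    apply add_nonneg <;> apply indicator_nonneg <;> intro x hx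
    · exact Real.rpow_nonneg hx.1.le _
    · have := hx.1; simp only [inv_nonneg]; linarith
  set F : ℝ → ℝ := (Iio R).indicator (fun t => min (t^2) t * (t ^ ((d : ℝ) + 2*s))⁻¹) with hF
  have hFm : Measurable F := by
    apply Measurable.indicator _ measurableSet_Iio
    fun_prop
  have hb : ∀ t ∈ Ioi (0:ℝ), 0 ≤ t ^ (d-1) * F t ∧ t ^ (d-1) * F t ≤ g t := by
    intro t ht
    have ht : 0 < t := ht
    by_cases h : t < R
    · have e : t ^ (d-1) * F t = min (t^2) t * t ^ (-1-2*s) := by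
        rw [hF, indicator_of_mem (show t ∈ Iio R from h), mul_left_comm, radial_pow hd s t ht]
      rw [e]
      refine ⟨by positivity, ?_⟩
      by_cases h1 : t ≤ 1
      · rw [hg]
        simp only
        rw [indicator_of_mem (show t ∈ Ioc (0:ℝ) 1 from ⟨ht, h1⟩),
          indicator_of_notMem (show t ∉ Ioc 1 R from fun hh => by linarith [hh.1]), add_zero]
        calc _ ≤ t^2 * t ^ (-1-2*s) := by gcongr; exact min_le_left _ _
          _ = t ^ (1-2*s) := by
            rw [← Real.rpow_natCast, ← Real.rpow_add ht]; congr 1; push_cast; ring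
      · push Not at h1
        rw [hg]
        simp only
        rw [indicator_of_notMem (show t ∉ Ioc (0:ℝ) 1 from fun hh => by linarith [hh.2]),
          indicator_of_mem (show t ∈ Ioc 1 R from ⟨h1, h.le⟩), zero_add]
        calc _ ≤ t * t ^ (-1-2*s) := by gcongr; exact min_le_right _ _
          _ = t ^ (-2*s) := by
            conv_lhs => rw [← Real.rpow_one t]
            rw [← Real.rpow_mul ht.le, ← Real.rpow_add ht]; congr 1; ring
          _ ≤ t ^ (-1:ℝ) := Real.rpow_le_rpow_of_exponent_le h1.le (by linarith)
          _ = _ := Real.rpow_neg_one t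
    · rw [hF, indicator_of_notMem (show t ∉ Iio R from h)]
      simp [hg0 t]
  have hI : IntegrableOn (fun t => t ^ (d-1) * F t) (Ioi 0) := by
    refine Integrable.mono' i3.integrableOn ?_ ?_
    · exact (Measurable.mul (by fun_prop) hFm).aestronglyMeasurable
    · refine (ae_restrict_iff' measurableSet_Ioi).2 (Eventually.of_forall fun t ht => ?_)
      rw [Real.norm_of_nonneg (hb t ht).1]; exact (hb t ht).2
  constructor
  · refine (integrable_fun_norm_addHaar (volume : Measure (EE d)) (f := F)).2 ?_
    simpa only [finrank_euclideanSpace, Fintype.card_fin, smul_eq_mul] using hI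
  · rw [integral_fun_norm_addHaar (volume : Measure (EE d)) F]
    simp only [finrank_euclideanSpace, Fintype.card_fin, smul_eq_mul, nsmul_eq_mul]
    rw [mul_assoc, mul_assoc]
    have hlog : 0 ≤ Real.log R := Real.log_nonneg hR
    have h3 : ∫ t in Ioi (0:ℝ), t ^ (d-1) * F t ≤ 1 / (2-2*s) + Real.log R := by
      rw [← hgi]
      calc _ ≤ ∫ t in Ioi (0:ℝ), g t :=
            setIntegral_mono_on hI i3.integrableOn measurableSet_Ioi (fun t ht => (hb t ht).2)
        _ ≤ _ := setIntegral_le_integral i3 (Eventually.of_forall hg0)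
    have h4 : 1 / (2-2*s) + Real.log R ≤ (1 / (2-2*s) + 1) * (1 + Real.log R) := by
      have : 0 ≤ 1 / (2-2*s) := by
        have : 0 < 2 - 2*s := by linarith
        positivity
      nlinarith
    gcongr
    exact h3.trans h4

/-- integrability on the product, in `(x,z)` coordinates -/
lemma int_xz {d : ℕ} (hd : 1 ≤ d) {s : ℝ} (hs0 : 0 < s) (hs1 : s < 1) (x₀ : EE d) (r : ℝ) :
    Integrable (fun p : EE d × EE d => (ball x₀ r).indicator 1 p.1 * mm d s p.2) := by
  have h1 : Integrable ((ball x₀ r).indicator (1 : EE d → ℝ)) :=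
    (integrable_indicator_iff measurableSet_ball).2
      (integrableOn_const (by exact measure_ball_lt_top.ne))
  exact h1.mul_prod (mm_integrable hd hs0 hs1)

lemma mp_shear (d : ℕ) : MeasurePreserving (fun p : EE d × EE d => (p.1, p.1 + p.2)) :=
  measurePreserving_prod_add (volume : Measure (EE d)) volume

lemma shear_int {d : ℕ} (F : EE d × EE d → ℝ) :
    ∫ p : EE d × EE d, F (p.1, p.1 + p.2) = ∫ p, F p :=
  (mp_shear d).integral_comp (MeasurableEquiv.shearAddRight (EE d)).measurableEmbedding F

lemma shear_integrable {d : ℕ} (F : EE d × EE d → ℝ) :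
    Integrable (fun p : EE d × EE d => F (p.1, p.1 + p.2)) ↔ Integrable F :=
  (mp_shear d).integrable_comp_emb (MeasurableEquiv.shearAddRight (EE d)).measurableEmbedding

lemma swap_int {d : ℕ} (F : EE d × EE d → ℝ) :
    ∫ p : EE d × EE d, F (p.2, p.1) = ∫ p, F p :=
  integral_prod_swap F

lemma int_xy {d : ℕ} (hd : 1 ≤ d) {s : ℝ} (hs0 : 0 < s) (hs1 : s < 1) (x₀ : EE d) (r : ℝ) :
    Integrable (fun p : EE d × EE d => (ball x₀ r).indicator 1 p.1 * mm d s (p.1 - p.2)) := by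
  rw [← shear_integrable]
  simp only [sub_add_cancel_left, mm_neg]
  exact int_xz hd hs0 hs1 x₀ r

noncomputable def dom (d : ℕ) (s : ℝ) (x₀ : EE d) (r : ℝ) (p : EE d × EE d) : ℝ :=
  ((ball x₀ r).indicator 1 p.1 + (ball x₀ r).indicator 1 p.2) * mm d s (p.1 - p.2)

lemma dom_integrable {d : ℕ} (hd : 1 ≤ d) {s : ℝ} (hs0 : 0 < s) (hs1 : s < 1) (x₀ : EE d) (r : ℝ) :
    Integrable (dom d s x₀ r) := by
  have h := int_xy hd hs0 hs1 x₀ r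
  have h2 := h.swap
  refine (h.add h2).congr (Eventually.of_forall fun p => ?_)
  simp only [Pi.add_apply, Function.comp, Prod.fst_swap, Prod.snd_swap, dom]
  rw [← mm_neg d s (p.2 - p.1), neg_sub]; ring

lemma int_of_dom {d : ℕ} (hd : 1 ≤ d) {s : ℝ} (hs0 : 0 < s) (hs1 : s < 1) (x₀ : EE d) (r C : ℝ)
    {F : EE d × EE d → ℝ} (hF : AEStronglyMeasurable F volume)
    (hb : ∀ p, |F p| ≤ C * dom d s x₀ r p) : Integrable F :=
  ((dom_integrable hd hs0 hs1 x₀ r).const_mul C).mono' hF (Eventually.of_forall hb)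

lemma ind_bounds {d : ℕ} (x₀ x : EE d) (r : ℝ) :
    0 ≤ (ball x₀ r).indicator (1 : EE d → ℝ) x := indicator_nonneg (fun _ _ => zero_le_one) _

lemma dom_nonneg (d : ℕ) (s : ℝ) (x₀ : EE d) (r : ℝ) (p : EE d × EE d) : 0 ≤ dom d s x₀ r p :=
  mul_nonneg (add_nonneg (ind_bounds _ _ _) (ind_bounds _ _ _)) (mm_nonneg _ _ _)


def LL {d : ℕ} (g : EE d → ℝ) : Prop :=
  ∀ x₀ : EE d, ∀ r : ℝ, ∃ L : ℝ, 0 ≤ L ∧ ∀ x ∈ ball x₀ r, ∀ y, |g x - g y| ≤ L * min 1 ‖x - y‖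

def CLip {d : ℕ} (ψ : EE d → ℝ) (x₀ : EE d) (r L : ℝ) : Prop :=
  0 ≤ L ∧ (∀ x, |ψ x| ≤ L) ∧ (∀ x y, |ψ x - ψ y| ≤ L * min 1 ‖x - y‖) ∧
    ∀ x, x ∉ ball x₀ r → ψ x = 0

lemma LL_of_C1 {d : ℕ} {g : EE d → ℝ} (hg : ContDiff ℝ 1 g) {c : ℝ} (hc : ∀ x, |g x| ≤ c) :
    LL g := by
  intro x₀ r
  have hcont : Continuous (fderiv ℝ g) := hg.continuous_fderiv (by norm_num)
  obtain ⟨M, hM⟩ := (isCompact_closedBall x₀ (r+1)).exists_bound_of_continuousOn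
    hcont.continuousOn
  have hc0 : 0 ≤ c := (abs_nonneg _).trans (hc x₀)
  refine ⟨max M (2*c), le_max_of_le_right (by linarith), ?_⟩
  intro x hx y
  by_cases h : ‖x - y‖ ≤ 1
  · rw [min_eq_right h]
    have hy : y ∈ closedBall x₀ (r+1) := by
      rw [mem_closedBall]
      calc dist y x₀ ≤ dist y x + dist x x₀ := dist_triangle _ _ _
        _ ≤ 1 + r := by
          rw [dist_comm y x, dist_eq_norm]
          have := mem_ball.1 hx; linarith
        _ = r + 1 := by ring
    have hx' : x ∈ closedBall x₀ (r+1) := by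
      rw [mem_closedBall]; have := mem_ball.1 hx; linarith
    have := (convex_closedBall x₀ (r+1)).norm_image_sub_le_of_norm_fderiv_le (𝕜 := ℝ)
      (fun z _ => (hg.differentiable (by norm_num)) z) hM hy hx'
    rw [Real.norm_eq_abs] at this
    exact this.trans (by gcongr; exact le_max_left _ _)
  · push Not at h
    rw [min_eq_left h.le, mul_one]
    calc |g x - g y| ≤ |g x| + |g y| := abs_sub _ _
      _ ≤ 2*c := by linarith [hc x, hc y]
      _ ≤ _ := le_max_right _ _

lemma LL.sub {d : ℕ} {g k : EE d → ℝ} (hg : LL g) (hk : LL k) : LL (fun x => g x - k x) := by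
  intro x₀ r
  obtain ⟨L, hL, h⟩ := hg x₀ r
  obtain ⟨M, hM, h'⟩ := hk x₀ r
  refine ⟨L + M, by positivity, fun x hx y => ?_⟩
  have h1 := h x hx y
  have h2 := h' x hx y
  calc |g x - k x - (g y - k y)| = |(g x - g y) - (k x - k y)| := by ring_nf
    _ ≤ |g x - g y| + |k x - k y| := abs_sub _ _
    _ ≤ _ := by linarith

lemma LL.abs {d : ℕ} {g : EE d → ℝ} (hg : LL g) : LL (fun x => |g x|) := by
  intro x₀ r
  obtain ⟨L, hL, h⟩ := hg x₀ r
  exact ⟨L, hL, fun x hx y => (abs_abs_sub_abs_le _ _).trans (h x hx y)⟩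

lemma LL.shift {d : ℕ} {g : EE d → ℝ} (hg : LL g) (e : EE d) : LL (fun x => g (x + e)) := by
  intro x₀ r
  obtain ⟨L, hL, h⟩ := hg (x₀ + e) r
  refine ⟨L, hL, fun x hx y => ?_⟩
  have := h (x+e) (by simpa [mem_ball] using hx) (y+e)
  simpa using this

lemma CLip.mul {d : ℕ} {χ g : EE d → ℝ} {x₀ : EE d} {r L c : ℝ} (hχ : CLip χ x₀ r L) (hg : LL g)
    (hc : ∀ x, |g x| ≤ c) : ∃ L', CLip (fun x => χ x * g x) x₀ r L' := by
  obtain ⟨h0, h1, h2, h3⟩ := hχ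
  obtain ⟨M, hM, h⟩ := hg x₀ r
  have hc0 : 0 ≤ c := (abs_nonneg _).trans (hc x₀)
  refine ⟨L * c + L * M, by positivity, fun x => ?_, fun x y => ?_, fun x hx => by simp [h3 x hx]⟩
  · rw [abs_mul]
    have := mul_le_mul (h1 x) (hc x) (abs_nonneg _) h0
    have : 0 ≤ L * M := by positivity
    linarith
  · have hm : 0 ≤ min 1 ‖x - y‖ := by positivity
    have e : χ x * g x - χ y * g y = (χ x - χ y) * g y + χ x * (g x - g y) := by ring
    rw [e]
    have a1 : |(χ x - χ y) * g y| ≤ (L * min 1 ‖x - y‖) * c := by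
      rw [abs_mul]; exact mul_le_mul (h2 x y) (hc y) (abs_nonneg _) (by positivity)
    have a2 : |χ x * (g x - g y)| ≤ L * (M * min 1 ‖x-y‖) := by
      by_cases hx : x ∈ ball x₀ r
      · rw [abs_mul]; exact mul_le_mul (h1 x) (h x hx y) (abs_nonneg _) h0
      · rw [h3 x hx]; simp; positivity
    refine (abs_add_le _ _).trans ?_
    linarith

lemma CLip.continuous {d : ℕ} {χ : EE d → ℝ} {x₀ : EE d} {r L : ℝ} (hχ : CLip χ x₀ r L) :
    Continuous χ := by
  obtain ⟨h0, h1, h2, h3⟩ := hχ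
  refine (LipschitzWith.of_dist_le_mul (K := ⟨L, h0⟩) fun x y => ?_).continuous
  rw [Real.dist_eq, dist_eq_norm]
  exact (h2 x y).trans (mul_le_mul_of_nonneg_left (min_le_right _ _) h0)

lemma CLip.hcs {d : ℕ} {χ : EE d → ℝ} {x₀ : EE d} {r L : ℝ} (hχ : CLip χ x₀ r L) :
    HasCompactSupport χ := by
  refine HasCompactSupport.intro (isCompact_closedBall x₀ r) fun x hx => ?_
  exact hχ.2.2.2 x (fun h => hx (ball_subset_closedBall h))

lemma CLip.integrable_mul {d : ℕ} {χ g : EE d → ℝ} {x₀ : EE d} {r L : ℝ} (hχ : CLip χ x₀ r L)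
    (hg : Continuous g) : Integrable (fun x => χ x * g x) :=
  (hχ.continuous.mul hg).integrable_of_hasCompactSupport hχ.hcs.mul_right

lemma CLip.diff_le {d : ℕ} {χ : EE d → ℝ} {x₀ : EE d} {r L : ℝ} (hχ : CLip χ x₀ r L) (x y : EE d) :
    |χ x - χ y| ≤ L * min 1 ‖x-y‖ *
      ((ball x₀ r).indicator 1 x + (ball x₀ r).indicator 1 y) := by
  obtain ⟨h0, h1, h2, h3⟩ := hχ
  have hm : 0 ≤ L * min 1 ‖x - y‖ := by positivity
  have hx0 := ind_bounds x₀ x r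
  have hy0 := ind_bounds x₀ y r
  by_cases hx : x ∈ ball x₀ r
  · have : (ball x₀ r).indicator (1 : EE d → ℝ) x = 1 := indicator_of_mem hx _
    rw [this]
    refine (h2 x y).trans (le_mul_of_one_le_right hm (by linarith))
  · by_cases hy : y ∈ ball x₀ r
    · have : (ball x₀ r).indicator (1 : EE d → ℝ) y = 1 := indicator_of_mem hy _
      rw [this]
      refine (h2 x y).trans (le_mul_of_one_le_right hm (by linarith))
    · rw [h3 x hx, h3 y hy]; simp only [sub_self, abs_zero]; positivity

lemma min_sq_le {s t : ℝ} (hs0 : 0 < s) (hs1 : s < 1) (ht : 0 ≤ t) :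
    min 1 t * min 1 t ≤ min 1 (t ^ (1+s)) := by
  rcases le_total t 1 with h | h
  · rw [min_eq_right h, min_eq_right (Real.rpow_le_one ht h (by linarith))]
    rcases ht.eq_or_lt with h0 | h0
    · rw [← h0]; simp; positivity
    · calc t * t = t ^ (2:ℝ) := by rw [Real.rpow_two]; ring
        _ ≤ _ := Real.rpow_le_rpow_of_exponent_ge h0 h (by linarith)
  · rw [min_eq_left h, min_eq_left (Real.one_le_rpow h (by linarith))]; simp

/-- second differences -/
lemma sd_bound {d : ℕ} {u : EE d → ℝ} (hu : ContDiff ℝ 2 u) (hb : ∀ x, |u x| ≤ 1)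
    {s : ℝ} (hs0 : 0 < s) (hs1 : s < 1) (x₀ : EE d) (r : ℝ) :
    ∃ L : ℝ, 0 ≤ L ∧ ∀ x ∈ ball x₀ r, ∀ z,
      |2 * u x - u (x+z) - u (x-z)| ≤ L * min 1 (‖z‖ ^ (1+s)) := by
  have hd1 : ContDiff ℝ 1 (fderiv ℝ u) := hu.fderiv_right (by norm_num)
  obtain ⟨M, hM⟩ := (isCompact_closedBall x₀ (r+1)).exists_bound_of_continuousOn
    (hd1.continuous_fderiv (by norm_num)).continuousOn
  refine ⟨max 4 (2*M), le_max_of_le_left (by norm_num), ?_⟩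
  intro x hx z
  refine le_trans ?_ (mul_le_mul_of_nonneg_left (min_sq_le hs0 hs1 (norm_nonneg z))
    (le_max_of_le_left (by norm_num)))
  have hx' := mem_ball.1 hx
  by_cases h : ‖z‖ ≤ 1
  · rw [min_eq_right h]
    have hmem : ∀ t ∈ Icc (-1:ℝ) 1, x + t • z ∈ closedBall x₀ (r+1) := by
      intro t ht
      rw [mem_closedBall, dist_eq_norm]
      have : x + t • z - x₀ = (x - x₀) + t • z := by abel
      rw [this]
      have h2 : ‖t • z‖ ≤ 1 := by
        rw [norm_smul, Real.norm_eq_abs]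
        have : |t| ≤ 1 := abs_le.2 ht
        calc |t| * ‖z‖ ≤ 1 * 1 := by gcongr
          _ = 1 := by norm_num
      have := norm_add_le (x - x₀) (t • z)
      rw [dist_eq_norm] at hx'
      linarith
    have hdu : Differentiable ℝ u := hu.differentiable (by norm_num)
    set g : ℝ → ℝ := fun t => u (x + t • z) + u (x - t • z) with hgdef
    have hg : ∀ t : ℝ, HasDerivAt g ((fderiv ℝ u (x + t • z)) z - (fderiv ℝ u (x - t • z)) z) t := by
      intro t
      have l1 : HasDerivAt (fun t : ℝ => x + t • z) z t := by
        simpa using ((hasDerivAt_id t).smul_const z).const_add x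
      have l2 : HasDerivAt (fun t : ℝ => x - t • z) (-z) t := by
        simpa using ((hasDerivAt_id t).smul_const z).const_sub x
      have k1 := (hdu (x + t • z)).hasFDerivAt.comp_hasDerivAt t l1
      have k2 := (hdu (x - t • z)).hasFDerivAt.comp_hasDerivAt t l2
      have := k1.add k2
      rw [map_neg, ← sub_eq_add_neg] at this
      exact this
    have hbound : ∀ t ∈ Icc (0:ℝ) 1,
        ‖(fderiv ℝ u (x + t • z)) z - (fderiv ℝ u (x - t • z)) z‖ ≤ 2 * M * (‖z‖ * ‖z‖) := by
      intro t ht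
      have m1 := hmem t ⟨by linarith [ht.1], ht.2⟩
      have m2 := hmem (-t) ⟨by linarith [ht.2], by linarith [ht.1]⟩
      have e2 : x + (-t) • z = x - t • z := by rw [neg_smul, sub_eq_add_neg]
      rw [e2] at m2
      have := (convex_closedBall x₀ (r+1)).norm_image_sub_le_of_norm_fderiv_le (𝕜 := ℝ)
        (fun z _ => (hd1.differentiable (by norm_num)) z) hM m2 m1
      rw [← sub_apply]
      refine (ContinuousLinearMap.le_opNorm _ _).trans ?_
      have M0 : 0 ≤ M := (norm_nonneg _).trans (hM _ m1)
      have e3 : x + t • z - (x - t • z) = (2 * t) • z := by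
        rw [mul_smul, two_smul]; abel
      rw [e3, norm_smul, Real.norm_eq_abs, abs_of_nonneg (by linarith [ht.1])] at this
      calc _ ≤ M * (2 * t * ‖z‖) * ‖z‖ := by gcongr
        _ ≤ M * (2 * 1 * ‖z‖) * ‖z‖ := by gcongr; exact ht.2
        _ = _ := by ring
    have := (convex_Icc (0:ℝ) 1).norm_image_sub_le_of_norm_hasDerivWithin_le
      (fun t _ => (hg t).hasDerivWithinAt) hbound (left_mem_Icc.2 zero_le_one)
      (right_mem_Icc.2 zero_le_one)
    simp only [hgdef, one_smul, zero_smul, add_zero, sub_zero, Real.norm_eq_abs, abs_one,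
      mul_one] at this
    calc |2 * u x - u (x+z) - u (x-z)| = |u (x + z) + u (x - z) - (u x + u x)| := by
          rw [abs_sub_comm]; ring_nf
      _ ≤ 2 * M * (‖z‖ * ‖z‖) := this
      _ ≤ _ := by gcongr; exact le_max_right _ _
  · push Not at h
    rw [min_eq_left h.le]
    have a1 := abs_le.1 (hb x)
    have a2 := abs_le.1 (hb (x+z))
    have a3 := abs_le.1 (hb (x-z))
    have : |2 * u x - u (x+z) - u (x-z)| ≤ 4 := by
      rw [abs_le]; constructor <;> linarith
    calc _ ≤ (4:ℝ) := this
      _ ≤ max 4 (2*M) := le_max_left _ _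
      _ = _ := by ring

/-- products of differences are integrable -/
lemma prod_integrable {d : ℕ} (hd : 1 ≤ d) {s : ℝ} (hs0 : 0 < s) (hs1 : s < 1)
    {u ψ : EE d → ℝ} (hu : LL u) (huc : Continuous u) {x₀ : EE d} {r L : ℝ} (hψ : CLip ψ x₀ r L) :
    Integrable (fun p : EE d × EE d =>
      (u p.1 - u p.2) * (ψ p.1 - ψ p.2) * frk d s (p.1 - p.2)) := by
  obtain ⟨M, hM, h⟩ := hu x₀ r
  have hψc := hψ.continuous
  refine int_of_dom hd hs0 hs1 x₀ r (M * L) ?_ ?_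
  · have := frk_meas d s
    have h1 : Measurable u := huc.measurable
    have h2 : Measurable ψ := hψc.measurable
    exact Measurable.aestronglyMeasurable (by fun_prop)
  · rintro ⟨x, y⟩
    have h4 : 0 ≤ frk d s (x - y) := frk_nonneg _ _ _
    have hm : 0 ≤ min 1 ‖x - y‖ := by positivity
    have i1 := ind_bounds x₀ x r
    have i2 := ind_bounds x₀ y r
    simp only [abs_mul, abs_of_nonneg h4, dom]
    have hd := hψ.diff_le x y
    have h0 := hψ.1
    by_cases hxy : x ∉ ball x₀ r ∧ y ∉ ball x₀ r
    · rw [hψ.2.2.2 x hxy.1, hψ.2.2.2 y hxy.2]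
      simp only [sub_self, abs_zero, mul_zero, zero_mul]
      have := mm_nonneg d s (x-y)
      positivity
    · have hu' : |u x - u y| ≤ M * min 1 ‖x-y‖ := by
        by_cases hx : x ∈ ball x₀ r
        · exact h x hx y
        · have hy : y ∈ ball x₀ r := by
            by_contra hy; exact hxy ⟨hx, hy⟩
          rw [abs_sub_comm, norm_sub_rev]; exact h y hy x
      calc |u x - u y| * |ψ x - ψ y| * frk d s (x-y)
          ≤ (M * min 1 ‖x-y‖) * (L * min 1 ‖x-y‖ *
            ((ball x₀ r).indicator 1 x + (ball x₀ r).indicator 1 y)) * frk d s (x-y) := by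
              gcongr
        _ = M * L * (((ball x₀ r).indicator 1 x + (ball x₀ r).indicator 1 y) *
            ((min 1 ‖x-y‖ * min 1 ‖x-y‖) * frk d s (x-y))) := by ring
        _ ≤ _ := by
            unfold mm
            gcongr
            exact min_sq_le hs0 hs1 (norm_nonneg _)

/-- weak formulation -/
lemma weak_form {d : ℕ} (hd : 1 ≤ d) {s : ℝ} (hs0 : 0 < s) (hs1 : s < 1)
    {u ψ : EE d → ℝ} (hu : ContDiff ℝ 2 u) (hb : ∀ x, |u x| ≤ 1)
    {x₀ : EE d} {r L : ℝ} (hψ : CLip ψ x₀ r L) :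
    ∫ p : EE d × EE d, (u p.1 - u p.2) * (ψ p.1 - ψ p.2) * frk d s (p.1 - p.2) =
      ∫ x, ψ x * ∫ z, (2 * u x - u (x+z) - u (x-z)) * frk d s z := by
  have huc : Continuous u := hu.continuous
  have hψc := hψ.continuous
  have hLL : LL u := LL_of_C1 (hu.of_le (by norm_num)) hb
  have hI := prod_integrable hd hs0 hs1 hLL huc hψ
  rw [← shear_int]
  rw [← shear_integrable] at hI
  simp only [sub_add_cancel_left, frk_neg] at hI ⊢
  obtain ⟨M, hM, h⟩ := sd_bound hu hb hs0 hs1 x₀ r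
  have hF : Integrable (fun p : EE d × EE d =>
      ψ p.1 * ((2 * u p.1 - u (p.1+p.2) - u (p.1-p.2)) * frk d s p.2)) := by
    refine ((int_xz hd hs0 hs1 x₀ r).const_mul (L * M)).mono' ?_ (Eventually.of_forall ?_)
    · have := frk_meas d s
      have h1 : Measurable u := huc.measurable
      have h2 : Measurable ψ := hψc.measurable
      exact Measurable.aestronglyMeasurable (by fun_prop)
    · rintro ⟨x, z⟩
      have h4 : 0 ≤ frk d s z := frk_nonneg _ _ _
      simp only [Real.norm_eq_abs, abs_mul, abs_of_nonneg h4]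
      have h0 := hψ.1
      by_cases hx : x ∈ ball x₀ r
      · rw [indicator_of_mem hx]
        unfold mm
        have := h x hx z
        have := hψ.2.1 x
        calc _ ≤ L * ((M * min 1 (‖z‖^(1+s))) * frk d s z) := by gcongr
          _ = _ := by simp; ring
      · rw [hψ.2.2.2 x hx, indicator_of_notMem hx]; simp
  have e1 : ∫ x, ψ x * ∫ z, (2 * u x - u (x+z) - u (x-z)) * frk d s z =
      ∫ z, ∫ x, ψ x * ((2 * u x - u (x+z) - u (x-z)) * frk d s z) := by
    rw [← integral_integral_swap hF]
    simp_rw [integral_const_mul]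
  rw [e1, Measure.volume_eq_prod, integral_prod_symm _ hI]
  congr 1
  ext z
  simp only
  rw [integral_mul_const]
  simp_rw [← mul_assoc]
  rw [integral_mul_const]
  congr 1
  have j1 : Integrable (fun x => ψ x * (u x - u (x+z))) :=
    hψ.integrable_mul (by fun_prop)
  have j2 : Integrable (fun x => ψ x * (u x - u (x-z))) :=
    hψ.integrable_mul (by fun_prop)
  have e2 : ∫ x, ψ (x+z) * (u (x+z) - u x) = ∫ x, ψ x * (u x - u (x-z)) := by
    rw [← integral_add_right_eq_self (fun x => ψ x * (u x - u (x-z))) z]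
    simp
  have j3 : Integrable (fun x => ψ (x+z) * (u (x+z) - u x)) := by
    have := j2.comp_add_right z
    simpa using this
  calc ∫ x, (u x - u (x+z)) * (ψ x - ψ (x+z))
      = ∫ x, (ψ x * (u x - u (x+z)) + ψ (x+z) * (u (x+z) - u x)) := by
        congr 1; ext x; ring
    _ = (∫ x, ψ x * (u x - u (x+z))) + ∫ x, ψ x * (u x - u (x-z)) := by
        rw [integral_add j1 j3, e2]
    _ = ∫ x, ψ x * (2 * u x - u (x + z) - u (x - z)) := by
        rw [← integral_add j1 j2]; congr 1; ext x; ring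


lemma CLip.LL {d : ℕ} {χ : EE d → ℝ} {x₀ : EE d} {r L : ℝ} (hχ : CLip χ x₀ r L) : LL χ :=
  fun _ _ => ⟨L, hχ.1, fun x _ y => hχ.2.2.1 x y⟩

lemma CLip.sq_integrable {d : ℕ} (hd : 1 ≤ d) {s : ℝ} (hs0 : 0 < s) (hs1 : s < 1)
    {χ : EE d → ℝ} {x₀ : EE d} {r L : ℝ} (hχ : CLip χ x₀ r L) :
    Integrable (fun p : EE d × EE d => (χ p.1 - χ p.2) ^ 2 * frk d s (p.1 - p.2)) := by
  have := prod_integrable hd hs0 hs1 hχ.LL hχ.continuous hχ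
  simpa only [← pow_two] using this

lemma CLip.sq_dom {d : ℕ} {s : ℝ} (hs0 : 0 < s) (hs1 : s < 1)
    {χ : EE d → ℝ} {x₀ : EE d} {r L : ℝ} (hχ : CLip χ x₀ r L) (p : EE d × EE d) :
    (χ p.1 - χ p.2) ^ 2 * frk d s (p.1 - p.2) ≤ L ^ 2 * dom d s x₀ r p := by
  have h1 := hχ.diff_le p.1 p.2
  have h2 := hχ.2.2.1 p.1 p.2
  have h0 := hχ.1
  have hm : 0 ≤ min 1 ‖p.1 - p.2‖ := by positivity
  have i1 := ind_bounds x₀ p.1 r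
  have i2 := ind_bounds x₀ p.2 r
  have hk := frk_nonneg d s (p.1 - p.2)
  have h3 : (χ p.1 - χ p.2)^2 ≤ (L * min 1 ‖p.1 - p.2‖) * (L * min 1 ‖p.1-p.2‖ *
      ((ball x₀ r).indicator 1 p.1 + (ball x₀ r).indicator 1 p.2)) := by
    rw [← sq_abs, pow_two]
    exact mul_le_mul h2 h1 (abs_nonneg _) (by positivity)
  unfold dom mm
  calc _ ≤ (L * min 1 ‖p.1 - p.2‖) * (L * min 1 ‖p.1-p.2‖ *
      ((ball x₀ r).indicator 1 p.1 + (ball x₀ r).indicator 1 p.2)) * frk d s (p.1 - p.2) := by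
        gcongr
    _ = L^2 * (((ball x₀ r).indicator 1 p.1 + (ball x₀ r).indicator 1 p.2) *
        ((min 1 ‖p.1-p.2‖ * min 1 ‖p.1-p.2‖) * frk d s (p.1-p.2))) := by ring
    _ ≤ _ := by
      gcongr
      exact min_sq_le hs0 hs1 (norm_nonneg _)

lemma mollify {d : ℕ} {η : EE d → ℝ} {x₀ : EE d} {r L : ℝ} (hη : CLip η x₀ r L) (n : ℕ) :
    ∃ g : EE d → ℝ, ContDiff ℝ (⊤ : ℕ∞) g ∧ HasCompactSupport g ∧ CLip g x₀ (r+1) L ∧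
      ∀ x, |g x - η x| ≤ L * (1 / ((n:ℝ)+1)) := by
  have hn : (0:ℝ) < 1 / ((n:ℝ)+1) := by positivity
  have hn1 : 1 / ((n:ℝ)+1) ≤ 1 := by
    rw [div_le_one (by positivity)]; linarith [(Nat.cast_nonneg n : (0:ℝ) ≤ n)]
  let b : ContDiffBump (0 : EE d) := ⟨1 / ((n:ℝ)+1) / 2, 1 / ((n:ℝ)+1), by positivity, by linarith⟩
  have hbr : b.rOut = 1 / ((n:ℝ)+1) := rfl
  obtain ⟨h0, h1, h2, h3⟩ := id hη
  have hc := hη.continuous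
  let g : EE d → ℝ := convolution (b.normed volume) η (ContinuousLinearMap.lsmul ℝ ℝ) volume
  have hgx : ∀ x, g x = ∫ t, b.normed volume t * η (x - t) := fun x => rfl
  have hbi : ∀ x, Integrable (fun t => b.normed volume t * η (x - t)) := by
    intro x
    refine Continuous.integrable_of_hasCompactSupport ?_ ?_
    · exact b.continuous_normed.mul (by fun_prop)
    · exact b.hasCompactSupport_normed.mul_right
  have hcl : CLip g x₀ (r+1) L := by
    refine ⟨h0, fun x => ?_, fun x y => ?_, fun x hx => ?_⟩
    · rw [hgx]
      have : ∀ t, ‖b.normed volume t * η (x - t)‖ ≤ b.normed volume t * L := by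
        intro t
        rw [norm_mul, Real.norm_of_nonneg (b.nonneg_normed t)]
        gcongr
        · exact b.nonneg_normed t
        · exact h1 _
      rw [← Real.norm_eq_abs]
      refine (norm_integral_le_of_norm_le (b.integrable_normed.mul_const _)
        (Eventually.of_forall this)).trans ?_
      rw [integral_mul_const, b.integral_normed, one_mul]
    · rw [hgx, hgx, ← integral_sub (hbi x) (hbi y)]
      have : ∀ t, ‖b.normed volume t * η (x - t) - b.normed volume t * η (y - t)‖ ≤
          b.normed volume t * (L * min 1 ‖x-y‖) := by
        intro t
        rw [← mul_sub, norm_mul, Real.norm_of_nonneg (b.nonneg_normed t)]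
        have := h2 (x - t) (y - t)
        rw [sub_sub_sub_cancel_right] at this
        gcongr
        · exact b.nonneg_normed t
        · exact this
      rw [← Real.norm_eq_abs]
      refine (norm_integral_le_of_norm_le (b.integrable_normed.mul_const _)
        (Eventually.of_forall this)).trans ?_
      rw [integral_mul_const, b.integral_normed, one_mul]
    · have hx0 : η x = 0 := h3 x (fun hh => hx (ball_subset_ball (by linarith) hh))
      have := b.dist_normed_convolution_le (μ := volume) (g := η) (x₀ := x) (ε := 0)
        hc.aestronglyMeasurable (fun y hy => by
          rw [h3 y, hx0]; · simp
          intro hy2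
          apply hx
          rw [mem_ball] at hy hy2 ⊢
          rw [hbr] at hy
          have := dist_triangle x y x₀
          rw [dist_comm x y] at this
          linarith)
      have h4 := dist_le_zero.1 this
      exact h4.trans hx0
  refine ⟨g, ?_, hcl.hcs, hcl, fun x => ?_⟩
  · exact b.hasCompactSupport_normed.contDiff_convolution_left _ b.contDiff_normed
      hc.locallyIntegrable
  · have := b.dist_normed_convolution_le (μ := volume) (g := η) (x₀ := x)
        (ε := L * (1 / ((n:ℝ)+1)))
        hc.aestronglyMeasurable (fun y hy => by
          rw [mem_ball, dist_eq_norm, hbr] at hy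
          rw [Real.dist_eq]
          refine (h2 y x).trans (mul_le_mul_of_nonneg_left ?_ h0)
          exact (min_le_right _ _).trans hy.le)
    exact this

lemma stab_ext {d : ℕ} (hd : 1 ≤ d) {s : ℝ} (hs0 : 0 < s) (hs1 : s < 1)
    {V : EE d → ℝ} (hV : Continuous V) {c : ℝ}
    (hst : ∀ η : EE d → ℝ, ContDiff ℝ (⊤ : ℕ∞) η → HasCompactSupport η →
      ∫ x, V x * (η x)^2 ≤ c * ∫ x, ∫ y, (η x - η y)^2 / ‖x - y‖ ^ ((d : ℝ) + 2*s))
    {η : EE d → ℝ} {x₀ : EE d} {r L : ℝ} (hη : CLip η x₀ r L) :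
    ∫ x, V x * (η x)^2 ≤
      c * ∫ p : EE d × EE d, (η p.1 - η p.2) ^ 2 * frk d s (p.1 - p.2) := by
  choose g hg1 hg2 hg3 hg4 using mollify hη
  have hlim : ∀ x, Tendsto (fun n => g n x) atTop (𝓝 (η x)) := by
    intro x
    rw [tendsto_iff_norm_sub_tendsto_zero]
    refine squeeze_zero (fun n => norm_nonneg _) (fun n => hg4 n x) ?_
    simpa using (tendsto_one_div_add_atTop_nhds_zero_nat (𝕜 := ℝ)).const_mul L
  have hk := frk_meas d s
  have key : ∀ n, ∫ x, V x * (g n x)^2 ≤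
      c * ∫ p : EE d × EE d, (g n p.1 - g n p.2) ^ 2 * frk d s (p.1 - p.2) := by
    intro n
    refine (hst (g n) (hg1 n) (hg2 n)).trans (le_of_eq ?_)
    congr 1
    have := (hg3 n).sq_integrable hd hs0 hs1
    rw [Measure.volume_eq_prod] at this ⊢
    rw [integral_prod _ this]
    rfl
  have h0 := hη.1
  have t1 : Tendsto (fun n => ∫ x, V x * (g n x)^2) atTop (𝓝 (∫ x, V x * (η x)^2)) := by
    refine tendsto_integral_of_dominated_convergence
      (fun x => |V x| * (L^2 * (ball x₀ (r+1)).indicator 1 x)) ?_ ?_ ?_ ?_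
    · intro n
      have : Continuous (g n) := (hg3 n).continuous
      exact Continuous.aestronglyMeasurable (by fun_prop)
    · have : (fun x => |V x| * (L^2 * (ball x₀ (r+1)).indicator 1 x)) =
          (ball x₀ (r+1)).indicator (fun x => |V x| * L^2) := by
        ext x
        by_cases hx : x ∈ ball x₀ (r+1) <;> simp [hx]
      rw [this, integrable_indicator_iff measurableSet_ball]
      have : IntegrableOn (fun x => |V x| * L^2) (closedBall x₀ (r+1)) :=
        ContinuousOn.integrableOn_compact (isCompact_closedBall _ _)
          (Continuous.continuousOn (by fun_prop))
      exact this.mono_set ball_subset_closedBall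
    · intro n
      refine Eventually.of_forall fun x => ?_
      rw [norm_mul, Real.norm_eq_abs, Real.norm_of_nonneg (sq_nonneg _)]
      gcongr
      by_cases hx : x ∈ ball x₀ (r+1)
      · rw [indicator_of_mem hx]; simp only [Pi.one_apply, mul_one]
        rw [← sq_abs]
        exact pow_le_pow_left₀ (abs_nonneg _) ((hg3 n).2.1 x) 2
      · rw [(hg3 n).2.2.2 x hx, indicator_of_notMem hx]; simp
    · exact Eventually.of_forall fun x => ((hlim x).pow 2).const_mul _
  have t2 : Tendsto (fun n => ∫ p : EE d × EE d, (g n p.1 - g n p.2) ^ 2 * frk d s (p.1 - p.2))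
      atTop (𝓝 (∫ p : EE d × EE d, (η p.1 - η p.2) ^ 2 * frk d s (p.1 - p.2))) := by
    refine tendsto_integral_of_dominated_convergence
      (fun p => L^2 * dom d s x₀ (r+1) p) ?_ ?_ ?_ ?_
    · intro n
      exact ((hg3 n).sq_integrable hd hs0 hs1).aestronglyMeasurable
    · exact (dom_integrable hd hs0 hs1 _ _).const_mul _
    · intro n
      refine Eventually.of_forall fun p => ?_
      rw [Real.norm_of_nonneg (mul_nonneg (sq_nonneg _) (frk_nonneg _ _ _))]
      exact (hg3 n).sq_dom hs0 hs1 p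
    · exact Eventually.of_forall fun p =>
        ((((hlim p.1).sub (hlim p.2)).pow 2)).mul_const _
  exact le_of_tendsto_of_tendsto' t1 (t2.const_mul c) key


lemma rp_lip {p : ℝ} (hp : 0 < p) {r : ℝ} (hr : 1/3 ≤ r) :
    |r ^ (-p) - 1| ≤ p * 3 ^ (p+1) * |r - 1| := by
  have hconv := convex_Ici (𝕜 := ℝ) (1/3:ℝ)
  have := Convex.norm_image_sub_le_of_norm_hasDerivWithin_le (𝕜 := ℝ)
    (f := fun r : ℝ => r ^ (-p)) (f' := fun r => (-p) * r ^ (-p-1)) (C := p * 3 ^ (p+1))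
    (x := 1) (y := r) (fun x hx => ?_) (fun x hx => ?_) hconv (by norm_num [mem_Ici]) hr
  · simpa using this
  · have hx0 : (0:ℝ) < x := lt_of_lt_of_le (by norm_num) hx
    exact (Real.hasDerivAt_rpow_const (Or.inl hx0.ne')).hasDerivWithinAt
  · have hx0 : (0:ℝ) < x := lt_of_lt_of_le (by norm_num) hx
    have hx1 : (1/3:ℝ) ≤ x := hx
    rw [norm_mul, norm_neg, Real.norm_of_nonneg hp.le, Real.norm_of_nonneg (by positivity)]
    gcongr
    have h1 : x ^ (-p-1) ≤ (1/3:ℝ) ^ (-p-1) :=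
      Real.rpow_le_rpow_of_nonpos (by norm_num) hx1 (by linarith)
    refine h1.trans (le_of_eq ?_)
    rw [show -p-1 = -(p+1) by ring, one_div, Real.inv_rpow (by norm_num), Real.rpow_neg (by norm_num),
      inv_inv]

lemma rp_taylor {p : ℝ} (hp : 0 < p) {r : ℝ} (hr : 1/3 ≤ r) :
    |r ^ (-p) - 1 + p * (r - 1)| ≤ p * ((p+1) * 3 ^ (p+2)) * |r - 1| ^ 2 := by
  have hconv := convex_uIcc (𝕜 := ℝ) (1:ℝ) r
  have hsub : ∀ x ∈ uIcc 1 r, 1/3 ≤ x ∧ |x - 1| ≤ |r - 1| := by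
    intro x hx
    refine ⟨?_, abs_sub_left_of_mem_uIcc hx⟩
    have : min 1 r ≤ x := hx.1
    have h2 : (1/3:ℝ) ≤ min 1 r := le_min (by norm_num) hr
    linarith
  have := Convex.norm_image_sub_le_of_norm_hasDerivWithin_le (𝕜 := ℝ)
    (f := fun r : ℝ => r ^ (-p) - 1 + p * (r - 1)) (f' := fun r => (-p) * r ^ (-p-1) + p * 1)
    (C := p * ((p+1) * 3 ^ (p+2)) * |r - 1|)
    (x := 1) (y := r) (fun x hx => ?_) (fun x hx => ?_) hconv left_mem_uIcc right_mem_uIcc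
  · rw [pow_two, ← mul_assoc]
    simpa using this
  · have hx0 : (0:ℝ) < x := lt_of_lt_of_le (by norm_num) (hsub x hx).1
    exact (((Real.hasDerivAt_rpow_const (Or.inl hx0.ne')).sub_const 1).add
      (((hasDerivAt_id x).sub_const 1).const_mul p)).hasDerivWithinAt
  · obtain ⟨hx1, hx2⟩ := hsub x hx
    have h1 := rp_lip (p := p + 1) (by linarith) hx1
    have : -p * x ^ (-p-1) + p * 1 = -(p * (x ^ (-(p+1)) - 1)) := by
      rw [show -p-1 = -(p+1) by ring]; ring
    rw [this, norm_neg, norm_mul, Real.norm_of_nonneg hp.le, mul_assoc]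
    refine mul_le_mul_of_nonneg_left (h1.trans ?_) hp.le
    rw [show p + 1 + 1 = p + 2 by ring]
    gcongr

noncomputable def kh (d : ℕ) (s h : ℝ) (z : EE d) : ℝ := (‖z‖^2+h^2) ^ (-(((d:ℝ)+2*s)/2))

lemma kh_pos (d : ℕ) (s : ℝ) {h : ℝ} (hh : 0 < h) (z : EE d) : 0 < kh d s h z :=
  Real.rpow_pos_of_pos (by positivity) _

lemma kh_cont (d : ℕ) (s : ℝ) {h : ℝ} (hh : 0 < h) : Continuous (kh d s h) := by
  unfold kh
  refine Continuous.rpow_const (by fun_prop) (fun z => Or.inl ?_)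
  positivity

lemma kh_neg (d : ℕ) (s h : ℝ) (z : EE d) : kh d s h (-z) = kh d s h z := by
  unfold kh; rw [norm_neg]

lemma frk_eq {d : ℕ} {s : ℝ} {z : EE d} : 
    frk d s z = (‖z‖^2) ^ (-(((d:ℝ)+2*s)/2)) := by
  unfold frk
  rw [Real.rpow_neg (by positivity), ← Real.rpow_natCast, ← Real.rpow_mul (norm_nonneg _)]
  congr 2
  push_cast; ring

lemma kh_le {d : ℕ} {s : ℝ} (hs0 : 0 < s) {h : ℝ} {z : EE d} (hz : z ≠ 0) :
    kh d s h z ≤ frk d s z := by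
  rw [frk_eq]
  unfold kh
  have : 0 < ‖z‖ := norm_pos_iff.2 hz
  refine Real.rpow_le_rpow_of_nonpos (by positivity) (by nlinarith [sq_nonneg h]) ?_
  have : (0:ℝ) ≤ d := Nat.cast_nonneg d
  linarith

lemma kh_sub {d : ℕ} {s : ℝ} (hs0 : 0 < s) {h : ℝ} {z : EE d} (hz : z ≠ 0) :
    frk d s z - kh d s h z ≤ ((d:ℝ)+2*s)/2 * (h^2 / ‖z‖^2) * frk d s z := by
  have hd : (0:ℝ) ≤ d := Nat.cast_nonneg d
  have hz : 0 < ‖z‖ := norm_pos_iff.2 hz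
  set p := ((d:ℝ)+2*s)/2 with hp
  have hp0 : 0 < p := by positivity
  have h1 : kh d s h z = frk d s z * (1 + h^2/‖z‖^2) ^ (-p) := by
    rw [frk_eq, ← Real.mul_rpow (by positivity) (by positivity)]
    unfold kh
    congr 1
    field_simp
  have h2 : 1 - p * (h^2/‖z‖^2) ≤ (1 + h^2/‖z‖^2) ^ (-p) := by
    have : (1 + h^2/‖z‖^2) ^ (-p) ≥ (Real.exp (h^2/‖z‖^2)) ^ (-p) :=
      Real.rpow_le_rpow_of_nonpos (by positivity) (by linarith [Real.add_one_le_exp (h^2/‖z‖^2)])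
        (by linarith)
    rw [← Real.exp_mul] at this
    linarith [Real.add_one_le_exp (h^2/‖z‖^2 * -p)]
  rw [h1]
  have hk := frk_nonneg d s z
  nlinarith

set_option maxHeartbeats 1000000 in
lemma kh_diff (d : ℕ) {s : ℝ} (hs0 : 0 < s) : ∃ C : ℝ, 0 ≤ C ∧ ∀ (h : ℝ) (e z : EE d), 0 < h →
    ‖e‖ = h →
    |kh d s h (z - e) + kh d s h (z + e) - 2 * kh d s h z| ≤ C * (h^2/(‖z‖^2+h^2)) * kh d s h z ∧
    |kh d s h (z - e) - kh d s h (z + e)| ≤ C * (h/√(‖z‖^2+h^2)) * kh d s h z := by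
  have hd : (0:ℝ) ≤ d := Nat.cast_nonneg d
  set p := ((d:ℝ)+2*s)/2 with hp
  have hp0 : 0 < p := by positivity
  set A := p * ((p+1) * 3 ^ (p+2)) with hA
  set B := p * (3:ℝ) ^ (p+1) with hB
  have hA0 : 0 ≤ A := by positivity
  have hB0 : 0 ≤ B := by positivity
  refine ⟨18 * A + 2 * p + 6 * B, by positivity, fun h e z hh he => ?_⟩
  set q := ‖z‖^2 + h^2 with hq
  have hq0 : 0 < q := by positivity
  have hsq : √q * √q = q := Real.mul_self_sqrt hq0.le
  have hsq0 : 0 < √q := Real.sqrt_pos.2 hq0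
  have hzq : ‖z‖ ≤ √q := Real.le_sqrt_of_sq_le (by nlinarith)
  have hhq : h ≤ √q := Real.le_sqrt_of_sq_le (by nlinarith [norm_nonneg z])
  have n1 : ‖z - e‖^2 = ‖z‖^2 - 2 * inner ℝ z e + h^2 := by rw [norm_sub_sq_real, he]
  have n2 : ‖z + e‖^2 = ‖z‖^2 + 2 * inner ℝ z e + h^2 := by rw [norm_add_sq_real, he]
  have hin : |inner ℝ z e| ≤ ‖z‖ * h := by rw [← he]; exact abs_real_inner_le_norm z e
  have hin' := abs_le.1 hin
  set r₁ := (‖z - e‖^2 + h^2) / q with hr₁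
  set r₂ := (‖z + e‖^2 + h^2) / q with hr₂
  have k1 : kh d s h (z - e) = r₁ ^ (-p) * kh d s h z := by
    unfold kh
    rw [← Real.mul_rpow (by positivity) (by positivity), div_mul_cancel₀ _ hq0.ne']
  have k2 : kh d s h (z + e) = r₂ ^ (-p) * kh d s h z := by
    unfold kh
    rw [← Real.mul_rpow (by positivity) (by positivity), div_mul_cancel₀ _ hq0.ne']
  have low : ∀ w : EE d, ‖z‖ ≤ ‖w‖ + h → 1/3 ≤ (‖w‖^2+h^2)/q := by
    intro w hw
    rw [le_div_iff₀ hq0]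
    have : ‖z‖^2 ≤ (‖w‖ + h)^2 := pow_le_pow_left₀ (norm_nonneg _) hw 2
    nlinarith [sq_nonneg (‖w‖ - h)]
  have l1 : 1/3 ≤ r₁ := low _ (by
    have := norm_add_le (z - e) e
    rw [he] at this; simpa using this)
  have l2 : 1/3 ≤ r₂ := low _ (by
    have := norm_sub_le (z + e) e
    rw [he] at this; simpa using this)
  have e1 : r₁ - 1 = (-(2 * inner ℝ z e) + h^2) / q := by
    rw [hr₁, n1]; field_simp; ring
  have e2 : r₂ - 1 = (2 * inner ℝ z e + h^2) / q := by
    rw [hr₂, n2]; field_simp; ring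
  have hzh : 2 * (‖z‖ * h) + h^2 ≤ 3 * h * √q := by nlinarith
  have b : ∀ t, |t| ≤ 2 * (‖z‖ * h) + h^2 → |t / q| ≤ 3 * (h / √q) := by
    intro t ht
    rw [abs_div, abs_of_pos hq0, div_le_iff₀ hq0]
    calc |t| ≤ 3 * h * √q := ht.trans hzh
      _ = 3 * (h / √q) * (√q * √q) := by field_simp
      _ = _ := by rw [hsq]
  have b1 : |r₁ - 1| ≤ 3 * (h / √q) := by
    rw [e1]; apply b; rw [abs_le]; constructor <;> linarith [sq_nonneg h]
  have b2 : |r₂ - 1| ≤ 3 * (h / √q) := by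
    rw [e2]; apply b; rw [abs_le]; constructor <;> linarith [sq_nonneg h]
  have hhq2 : (h/√q)^2 = h^2/q := by rw [div_pow, Real.sq_sqrt hq0.le]
  have t1 := rp_taylor hp0 l1
  have t2 := rp_taylor hp0 l2
  have u1 := rp_lip hp0 l1
  have u2 := rp_lip hp0 l2
  have s1 : |r₁ - 1|^2 ≤ 9 * (h^2/q) := by
    rw [← hhq2]; exact (pow_le_pow_left₀ (abs_nonneg _) b1 2).trans (le_of_eq (by ring))
  have s2 : |r₂ - 1|^2 ≤ 9 * (h^2/q) := by
    rw [← hhq2]; exact (pow_le_pow_left₀ (abs_nonneg _) b2 2).trans (le_of_eq (by ring))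
  have hsum : r₁ + r₂ - 2 = 2 * (h^2/q) := by
    have : r₁ + r₂ - 2 = (r₁ - 1) + (r₂ - 1) := by ring
    rw [this, e1, e2]; ring
  have hk := (kh_pos d s hh z).le
  have hhq0 : 0 ≤ h^2/q := by positivity
  have hhq1 : 0 ≤ h/√q := by positivity
  constructor
  · rw [k1, k2, show r₁ ^ (-p) * kh d s h z + r₂ ^ (-p) * kh d s h z - 2 * kh d s h z =
      (r₁ ^ (-p) + r₂ ^ (-p) - 2) * kh d s h z by ring, abs_mul, abs_of_nonneg hk]
    refine mul_le_mul_of_nonneg_right ?_ hk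
    have : |r₁ ^ (-p) + r₂ ^ (-p) - 2| ≤ A * (9 * (h^2/q)) + A * (9 * (h^2/q)) + p * (2 * (h^2/q)) := by
      have t1' := abs_le.1 (t1.trans (mul_le_mul_of_nonneg_left s1 hA0))
      have t2' := abs_le.1 (t2.trans (mul_le_mul_of_nonneg_left s2 hA0))
      have : p * (r₁ - 1) + p * (r₂ - 1) = p * (2 * (h^2/q)) := by rw [← hsum]; ring
      have h3 : 0 ≤ p * (2 * (h^2/q)) := by positivity
      rw [abs_le]; constructor <;> linarith
    refine this.trans (le_of_sub_nonneg ?_)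
    have := mul_nonneg hB0 hhq0
    linarith
  · rw [k1, k2, ← sub_mul, abs_mul, abs_of_nonneg hk]
    refine mul_le_mul_of_nonneg_right ?_ hk
    have u1' := abs_le.1 (u1.trans (mul_le_mul_of_nonneg_left b1 hB0))
    have u2' := abs_le.1 (u2.trans (mul_le_mul_of_nonneg_left b2 hB0))
    have : |r₁ ^ (-p) - r₂ ^ (-p)| ≤ 6 * B * (h/√q) := by
      rw [abs_le]; constructor <;> linarith
    refine this.trans (le_of_sub_nonneg ?_)
    have h1 := mul_nonneg hA0 hhq1
    have h2 := mul_nonneg hp0.le hhq1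
    linarith

lemma D_bound (d : ℕ) {s : ℝ} (hs0 : 0 < s) : ∃ C : ℝ, 0 ≤ C ∧ ∀ (h R : ℝ) (e z : EE d)
    (a0 a1 b0 b1 : ℝ), 0 < h → 0 < R → ‖e‖ = h → 0 ≤ a0 → 0 ≤ a1 → 0 ≤ b0 → 0 ≤ b1 →
    |a0 - a1| ≤ h / R → |b0 - b1| ≤ h / R → |a1 - b0| ≤ (‖z‖ + h) / R → |a0 - b1| ≤ (‖z‖ + h) / R →
    |(a1^2 - b0^2)^2 * kh d s h (z - e) + (a0^2 - b1^2)^2 * kh d s h (z + e)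
      - (a1^2 - b1^2)^2 * kh d s h z - (a0^2 - b0^2)^2 * kh d s h z| ≤
      C * (h^2/R^2) * (a0 + a1 + b0 + b1)^2 * kh d s h z := by
  obtain ⟨C, hC, hk⟩ := kh_diff d hs0
  refine ⟨8 * C + 2, by positivity, fun h R e z a0 a1 b0 b1 hh hR he ha0 ha1 hb0 hb1 h1 h2 h3 h4 => ?_⟩
  obtain ⟨k1, k2⟩ := hk h e z hh he
  set q := ‖z‖^2 + h^2 with hq
  have hq0 : 0 < q := by positivity
  set σ := a0 + a1 + b0 + b1 with hσ
  have hσ0 : 0 ≤ σ := by positivity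
  set T := √q with hT
  have hsq : T * T = q := Real.mul_self_sqrt hq0.le
  have hT0 : 0 < T := Real.sqrt_pos.2 hq0
  have hzT : ‖z‖ + h ≤ 2 * T := by
    have hzq : ‖z‖ ≤ √q := Real.le_sqrt_of_sq_le (by nlinarith)
    have hhq : h ≤ √q := Real.le_sqrt_of_sq_le (by nlinarith [norm_nonneg z])
    linarith
  have hzR : (‖z‖ + h) / R ≤ 2 * (T / R) := by
    rw [← mul_div_assoc]; gcongr
  have hTR : 0 ≤ T / R := by positivity
  have hhR : 0 ≤ h / R := by positivity
  have sqd : ∀ a b m : ℝ, 0 ≤ a → 0 ≤ b → a + b ≤ σ → |a - b| ≤ m → |a^2 - b^2| ≤ m * σ := by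
    intro a b m ha hb hab hm
    rw [show a^2 - b^2 = (a - b) * (a + b) by ring, abs_mul, abs_of_nonneg (by positivity : 0 ≤ a + b)]
    exact mul_le_mul hm hab (by positivity) ((abs_nonneg _).trans hm)
  have c1 := sqd a1 b0 _ ha1 hb0 (by linarith) (h3.trans hzR)
  have c2 := sqd a0 b1 _ ha0 hb1 (by linarith) (h4.trans hzR)
  have c3 := sqd a0 a1 _ ha0 ha1 (by linarith) h1
  have c4 := sqd b0 b1 _ hb0 hb1 (by linarith) h2
  set X := a1^2 - b0^2 with hX
  set Y := a0^2 - b1^2 with hY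
  set U := a0^2 - a1^2 with hU
  set W := b0^2 - b1^2 with hW
  set k := kh d s h z with hkd
  have hk0 : 0 ≤ k := (kh_pos d s hh z).le
  have id1 : X^2 * kh d s h (z - e) + Y^2 * kh d s h (z + e)
      - (a1^2 - b1^2)^2 * k - (a0^2 - b0^2)^2 * k =
      1/2 * (X^2 + Y^2) * (kh d s h (z - e) + kh d s h (z + e) - 2 * k)
      + 1/2 * ((-U - W) * (X + Y)) * (kh d s h (z - e) - kh d s h (z + e)) + 2 * (U * W) * k := by
    simp only [X, Y, U, W]; ring
  rw [id1]
  have X2 : X^2 ≤ (2 * (T/R) * σ)^2 := by rw [← sq_abs]; exact pow_le_pow_left₀ (abs_nonneg _) c1 2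
  have Y2 : Y^2 ≤ (2 * (T/R) * σ)^2 := by rw [← sq_abs]; exact pow_le_pow_left₀ (abs_nonneg _) c2 2
  have m1 : |1/2 * (X^2 + Y^2) * (kh d s h (z - e) + kh d s h (z + e) - 2 * k)| ≤
      1/2 * (2 * (2 * (T/R) * σ)^2) * (C * (h^2/q) * k) := by
    rw [abs_mul, abs_of_nonneg (by positivity : 0 ≤ 1/2 * (X^2 + Y^2))]
    refine mul_le_mul (by linarith) k1 (abs_nonneg _) (by positivity)
  have m2 : |1/2 * ((-U - W) * (X + Y)) * (kh d s h (z - e) - kh d s h (z + e))| ≤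
      1/2 * ((2 * (h / R * σ)) * (2 * (2 * (T/R) * σ))) * (C * (h/T) * k) := by
    rw [abs_mul, abs_mul, abs_mul, abs_of_nonneg (by norm_num : (0:ℝ) ≤ 1/2)]
    have q1 : |-U - W| ≤ 2 * (h / R * σ) := by
      have := abs_le.1 c3; have := abs_le.1 c4
      rw [abs_le]; constructor <;> linarith
    have q2 : |X + Y| ≤ 2 * (2 * (T / R) * σ) := (abs_add_le _ _).trans (by linarith)
    refine mul_le_mul ?_ k2 (abs_nonneg _) (by positivity)
    exact mul_le_mul_of_nonneg_left (mul_le_mul q1 q2 (abs_nonneg _) (by positivity)) (by norm_num)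
  have m3 : |2 * (U * W) * k| ≤ 2 * ((h / R * σ) * (h / R * σ)) * k := by
    rw [abs_mul, abs_mul, abs_mul, abs_of_nonneg hk0, abs_two]
    gcongr
  refine (abs_add_three _ _ _).trans ((add_le_add_three m1 m2 m3).trans (le_of_eq ?_))
  rw [← hsq]
  field_simp
  ring


lemma int_ss {X : Type*} [MeasurableSpace X] {μ : Measure X} {a b c : X → ℝ}
    (ha : Integrable a μ) (hb : Integrable b μ) (hc : Integrable c μ) :
    ∫ x, (a x - b x - c x) ∂μ = ∫ x, a x ∂μ - ∫ x, b x ∂μ - ∫ x, c x ∂μ := by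
  have h := integral_sub (ha.sub hb) hc
  simp only [Pi.sub_apply] at h
  rw [h, integral_sub ha hb]

lemma int_ssa {X : Type*} [MeasurableSpace X] {μ : Measure X} {a b c e : X → ℝ}
    (ha : Integrable a μ) (hb : Integrable b μ) (hc : Integrable c μ) (he : Integrable e μ) :
    ∫ x, (a x - b x - c x + e x) ∂μ = ∫ x, a x ∂μ - ∫ x, b x ∂μ - ∫ x, c x ∂μ + ∫ x, e x ∂μ := by
  have h := integral_add ((ha.sub hb).sub hc) he
  simp only [Pi.sub_apply] at h
  rw [h, int_ss ha hb hc]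

noncomputable def zt {d : ℕ} (x₀ : EE d) (R : ℝ) (x : EE d) : ℝ := max 0 (2 - ‖x - x₀‖ / R)

noncomputable def ph {d : ℕ} (x₀ : EE d) (R : ℝ) (x : EE d) : ℝ := (zt x₀ R x)^2

lemma zt_nonneg {d : ℕ} (x₀ : EE d) (R : ℝ) (x : EE d) : 0 ≤ zt x₀ R x := le_max_left _ _

lemma zt_le {d : ℕ} (x₀ : EE d) {R : ℝ} (hR : 0 < R) (x : EE d) : zt x₀ R x ≤ 2 :=
  max_le (by norm_num) (by have : 0 ≤ ‖x - x₀‖ / R := by positivity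
                           linarith)

lemma zt_lip {d : ℕ} (x₀ : EE d) {R : ℝ} (hR : 0 < R) (x y : EE d) :
    |zt x₀ R x - zt x₀ R y| ≤ ‖x - y‖ / R := by
  unfold zt
  refine (abs_max_sub_max_le_max _ _ _ _).trans ?_
  rw [sub_self, abs_zero, max_eq_right (abs_nonneg _)]
  rw [show 2 - ‖x - x₀‖ / R - (2 - ‖y - x₀‖ / R) = -((‖x - x₀‖ - ‖y - x₀‖) / R) by ring, abs_neg,
    abs_div, abs_of_pos hR]
  gcongr
  refine (abs_norm_sub_norm_le _ _).trans (by simp)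

lemma zt_supp {d : ℕ} (x₀ : EE d) {R : ℝ} (hR : 0 < R) {x : EE d} (hx : x ∉ ball x₀ (2*R)) :
    zt x₀ R x = 0 := by
  unfold zt
  rw [mem_ball, dist_eq_norm, not_lt] at hx
  apply max_eq_left
  have : 2 ≤ ‖x - x₀‖ / R := by rwa [le_div_iff₀ hR]
  linarith

lemma zt_one {d : ℕ} (x₀ : EE d) {R : ℝ} (hR : 0 < R) {x : EE d} (hx : x ∈ ball x₀ R) :
    1 ≤ zt x₀ R x := by
  unfold zt
  rw [mem_ball, dist_eq_norm] at hx
  refine le_max_of_le_right ?_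
  have : ‖x - x₀‖ / R < 1 := by rwa [div_lt_one hR]
  linarith

lemma zt_cont {d : ℕ} (x₀ : EE d) (R : ℝ) : Continuous (zt x₀ R) := by
  unfold zt; fun_prop

lemma ph_cont {d : ℕ} (x₀ : EE d) (R : ℝ) : Continuous (ph x₀ R) := by
  have := zt_cont x₀ R
  unfold ph; fun_prop

lemma ph_nonneg {d : ℕ} (x₀ : EE d) (R : ℝ) (x : EE d) : 0 ≤ ph x₀ R x := sq_nonneg _

lemma ph_le {d : ℕ} (x₀ : EE d) {R : ℝ} (hR : 0 < R) (x : EE d) : ph x₀ R x ≤ 4 := by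
  unfold ph; nlinarith [zt_nonneg x₀ R x, zt_le x₀ hR x]

lemma ph_supp {d : ℕ} (x₀ : EE d) {R : ℝ} (hR : 0 < R) {x : EE d} (hx : x ∉ ball x₀ (2*R)) :
    ph x₀ R x = 0 := by unfold ph; rw [zt_supp x₀ hR hx]; simp

lemma ph_lip {d : ℕ} (x₀ : EE d) {R : ℝ} (hR : 0 < R) (x y : EE d) :
    |ph x₀ R x - ph x₀ R y| ≤ 2 * min 1 (‖x - y‖ / R) * (zt x₀ R x + zt x₀ R y) := by
  unfold ph
  have h1 := zt_nonneg x₀ R x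
  have h2 := zt_nonneg x₀ R y
  have h3 := zt_le x₀ hR x
  have h4 := zt_le x₀ hR y
  have h5 := zt_lip x₀ hR x y
  rw [show zt x₀ R x ^ 2 - zt x₀ R y ^ 2 = (zt x₀ R x - zt x₀ R y) * (zt x₀ R x + zt x₀ R y) by ring,
    abs_mul, abs_of_nonneg (by positivity : 0 ≤ zt x₀ R x + zt x₀ R y)]
  gcongr
  have h6 : 0 ≤ ‖x - y‖ / R := by positivity
  rcases le_total 1 (‖x - y‖ / R) with h | h
  · rw [min_eq_left h, abs_le]; constructor <;> linarith
  · rw [min_eq_right h]; linarith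

lemma ph_CLip {d : ℕ} (x₀ : EE d) {R : ℝ} (hR : 1 ≤ R) : CLip (ph x₀ R) x₀ (2*R) 8 := by
  have hR0 : 0 < R := by linarith
  refine ⟨by norm_num, fun x => ?_, fun x y => ?_, fun x hx => ph_supp x₀ hR0 hx⟩
  · rw [abs_of_nonneg (ph_nonneg _ _ _)]; linarith [ph_le x₀ hR0 x]
  · refine (ph_lip x₀ hR0 x y).trans ?_
    have h1 := zt_le x₀ hR0 x
    have h2 := zt_le x₀ hR0 y
    have h3 : min 1 (‖x - y‖ / R) ≤ min 1 ‖x - y‖ := by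
      gcongr
      exact div_le_self (norm_nonneg _) hR
    have h4 : 0 ≤ min 1 (‖x - y‖ / R) := by positivity
    nlinarith [zt_nonneg x₀ R x, zt_nonneg x₀ R y]

lemma fracC_pos (d : ℕ) {s : ℝ} (hs0 : 0 < s) (hs1 : s < 1) : 0 < fracC d s := by
  unfold fracC
  have h1 : Real.Gamma (-s) ≠ 0 := by
    refine Real.Gamma_ne_zero fun m h => ?_
    have h2 : s = m := by linarith
    rw [h2] at hs0 hs1
    have h3 : 0 < m := by exact_mod_cast hs0
    have h4 : m < 1 := by exact_mod_cast hs1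
    omega
  have h2 : 0 < Real.Gamma ((d:ℝ)/2 + s) := Real.Gamma_pos_of_pos (by positivity)
  have h3 : 0 < |Real.Gamma (-s)| := abs_pos.2 h1
  positivity

lemma f_taylor {f f' : ℝ → ℝ} {α Cα : ℝ} (hα : 0 < α) (hC : 0 ≤ Cα)
    (h1 : ∀ x ∈ Icc (-1 : ℝ) 1, HasDerivAt f (f' x) x)
    (h2 : ∀ x ∈ Icc (-1 : ℝ) 1, ∀ y ∈ Icc (-1 : ℝ) 1, |f' x - f' y| ≤ Cα * |x - y| ^ α)
    {a b : ℝ} (ha : a ∈ Icc (-1:ℝ) 1) (hb : b ∈ Icc (-1:ℝ) 1) :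
    |f b - f a - f' a * (b - a)| ≤ Cα * |b - a| ^ α * |b - a| := by
  have hconv := convex_uIcc (𝕜 := ℝ) a b
  have hsub : uIcc a b ⊆ Icc (-1) 1 := uIcc_subset_Icc ha hb
  have := Convex.norm_image_sub_le_of_norm_hasDerivWithin_le (𝕜 := ℝ)
    (f := fun t : ℝ => f t - f' a * t) (f' := fun t => f' t - f' a * 1)
    (C := Cα * |b - a| ^ α)
    (x := a) (y := b) (fun x hx => ?_) (fun x hx => ?_) hconv left_mem_uIcc right_mem_uIcc
  · rw [Real.norm_eq_abs, Real.norm_eq_abs] at this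
    rwa [show f b - f a - f' a * (b - a) = f b - f' a * b - (f a - f' a * a) by ring]
  · exact ((h1 x (hsub hx)).sub ((hasDerivAt_id x).const_mul _)).hasDerivWithinAt
  · rw [mul_one]
    refine (h2 x (hsub hx) a ha).trans ?_
    exact mul_le_mul_of_nonneg_left (Real.rpow_le_rpow (abs_nonneg _)
      (abs_sub_left_of_mem_uIcc hx) hα.le) hC

lemma fu_cont {d : ℕ} {f' : ℝ → ℝ} {α Cα : ℝ} (hα : 0 < α) 
    (h2 : ∀ x ∈ Icc (-1 : ℝ) 1, ∀ y ∈ Icc (-1 : ℝ) 1, |f' x - f' y| ≤ Cα * |x - y| ^ α)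
    {u : EE d → ℝ} (hu : Continuous u) (hb : ∀ x, |u x| ≤ 1) : Continuous (fun x => f' (u x)) := by
  rw [continuous_iff_continuousAt]
  intro x
  rw [ContinuousAt, tendsto_iff_norm_sub_tendsto_zero]
  refine squeeze_zero (fun n => norm_nonneg _)
    (fun y => h2 (u y) (abs_le.1 (hb y)) (u x) (abs_le.1 (hb x))) ?_
  have : Continuous (fun y => Cα * |u y - u x| ^ α) :=
    continuous_const.mul (Continuous.rpow_const (by fun_prop) (fun _ => Or.inr hα.le))
  have h3 := this.tendsto x
  simpa [Real.zero_rpow hα.ne'] using h3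

lemma pde_inner {d : ℕ} {s : ℝ} (hs0 : 0 < s) (hs1 : s < 1) {f f' : ℝ → ℝ} {u : EE d → ℝ}
    (hu : IsStableSolution d s f f' u) (x : EE d) :
    ∫ z, (2 * u x - u (x+z) - u (x-z)) * frk d s z = 2 / fracC d s * f (u x) := by
  have hc := fracC_pos d hs0 hs1
  rw [← hu.2.2.1 x]
  simp only [div_eq_mul_inv]
  change _ = 2 * (fracC d s)⁻¹ * (fracC d s * 2⁻¹ * ∫ z, (2 * u x - u (x+z) - u (x-z)) * frk d s z)
  field_simp

lemma step3 {d : ℕ} (hd : 1 ≤ d) {s α : ℝ} (hs0 : 0 < s) (hs1 : s < 1) (hα : 0 < α)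
    {f f' : ℝ → ℝ} (hf : IsC1Alpha f f' α) {u : EE d → ℝ} (hu : IsStableSolution d s f f' u)
    (x₀ : EE d) {R : ℝ} (hR : 1 ≤ R) : ∃ Cu : ℝ, 0 ≤ Cu ∧ ∀ (e : EE d) (w : EE d → ℝ),
      (∀ x, w x = u (x + e) - u x) →
      Integrable (fun p : EE d × EE d => 2 * (ph x₀ R p.1 * ph x₀ R p.2 *
        (|w p.1| * |w p.2| - w p.1 * w p.2)) * frk d s (p.1 - p.2)) ∧
      ∫ p : EE d × EE d, 2 * (ph x₀ R p.1 * ph x₀ R p.2 *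
        (|w p.1| * |w p.2| - w p.1 * w p.2)) * frk d s (p.1 - p.2) ≤
      (∫ p : EE d × EE d, (ph x₀ R p.1 - ph x₀ R p.2)^2 * (w p.1 * w p.2) * frk d s (p.1 - p.2))
        + Cu * ‖e‖ ^ (2 + α) := by
  have hc := fracC_pos d hs0 hs1
  have hR0 : 0 < R := by linarith
  obtain ⟨hf1, Cα, hCα, hf2⟩ := hf
  have hu2 := hu.1
  have hb := hu.2.1
  have huc : Continuous u := hu2.continuous
  have huL : LL u := LL_of_C1 (hu2.of_le (by norm_num)) hb
  obtain ⟨L, hL, hLu⟩ := huL x₀ (2*R)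
  have hφ := ph_CLip x₀ hR
  have hφc := ph_cont x₀ R
  set φ := ph x₀ R with hφd
  have hk := frk_meas d s
  have hvol : 0 ≤ volume.real (ball x₀ (2*R)) := measureReal_nonneg
  refine ⟨2 / fracC d s * (16 * Cα * L ^ (2+α) * volume.real (ball x₀ (2*R))), by positivity,
    fun e w hw => ?_⟩
  have hwe : w = fun x => u (x + e) - u x := funext hw
  have huec : Continuous (fun x => u (x + e)) := by fun_prop
  have hwc : Continuous w := by rw [hwe]; fun_prop
  have hwL : LL w := by rw [hwe]; exact (huL.shift e).sub huL
  have hw2 : ∀ x, |w x| ≤ 2 := by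
    intro x; rw [hw]
    have := abs_le.1 (hb (x+e)); have := abs_le.1 (hb x)
    rw [abs_le]; constructor <;> linarith
  obtain ⟨L1, hη⟩ := hφ.mul hwL.abs (c := 2) (fun x => by rw [abs_abs]; exact hw2 x)
  obtain ⟨L2, hφw⟩ := hφ.mul hwL hw2
  obtain ⟨L3, hψ⟩ := hφw.mul hφ.LL hφ.2.1
  have hst := stab_ext hd hs0 hs1 (fu_cont hα hf2 huc hb) hu.2.2.2 hη
  have hV := fu_cont (d := d) hα hf2 huc hb
  have hue : ContDiff ℝ 2 (fun x => u (x + e)) := by fun_prop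
  have w1 := weak_form hd hs0 hs1 hue (fun x => hb _) hψ
  have w2 := weak_form hd hs0 hs1 hu2 hb hψ
  have p1 : ∀ x, ∫ z, (2 * u (x + e) - u (x + z + e) - u (x - z + e)) * frk d s z
      = 2 / fracC d s * f (u (x + e)) := by
    intro x
    rw [← pde_inner hs0 hs1 hu (x + e)]
    congr 1; ext z
    rw [show x + z + e = x + e + z by abel, show x - z + e = x + e - z by abel]
  simp_rw [p1] at w1
  simp_rw [pde_inner hs0 hs1 hu] at w2
  have fuc : Continuous (fun x => f (u x)) := by
    have : ContinuousOn f (Icc (-1) 1) := fun t ht => (hf1 t ht).continuousAt.continuousWithinAt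
    exact this.comp_continuous huc (fun x => abs_le.1 (hb x))
  have i1 := prod_integrable hd hs0 hs1 (huL.shift e) huec hψ
  have i2 := prod_integrable hd hs0 hs1 huL huc hψ
  have i3 := hη.sq_integrable hd hs0 hs1
  have i4 : Integrable (fun p : EE d × EE d =>
      (φ p.1 - φ p.2)^2 * (w p.1 * w p.2) * frk d s (p.1 - p.2)) := by
    refine int_of_dom hd hs0 hs1 x₀ (2*R) (4 * 8^2) ?_ ?_
    · exact (by fun_prop : Measurable _).aestronglyMeasurable
    · intro p
      have hs := hφ.sq_dom hs0 hs1 p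
      have hk0 := frk_nonneg d s (p.1 - p.2)
      have : |(φ p.1 - φ p.2)^2 * (w p.1 * w p.2) * frk d s (p.1 - p.2)| =
        (|w p.1| * |w p.2|) * ((φ p.1 - φ p.2)^2 * frk d s (p.1 - p.2)) := by
        rw [abs_mul, abs_mul, abs_mul, abs_of_nonneg hk0, abs_of_nonneg (sq_nonneg _)]; ring
      rw [this, mul_assoc 4]
      refine mul_le_mul ?_ hs (by positivity) (by norm_num)
      nlinarith [hw2 p.1, hw2 p.2, abs_nonneg (w p.1), abs_nonneg (w p.2)]
  have key : (fun p : EE d × EE d => 2 * (φ p.1 * φ p.2 *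
        (|w p.1| * |w p.2| - w p.1 * w p.2)) * frk d s (p.1 - p.2)) = 
      fun p => ((u (p.1 + e) - u (p.2 + e)) * (φ p.1 * w p.1 * φ p.1 - φ p.2 * w p.2 * φ p.2) * frk d s (p.1 - p.2)
        - (u p.1 - u p.2) * (φ p.1 * w p.1 * φ p.1 - φ p.2 * w p.2 * φ p.2) * frk d s (p.1 - p.2)
        - (φ p.1 * |w p.1| - φ p.2 * |w p.2|)^2 * frk d s (p.1 - p.2))
        + (φ p.1 - φ p.2)^2 * (w p.1 * w p.2) * frk d s (p.1 - p.2) := by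
    ext p
    have e1 : u (p.1 + e) = w p.1 + u p.1 := by rw [hw]; ring
    have e2 : u (p.2 + e) = w p.2 + u p.2 := by rw [hw]; ring
    have e3 := sq_abs (w p.1)
    have e4 := sq_abs (w p.2)
    rw [e1, e2]
    linear_combination (φ p.1 ^2 * frk d s (p.1 - p.2)) * e3 + (φ p.2 ^2 * frk d s (p.1 - p.2)) * e4
  rw [key]
  refine ⟨((i1.sub i2).sub i3).add i4, ?_⟩
  rw [int_ssa i1 i2 i3 i4, w1, w2, add_comm]
  gcongr
  have j1 : Integrable (fun x => φ x * w x * φ x * (2 / fracC d s * f (u (x + e)))) :=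
    hψ.integrable_mul (continuous_const.mul (fuc.comp (continuous_add_const e)))
  have j2 : Integrable (fun x => φ x * w x * φ x * (2 / fracC d s * f (u x))) :=
    hψ.integrable_mul (continuous_const.mul fuc)
  have j3 : Integrable (fun x => f' (u x) * (φ x * |w x|)^2) := by
    have := hη.integrable_mul (g := fun x => (φ x * |w x|) * f' (u x))
      ((hφc.mul hwc.abs).mul hV)
    refine this.congr (Eventually.of_forall fun x => ?_)
    simp only; ring
  have st' : 2 / fracC d s * ∫ x, f' (u x) * (φ x * |w x|)^2 ≤
      ∫ p : EE d × EE d, (φ p.1 * |w p.1| - φ p.2 * |w p.2|) ^ 2 * frk d s (p.1 - p.2) := by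
    rw [div_mul_eq_mul_div, div_le_iff₀ hc]
    linarith
  refine (sub_le_sub_left st' _).trans ?_
  rw [← integral_const_mul, ← int_ss j1 j2 (j3.const_mul _)]
  have bnd : ∀ x, φ x * w x * φ x * (2 / fracC d s * f (u (x + e))) - φ x * w x * φ x * (2 / fracC d s * f (u x))
      - 2 / fracC d s * (f' (u x) * (φ x * |w x|)^2) ≤
      (ball x₀ (2*R)).indicator (fun _ => 2 / fracC d s * (16 * Cα * L ^ (2+α)) * ‖e‖ ^ (2+α)) x := by
    intro x
    by_cases hx : x ∈ ball x₀ (2*R)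
    · rw [indicator_of_mem hx]
      have ft := f_taylor hα hCα hf1 hf2 (a := u x) (b := u (x+e)) (abs_le.1 (hb x)) (abs_le.1 (hb _))
      rw [← hw x] at ft
      have hwx : |w x| ≤ L * ‖e‖ := by
        rw [hw, abs_sub_comm]
        refine (hLu x hx (x+e)).trans ?_
        gcongr
        refine (min_le_right _ _).trans (by simp)
      have hφ0 := ph_nonneg x₀ R x
      have hφ4 := ph_le x₀ hR0 x
      have e3 := sq_abs (w x)
      have : φ x * w x * φ x * (2 / fracC d s * f (u (x + e))) - φ x * w x * φ x * (2 / fracC d s * f (u x))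
        - 2 / fracC d s * (f' (u x) * (φ x * |w x|)^2) =
        2 / fracC d s * (φ x ^ 2 * (w x * (f (u (x+e)) - f (u x) - f' (u x) * w x))) := by
        linear_combination (-(2 / fracC d s) * φ x ^2 * f' (u x)) * e3
      rw [this, mul_assoc]
      refine mul_le_mul_of_nonneg_left ?_ (by positivity)
      have a1 : w x * (f (u (x+e)) - f (u x) - f' (u x) * w x) ≤ |w x| * (Cα * |w x| ^ α * |w x|) := by
        refine (le_abs_self _).trans ?_
        rw [abs_mul]
        gcongr
      have a2 : |w x| * (Cα * |w x| ^ α * |w x|) ≤ (L * ‖e‖) * (Cα * (L*‖e‖)^α * (L * ‖e‖)) := by gcongr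
      have a3 : (L * ‖e‖) * (Cα * (L*‖e‖)^α * (L * ‖e‖)) = Cα * L^(2+α) * ‖e‖^(2+α) := by
        rw [mul_assoc Cα (L^(2+α)), ← Real.mul_rpow hL (norm_nonneg e)]
        have hle : 0 ≤ L * ‖e‖ := by positivity
        rw [Real.rpow_add' hle (by linarith), Real.rpow_two]; ring
      have a4 : 0 ≤ Cα * L^(2+α) * ‖e‖^(2+α) := by positivity
      have a5 : φ x ^2 ≤ 16 := by nlinarith
      calc _ ≤ φ x ^ 2 * (Cα * L^(2+α) * ‖e‖^(2+α)) := by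
            exact mul_le_mul_of_nonneg_left (by linarith) (sq_nonneg _)
        _ ≤ 16 * (Cα * L^(2+α) * ‖e‖^(2+α)) := by gcongr
        _ = _ := by ring
    · rw [indicator_of_notMem hx, hφ.2.2.2 x hx]; simp
  refine (integral_mono ((j1.sub j2).sub (j3.const_mul _)) ?_ bnd).trans (le_of_eq ?_)
  · exact (integrable_indicator_iff measurableSet_ball).2 (integrableOn_const (measure_ball_lt_top.ne))
  · rw [integral_indicator_const _ measurableSet_ball, smul_eq_mul]; ring


lemma A_dom {d : ℕ} {s : ℝ} (hs0 : 0 < s) (hs1 : s < 1) {u : EE d → ℝ} (hu : LL u) (x₀ : EE d)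
    (r : ℝ) : ∃ M : ℝ, 0 ≤ M ∧ ∀ p : EE d × EE d, (u p.1 - u p.2)^2 *
      ((ball x₀ r).indicator 1 p.1 + (ball x₀ r).indicator 1 p.2) * frk d s (p.1 - p.2)
      ≤ M * dom d s x₀ r p := by
  obtain ⟨L, hL, h⟩ := hu x₀ r
  refine ⟨L^2, by positivity, fun p => ?_⟩
  have i1 := ind_bounds x₀ p.1 r
  have i2 := ind_bounds x₀ p.2 r
  have hk := frk_nonneg d s (p.1 - p.2)
  have hm : 0 ≤ min 1 ‖p.1 - p.2‖ := by positivity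
  have key : ∀ x y : EE d, x ∈ ball x₀ r ∨ y ∈ ball x₀ r → (u x - u y)^2 ≤ L^2 * (min 1 (‖x - y‖ ^ (1+s))) := by
    intro x y hxy
    have : |u x - u y| ≤ L * min 1 ‖x - y‖ := by
      rcases hxy with h1 | h1
      · exact h x h1 y
      · rw [abs_sub_comm, norm_sub_rev]; exact h y h1 x
    rw [← sq_abs]
    refine (pow_le_pow_left₀ (abs_nonneg _) this 2).trans ?_
    rw [mul_pow, pow_two (min 1 ‖x - y‖)]
    gcongr
    exact min_sq_le hs0 hs1 (norm_nonneg _)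
  unfold dom mm
  by_cases hp : p.1 ∈ ball x₀ r ∨ p.2 ∈ ball x₀ r
  · have := key _ _ hp
    calc _ ≤ (L^2 * (min 1 (‖p.1 - p.2‖ ^ (1+s)))) *
      ((ball x₀ r).indicator 1 p.1 + (ball x₀ r).indicator 1 p.2) * frk d s (p.1 - p.2) := by gcongr
      _ = _ := by ring
  · push Not at hp
    rw [indicator_of_notMem hp.1, indicator_of_notMem hp.2]; simp

lemma ph_le_ind {d : ℕ} (x₀ : EE d) {R r : ℝ} (hR : 0 < R) (hr : 2 * R ≤ r) (x : EE d) :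
    ph x₀ R x ≤ 4 * (ball x₀ r).indicator 1 x := by
  by_cases hx : x ∈ ball x₀ r
  · rw [indicator_of_mem hx]; simpa using ph_le x₀ hR x
  · rw [indicator_of_notMem hx, ph_supp x₀ hR (fun h => hx (ball_subset_ball hr h))]; simp

lemma AF_integrable {d : ℕ} (hd : 1 ≤ d) {s : ℝ} (hs0 : 0 < s) (hs1 : s < 1) {u : EE d → ℝ}
    (hu : LL u) (huc : Continuous u) (x₀ : EE d) (r : ℝ) {g : EE d × EE d → ℝ} (hg : Measurable g)
    {c : ℝ} (hgb : ∀ p, |g p| ≤ c * ((ball x₀ r).indicator 1 p.1 + (ball x₀ r).indicator 1 p.2)) :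
    Integrable (fun p : EE d × EE d => (u p.1 - u p.2)^2 * g p * frk d s (p.1 - p.2)) := by
  obtain ⟨M, hM, h⟩ := A_dom hs0 hs1 hu x₀ r
  have hk := frk_meas d s
  have hum := huc.measurable
  by_cases hc : 0 ≤ c
  · refine int_of_dom hd hs0 hs1 x₀ r (c * M) (by fun_prop : Measurable _).aestronglyMeasurable
      fun p => ?_
    have hk0 := frk_nonneg d s (p.1 - p.2)
    rw [abs_mul, abs_mul, abs_of_nonneg hk0, abs_of_nonneg (sq_nonneg _)]
    calc _ ≤ (u p.1 - u p.2)^2 * (c * ((ball x₀ r).indicator 1 p.1 + (ball x₀ r).indicator 1 p.2)) *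
          frk d s (p.1 - p.2) := by gcongr; exact hgb p
      _ = c * ((u p.1 - u p.2)^2 * ((ball x₀ r).indicator 1 p.1 + (ball x₀ r).indicator 1 p.2) *
          frk d s (p.1 - p.2)) := by ring
      _ ≤ c * (M * dom d s x₀ r p) := mul_le_mul_of_nonneg_left (h p) hc
      _ = _ := by ring
  · have : ∀ p, g p = 0 := by
      intro p
      have h1 := hgb p
      have i1 := ind_bounds x₀ p.1 r
      have i2 := ind_bounds x₀ p.2 r
      push Not at hc
      have : |g p| ≤ 0 := h1.trans (mul_nonpos_of_nonpos_of_nonneg hc.le (by positivity))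
      simpa using this
    simp [this]

lemma J_integrable {d : ℕ} (hd : 1 ≤ d) {s : ℝ} (hs0 : 0 < s) (hs1 : s < 1) {u : EE d → ℝ}
    (hu : LL u) (huc : Continuous u) (x₀ : EE d) {R : ℝ} (hR : 0 < R) :
    Integrable (fun p : EE d × EE d => (u p.1 - u p.2)^2 * ph x₀ R p.1 * frk d s (p.1 - p.2)) := by
  have hp := (ph_cont x₀ R).measurable
  refine AF_integrable hd hs0 hs1 hu huc x₀ (2*R) (g := fun p => ph x₀ R p.1) (by fun_prop) (c := 4)
    fun p => ?_
  rw [abs_of_nonneg (ph_nonneg _ _ _)]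
  have := ph_le_ind x₀ hR le_rfl p.1
  have i2 := ind_bounds x₀ p.2 (2*R)
  linarith

lemma J_swap {d : ℕ} {s : ℝ} {u : EE d → ℝ} (φ : EE d → ℝ) :
    ∫ p : EE d × EE d, (u p.1 - u p.2)^2 * φ p.2 * frk d s (p.1 - p.2) =
    ∫ p : EE d × EE d, (u p.1 - u p.2)^2 * φ p.1 * frk d s (p.1 - p.2) := by
  rw [← swap_int]
  congr 1; ext p
  simp only
  rw [← frk_neg, neg_sub]; ring

lemma J_integrable' {d : ℕ} (hd : 1 ≤ d) {s : ℝ} (hs0 : 0 < s) (hs1 : s < 1) {u : EE d → ℝ}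
    (hu : LL u) (huc : Continuous u) (x₀ : EE d) {R : ℝ} (hR : 0 < R) :
    Integrable (fun p : EE d × EE d => (u p.1 - u p.2)^2 * ph x₀ R p.2 * frk d s (p.1 - p.2)) := by
  refine (J_integrable hd hs0 hs1 hu huc x₀ hR).swap.congr (Eventually.of_forall fun p => ?_)
  simp only [Function.comp, Prod.fst_swap, Prod.snd_swap]
  rw [← frk_neg, neg_sub]; ring

set_option maxHeartbeats 2000000 in
lemma step4a {d : ℕ} (hd : 1 ≤ d) {s : ℝ} (hs0 : 0 < s) (hs1 : s < 1) {u : EE d → ℝ}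
    (hu : LL u) (huc : Continuous u) (hb : ∀ x, |u x| ≤ 1) (x₀ : EE d) {R : ℝ} (hR : 1 ≤ R) :
    ∃ Cu : ℝ, 0 ≤ Cu ∧ ∀ (e : EE d) (w : EE d → ℝ), 0 < ‖e‖ → ‖e‖ ≤ 1 →
      (∀ x, w x = u (x + e) - u x) →
      ∫ p : EE d × EE d, (ph x₀ R p.1 - ph x₀ R p.2)^2 * (w p.1 * w p.2) *
        (frk d s (p.1 - p.2) - kh d s ‖e‖ (p.1 - p.2)) ≤ Cu * ‖e‖ ^ (2 + (1 - s)) := by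
  have hφ := ph_CLip x₀ hR
  have hφc := ph_cont x₀ R
  obtain ⟨L, hL, hLu⟩ := hu x₀ (2*R+1)
  set P := ((d:ℝ)+2*s)/2 with hP
  have hP0 : 0 < P := by positivity
  set φ := ph x₀ R with hφd
  have hdi : 0 ≤ ∫ p, dom d s x₀ (2*R) p := integral_nonneg (dom_nonneg d s x₀ (2*R))
  refine ⟨64 * (P+1) * (L^2 + 2 * L) * ∫ p, dom d s x₀ (2*R) p, by positivity, ?_⟩
  intro e w he0 he1 hw
  set h := ‖e‖ with hh
  have hw2 : ∀ x, |w x| ≤ 2 := by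
    intro x; rw [hw]
    have := abs_le.1 (hb (x+e)); have := abs_le.1 (hb x)
    rw [abs_le]; constructor <;> linarith
  have hwL : ∀ x ∈ ball x₀ (2*R+1), |w x| ≤ L * h := by
    intro x hx
    rw [hw, abs_sub_comm]
    refine (hLu x hx (x+e)).trans ?_
    gcongr
    refine (min_le_right _ _).trans (by simp [hh])
  have hδ : 0 < 1 - s := by linarith
  have pw : ∀ p : EE d × EE d, (φ p.1 - φ p.2)^2 * (w p.1 * w p.2) *
        (frk d s (p.1 - p.2) - kh d s h (p.1 - p.2)) ≤
      64 * (P+1) * (L^2 + 2 * L) * h ^ (2 + (1-s)) * dom d s x₀ (2*R) p := by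
    intro p
    have hdom := dom_nonneg d s x₀ (2*R) p
    have hrhs : 0 ≤ 64 * (P+1) * (L^2 + 2 * L) * h ^ (2 + (1-s)) * dom d s x₀ (2*R) p := by positivity
    by_cases hz : p.1 - p.2 = 0
    · have : p.1 = p.2 := sub_eq_zero.1 hz
      rw [this]; simpa [this] using hrhs
    by_cases hp : p.1 ∈ ball x₀ (2*R) ∨ p.2 ∈ ball x₀ (2*R)
    swap
    · push Not at hp
      rw [hφ.2.2.2 _ hp.1, hφ.2.2.2 _ hp.2]; simpa using hrhs
    have hz0 : 0 < ‖p.1 - p.2‖ := norm_pos_iff.2 hz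
    have hI : (1:ℝ) ≤ (ball x₀ (2*R)).indicator 1 p.1 + (ball x₀ (2*R)).indicator 1 p.2 := by
      have i1 := ind_bounds x₀ p.1 (2*R)
      have i2 := ind_bounds x₀ p.2 (2*R)
      rcases hp with hp | hp <;> rw [indicator_of_mem hp] at * <;> simp only [Pi.one_apply] at * <;> linarith
    have hK := frk_nonneg d s (p.1 - p.2)
    have hdiff0 : 0 ≤ frk d s (p.1 - p.2) - kh d s h (p.1 - p.2) := sub_nonneg.2 (kh_le hs0 hz)
    have hdiff1 := kh_sub hs0 (h := h) hz
    have hdiff2 : frk d s (p.1 - p.2) - kh d s h (p.1 - p.2) ≤ frk d s (p.1 - p.2) := by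
      linarith [kh_pos d s he0 (p.1 - p.2)]
    rw [← hP] at hdiff1
    have hφd1 := hφ.2.2.1 p.1 p.2
    have hm0 : 0 ≤ min 1 ‖p.1 - p.2‖ := by positivity
    have hφ2 : (φ p.1 - φ p.2)^2 ≤ 64 * (min 1 ‖p.1 - p.2‖)^2 := by
      rw [← sq_abs]
      refine (pow_le_pow_left₀ (abs_nonneg _) hφd1 2).trans (le_of_eq ?_)
      ring
    set z := p.1 - p.2 with hzd
    have hdm : dom d s x₀ (2*R) p ≥ min 1 (‖z‖ ^ (1+s)) * frk d s z := by
      unfold dom mm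
      rw [← hzd]
      have : 0 ≤ min 1 (‖z‖ ^ (1+s)) * frk d s z := by positivity
      nlinarith
    have main : |w p.1| * |w p.2| * ((min 1 ‖z‖)^2 * (frk d s z - kh d s h z)) ≤
        (P+1) * (L^2+2*L) * h ^ (2 + (1-s)) * (min 1 (‖z‖ ^ (1+s)) * frk d s z) := by
      have hpow : h ^ (2 + (1-s)) = h^2 * h ^ (1-s) := by rw [Real.rpow_add he0, Real.rpow_two]
      rcases lt_or_ge ‖z‖ 1 with hz1 | hz1
      · rw [min_eq_right hz1.le, min_eq_right (Real.rpow_le_one hz0.le hz1.le (by linarith))]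
        have hboth : p.1 ∈ ball x₀ (2*R+1) ∧ p.2 ∈ ball x₀ (2*R+1) := by
          simp only [mem_ball] at hp ⊢
          have hd1 : dist p.1 p.2 < 1 := by rw [dist_eq_norm]; exact hz1
          have t1 := dist_triangle p.1 p.2 x₀
          have t2 := dist_triangle p.2 p.1 x₀
          rw [dist_comm p.2 p.1] at t2
          rcases hp with hp | hp <;> constructor <;> linarith
        have ww : |w p.1| * |w p.2| ≤ (L * h) * (L * h) :=
          mul_le_mul (hwL _ hboth.1) (hwL _ hboth.2) (abs_nonneg _) (by positivity)
        have kk : ‖z‖^2 * (frk d s z - kh d s h z) ≤ (P+1) * h^(1-s) * (‖z‖^(1+s) * frk d s z) := by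
          have e1 : ‖z‖^(1+s) = ‖z‖^2 * ‖z‖ ^ (-(1-s)) := by
            rw [← Real.rpow_two, ← Real.rpow_add hz0]; congr 1; ring
          have e2 : h^(1-s) * ‖z‖ ^ (-(1-s)) = (h/‖z‖)^(1-s) := by
            rw [Real.div_rpow he0.le hz0.le, Real.rpow_neg hz0.le, div_eq_mul_inv]
          have e3 : (P+1) * h^(1-s) * (‖z‖^(1+s) * frk d s z) =
              ‖z‖^2 * ((P+1) * (h/‖z‖)^(1-s) * frk d s z) := by
            rw [e1, ← e2]; ring
          rw [e3]
          gcongr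
          rcases le_total (h/‖z‖) 1 with ht | ht
          · refine hdiff1.trans ?_
            gcongr ?_ * _
            rw [← div_pow]
            have : (h/‖z‖)^2 ≤ (h/‖z‖)^(1-s) := by
              rw [← Real.rpow_two]
              exact Real.rpow_le_rpow_of_exponent_ge (by positivity) ht (by linarith)
            have : 0 ≤ (h/‖z‖)^(1-s) := by positivity
            nlinarith
          · refine hdiff2.trans (le_mul_of_one_le_left hK ?_)
            have : 1 ≤ (h/‖z‖)^(1-s) := Real.one_le_rpow ht hδ.le
            nlinarith
        calc _ ≤ ((L * h) * (L * h)) * ((P+1) * h^(1-s) * (‖z‖^(1+s) * frk d s z)) :=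
              mul_le_mul ww kk (by positivity) (by positivity)
          _ = (P+1) * (L^2) * h ^ (2 + (1-s)) * (‖z‖^(1+s) * frk d s z) := by rw [hpow]; ring
          _ ≤ _ := by
            have : 0 ≤ ‖z‖^(1+s) * frk d s z := by positivity
            gcongr
            linarith
      · rw [min_eq_left hz1, min_eq_left (Real.one_le_rpow hz1 (by linarith)), one_pow, one_mul, one_mul]
        have ww : |w p.1| * |w p.2| ≤ 2 * (L * h) := by
          have hsub := ball_subset_ball (x := x₀) (by linarith : 2*R ≤ 2*R+1)
          rcases hp with hp | hp
          · rw [mul_comm]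
            exact mul_le_mul (hw2 _) (hwL _ (hsub hp)) (abs_nonneg _) (by norm_num)
          · exact mul_le_mul (hw2 _) (hwL _ (hsub hp)) (abs_nonneg _) (by norm_num)
        have kk : frk d s z - kh d s h z ≤ P * h^2 * frk d s z := by
          refine hdiff1.trans ?_
          gcongr
          exact div_le_self (by positivity) (one_le_pow₀ hz1)
        have hh1 : h ≤ h ^ (1-s) := by
          conv_lhs => rw [← Real.rpow_one h]
          exact Real.rpow_le_rpow_of_exponent_ge he0 he1 (by linarith)
        calc _ ≤ (2 * (L * h)) * (P * h^2 * frk d s z) :=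
              mul_le_mul ww kk (by positivity) (by positivity)
          _ = P * (2 * L) * (h^2 * h) * frk d s z := by ring
          _ ≤ (P+1) * (L^2+2*L) * (h^2 * h^(1-s)) * frk d s z := by
            gcongr <;> nlinarith
          _ = _ := by rw [hpow]
    calc _ ≤ (64 * (min 1 ‖z‖)^2) * (|w p.1| * |w p.2|) * (frk d s z - kh d s h z) := by
          refine mul_le_mul_of_nonneg_right ?_ hdiff0
          refine (mul_le_mul_of_nonneg_left (le_abs_self _) (sq_nonneg _)).trans ?_
          rw [abs_mul]
          exact mul_le_mul_of_nonneg_right hφ2 (by positivity)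
      _ = 64 * (|w p.1| * |w p.2| * ((min 1 ‖z‖)^2 * (frk d s z - kh d s h z))) := by ring
      _ ≤ 64 * ((P+1) * (L^2+2*L) * h ^ (2 + (1-s)) * (min 1 (‖z‖ ^ (1+s)) * frk d s z)) := by gcongr
      _ ≤ 64 * ((P+1) * (L^2+2*L) * h ^ (2 + (1-s)) * dom d s x₀ (2*R) p) := by gcongr
      _ = _ := by ring
  have hrhs : ∫ p, 64 * (P+1) * (L^2 + 2 * L) * h ^ (2 + (1-s)) * dom d s x₀ (2*R) p =
      (64 * (P+1) * (L^2 + 2 * L) * ∫ p, dom d s x₀ (2*R) p) * h ^ (2 + (1-s)) := by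
    rw [integral_const_mul]; ring
  rw [← hrhs]
  by_cases hi : Integrable (fun p : EE d × EE d => (φ p.1 - φ p.2)^2 * (w p.1 * w p.2) *
        (frk d s (p.1 - p.2) - kh d s h (p.1 - p.2)))
  · exact integral_mono hi ((dom_integrable hd hs0 hs1 _ _).const_mul _) pw
  · rw [integral_undef hi]
    exact integral_nonneg fun p => mul_nonneg (by positivity) (dom_nonneg _ _ _ _ _)


lemma trans_int {d : ℕ} (F : EE d × EE d → ℝ) (v : EE d × EE d) :
    ∫ p, F (p - v) = ∫ p, F p := by
  rw [Measure.volume_eq_prod]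
  exact integral_sub_right_eq_self F v

lemma trans_integrable {d : ℕ} {F : EE d × EE d → ℝ} (hF : Integrable F) (v : EE d × EE d) :
    Integrable (fun p => F (p - v)) := by
  rw [Measure.volume_eq_prod] at *
  exact hF.comp_sub_right v

lemma int_4 {X : Type*} [MeasurableSpace X] {μ : Measure X} {a b c e : X → ℝ}
    (ha : Integrable a μ) (hb : Integrable b μ) (hc : Integrable c μ) (he : Integrable e μ) :
    ∫ x, (1/2) * (a x + b x - c x - e x) ∂μ =
      (1/2) * (∫ x, a x ∂μ + ∫ x, b x ∂μ - ∫ x, c x ∂μ - ∫ x, e x ∂μ) := by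
  have h := int_ss (ha.add hb) hc he
  simp only [Pi.add_apply] at h
  rw [integral_const_mul, h, integral_add ha hb]

lemma step4b {d : ℕ} (hd : 1 ≤ d) {s : ℝ} (hs0 : 0 < s) (hs1 : s < 1) : ∃ C : ℝ, 0 ≤ C ∧
    ∀ {u : EE d → ℝ}, LL u → Continuous u → (∀ x, |u x| ≤ 1) → ∀ (x₀ : EE d) {R : ℝ}, 1 ≤ R →
    ∃ Cu : ℝ, 0 ≤ Cu ∧ ∀ (e : EE d) (w : EE d → ℝ), 0 < ‖e‖ → ‖e‖ ≤ 1 →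
      (∀ x, w x = u (x + e) - u x) →
      Integrable (fun p : EE d × EE d => (ph x₀ R p.1 - ph x₀ R p.2)^2 * (w p.1 * w p.2) *
        kh d s ‖e‖ (p.1 - p.2)) ∧
      ∫ p : EE d × EE d, (ph x₀ R p.1 - ph x₀ R p.2)^2 * (w p.1 * w p.2) *
        kh d s ‖e‖ (p.1 - p.2) ≤ C * (‖e‖^2 / R^2) *
          (∫ p : EE d × EE d, (u p.1 - u p.2)^2 * ph x₀ R p.1 * frk d s (p.1 - p.2))
          + Cu * ‖e‖ ^ 4 := by
  obtain ⟨C, hC, hD⟩ := D_bound d hs0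
  refine ⟨12 * C, by positivity, fun {u} hu huc hb x₀ R hR => ?_⟩
  have hR0 : 0 < R := by linarith
  have hφ := ph_CLip x₀ hR
  have hφc := ph_cont x₀ R
  have hk := frk_meas d s
  have iI : Integrable (fun p : EE d × EE d => (u p.1 - u p.2)^2 *
      ((ball x₀ (2*R+1)).indicator 1 p.1 + (ball x₀ (2*R+1)).indicator 1 p.2) *
      frk d s (p.1 - p.2)) := by
    refine AF_integrable hd hs0 hs1 hu huc x₀ (2*R+1) (g := fun p => 
      ((ball x₀ (2*R+1)).indicator 1 p.1 + (ball x₀ (2*R+1)).indicator 1 p.2)) ?_ (c := 1) ?_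
    · have : Measurable ((ball x₀ (2*R+1)).indicator (1 : EE d → ℝ)) :=
        measurable_one.indicator measurableSet_ball
      fun_prop
    · intro p
      have i1 := ind_bounds x₀ p.1 (2*R+1)
      have i2 := ind_bounds x₀ p.2 (2*R+1)
      rw [abs_of_nonneg (by positivity), one_mul]
  set I := ∫ p : EE d × EE d, (u p.1 - u p.2)^2 *
      ((ball x₀ (2*R+1)).indicator 1 p.1 + (ball x₀ (2*R+1)).indicator 1 p.2) *
      frk d s (p.1 - p.2) with hI
  have hI0 : 0 ≤ I := integral_nonneg fun p => by
    have i1 := ind_bounds x₀ p.1 (2*R+1)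
    have i2 := ind_bounds x₀ p.2 (2*R+1)
    have := frk_nonneg d s (p.1 - p.2)
    simp only [Pi.zero_apply]
    positivity
  have iJ := J_integrable hd hs0 hs1 hu huc x₀ hR0
  have iJ' := J_integrable' hd hs0 hs1 hu huc x₀ hR0
  refine ⟨6 * C * I, by positivity, fun e w he0 he1 hw => ?_⟩
  set h := ‖e‖ with hh
  have hkc := kh_cont d s he0
  set G : EE d × EE d → ℝ := fun p => (ph x₀ R p.1 - ph x₀ R p.2)^2 * kh d s h (p.1 - p.2) with hG
  have hGc : Continuous G := by rw [hG]; fun_prop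
  have G0 : ∀ p, 0 ≤ G p := fun p => mul_nonneg (sq_nonneg _) (kh_pos d s he0 _).le
  have Gb : ∀ p, G p ≤ 8^2 * dom d s x₀ (2*R) p := by
    intro p
    by_cases hz : p.1 - p.2 = 0
    · have : p.1 = p.2 := sub_eq_zero.1 hz
      have h0 := dom_nonneg d s x₀ (2*R) p
      simp only [hG, this]
      simp only [sub_self, ne_eq, OfNat.ofNat_ne_zero, not_false_eq_true, zero_pow, zero_mul]
      positivity
    · exact (mul_le_mul_of_nonneg_left (kh_le hs0 hz) (sq_nonneg _)).trans (hφ.sq_dom hs0 hs1 p)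
  have iG : ∀ F : EE d × EE d → ℝ, Continuous F → (∀ p, |F p| ≤ 4) → Integrable (fun p => F p * G p) := by
    intro F hF hF4
    refine int_of_dom hd hs0 hs1 x₀ (2*R) (4 * 8^2) (hF.mul hGc).aestronglyMeasurable fun p => ?_
    rw [abs_mul, abs_of_nonneg (G0 p), mul_assoc 4]
    exact mul_le_mul (hF4 p) (Gb p) (G0 p) (by norm_num)
  have A4 : ∀ a b : EE d, |(u a - u b)^2| ≤ 4 := by
    intro a b
    rw [abs_of_nonneg (sq_nonneg _)]
    have := abs_le.1 (hb a); have := abs_le.1 (hb b)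
    nlinarith
  have g1 := iG (fun p => (u (p.1 + e) - u p.2)^2) (by fun_prop) (fun p => A4 _ _)
  have g2 := iG (fun p => (u p.1 - u (p.2 + e))^2) (by fun_prop) (fun p => A4 _ _)
  have g3 := iG (fun p => (u (p.1 + e) - u (p.2 + e))^2) (by fun_prop) (fun p => A4 _ _)
  have g4 := iG (fun p => (u p.1 - u p.2)^2) (by fun_prop) (fun p => A4 _ _)
  have eq1 : (fun p : EE d × EE d => (ph x₀ R p.1 - ph x₀ R p.2)^2 * (w p.1 * w p.2) *
        kh d s h (p.1 - p.2)) = fun p => (1/2) * ((u (p.1 + e) - u p.2)^2 * G p +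
        (u p.1 - u (p.2 + e))^2 * G p - (u (p.1 + e) - u (p.2 + e))^2 * G p - (u p.1 - u p.2)^2 * G p) := by
    ext p
    simp only [hG, hw]; ring
  rw [eq1]
  refine ⟨(((g1.add g2).sub g3).sub g4).const_mul _, ?_⟩
  rw [int_4 g1 g2 g3 g4]
  rw [← trans_int (fun p : EE d × EE d => (u (p.1 + e) - u p.2)^2 * G p) (e, 0),
    ← trans_int (fun p : EE d × EE d => (u p.1 - u (p.2 + e))^2 * G p) (0, e),
    ← trans_int (fun p : EE d × EE d => (u (p.1 + e) - u (p.2 + e))^2 * G p) (e, e)]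
  have t1 := trans_integrable g1 (e, 0)
  have t2 := trans_integrable g2 (0, e)
  have t3 := trans_integrable g3 (e, e)
  rw [← int_4 t1 t2 t3 g4]
  have i1 := (((t1.add t2).sub t3).sub g4).const_mul (1/2)
  have pw : ∀ p : EE d × EE d, 1 / 2 *
      ((u ((p - (e, 0)).1 + e) - u (p - (e, 0)).2) ^ 2 * G (p - (e, 0)) +
            (u (p - (0, e)).1 - u ((p - (0, e)).2 + e)) ^ 2 * G (p - (0, e)) -
          (u ((p - (e, e)).1 + e) - u ((p - (e, e)).2 + e)) ^ 2 * G (p - (e, e)) -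
        (u p.1 - u p.2) ^ 2 * G p) ≤
      6 * C * (h^2/R^2) * ((u p.1 - u p.2)^2 * ph x₀ R p.1 * frk d s (p.1 - p.2) +
        (u p.1 - u p.2)^2 * ph x₀ R p.2 * frk d s (p.1 - p.2) + h^2 * ((u p.1 - u p.2)^2 *
      ((ball x₀ (2*R+1)).indicator 1 p.1 + (ball x₀ (2*R+1)).indicator 1 p.2) *
      frk d s (p.1 - p.2))) := by
    rintro ⟨x, y⟩
    simp only [Prod.fst_sub, Prod.snd_sub, sub_zero, sub_add_cancel]
    have j1 := ind_bounds x₀ x (2*R+1)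
    have j2 := ind_bounds x₀ y (2*R+1)
    set I1 := (ball x₀ (2*R+1)).indicator (1 : EE d → ℝ) x with hI1
    set I2 := (ball x₀ (2*R+1)).indicator (1 : EE d → ℝ) y with hI2
    by_cases hxy : x = y
    · rw [hxy]; simp
    have hz : x - y ≠ 0 := sub_ne_zero.2 hxy
    simp only [hG, Prod.mk_sub_mk, sub_zero, sub_sub_sub_cancel_right]
    rw [show x - e - y = x - y - e by abel, show x - (y - e) = x - y + e by abel]
    have db := hD h R e (x - y) (zt x₀ R x) (zt x₀ R (x - e)) (zt x₀ R y) (zt x₀ R (y - e)) he0 hR0 rfl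
      (zt_nonneg _ _ _) (zt_nonneg _ _ _) (zt_nonneg _ _ _) (zt_nonneg _ _ _)
      (by simpa using zt_lip x₀ hR0 x (x - e)) (by simpa using zt_lip x₀ hR0 y (y - e))
      (by refine (zt_lip x₀ hR0 (x - e) y).trans ?_
          gcongr
          rw [show x - e - y = x - y - e by abel]
          exact norm_sub_le _ _)
      (by refine (zt_lip x₀ hR0 x (y - e)).trans ?_
          gcongr
          rw [show x - (y - e) = x - y + e by abel]
          exact norm_add_le _ _)
    have hσ : (zt x₀ R x + zt x₀ R (x - e) + zt x₀ R y + zt x₀ R (y - e))^2 ≤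
        12 * (ph x₀ R x + ph x₀ R y + h^2 * (I1 + I2)) := by
      have z1 := zt_nonneg x₀ R x
      have z2 := zt_nonneg x₀ R y
      have z3 := zt_nonneg x₀ R (x-e)
      have z4 := zt_nonneg x₀ R (y-e)
      unfold ph
      by_cases hc : x ∈ ball x₀ (2*R+1) ∨ y ∈ ball x₀ (2*R+1)
      · have hII : 1 ≤ I1 + I2 := by
          rcases hc with hc | hc
          · rw [hI1, indicator_of_mem hc]; simp only [Pi.one_apply]; linarith
          · rw [hI2, indicator_of_mem hc]; simp only [Pi.one_apply]; linarith
        have l1 := zt_lip x₀ hR0 x (x - e)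
        have l2 := zt_lip x₀ hR0 y (y - e)
        rw [sub_sub_cancel, ← hh] at l1 l2
        have hhR : h / R ≤ h := div_le_self he0.le hR
        have l1' := (abs_le.1 l1).1
        have l2' := (abs_le.1 l2).1
        have hle : zt x₀ R x + zt x₀ R (x - e) + zt x₀ R y + zt x₀ R (y - e) ≤
          2 * (zt x₀ R x + zt x₀ R y + h) := by linarith
        refine (pow_le_pow_left₀ (by positivity) hle 2).trans ?_
        have : h^2 ≤ h^2 * (I1 + I2) := le_mul_of_one_le_right (by positivity) hII
        nlinarith [sq_nonneg (zt x₀ R x - zt x₀ R y), sq_nonneg (zt x₀ R x - h), sq_nonneg (zt x₀ R y - h)]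
      · push Not at hc
        have s0 : ∀ t, t ∉ ball x₀ (2*R+1) → zt x₀ R t = 0 ∧ zt x₀ R (t - e) = 0 := by
          intro t ht
          constructor
          · exact zt_supp x₀ hR0 (fun h' => ht (ball_subset_ball (by linarith) h'))
          · apply zt_supp x₀ hR0
            intro h'
            apply ht
            rw [mem_ball, dist_eq_norm] at h' ⊢
            have := norm_add_le (t - e - x₀) e
            rw [show t - e - x₀ + e = t - x₀ by abel] at this
            linarith
        rw [(s0 x hc.1).1, (s0 x hc.1).2, (s0 y hc.2).1, (s0 y hc.2).2]
        have : 0 ≤ h^2 * (I1 + I2) := by positivity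
        norm_num
        exact this
    have hkk := kh_le hs0 (h := h) hz
    have hk0 := (kh_pos d s he0 (x - y)).le
    have hA := sq_nonneg (u x - u y)
    have hK := frk_nonneg d s (x - y)
    unfold ph at hσ ⊢
    calc _ = 1/2 * ((u x - u y)^2 * ((zt x₀ R (x-e)^2 - zt x₀ R y^2)^2 * kh d s h (x - y - e)
        + (zt x₀ R x^2 - zt x₀ R (y-e)^2)^2 * kh d s h (x - y + e)
      - (zt x₀ R (x-e)^2 - zt x₀ R (y-e)^2)^2 * kh d s h (x-y)
      - (zt x₀ R x^2 - zt x₀ R y^2)^2 * kh d s h (x-y))) := by ring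
      _ ≤ 1/2 * ((u x - u y)^2 * (C * (h^2/R^2) *
        (12 * (zt x₀ R x^2 + zt x₀ R y^2 + h^2 * (I1 + I2))) * frk d s (x - y))) := by
        refine mul_le_mul_of_nonneg_left (mul_le_mul_of_nonneg_left ?_ hA) (by norm_num)
        refine (le_abs_self _).trans (db.trans ?_)
        gcongr
      _ = _ := by ring
  have i2 := (((iJ.add iJ').add (iI.const_mul (h^2))).const_mul (6 * C * (h^2/R^2)))
  refine (integral_mono i1 i2 pw).trans ?_
  simp only [Pi.add_apply]
  rw [integral_const_mul]
  have e3 := integral_add (iJ.add iJ') (iI.const_mul (h^2))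
  simp only [Pi.add_apply] at e3
  rw [e3, integral_add iJ iJ', J_swap, integral_const_mul, ← hI]
  have : h^2/R^2 ≤ h^2 := div_le_self (by positivity) (one_le_pow₀ hR)
  have h3 : h^2/R^2 * (h^2 * I) ≤ h^2 * (h^2 * I) := by gcongr
  have h4 := mul_le_mul_of_nonneg_left h3 (by positivity : 0 ≤ 6 * C)
  linarith


lemma vol_ball {d : ℕ} (hd : 1 ≤ d) (x₀ : EE d) {r : ℝ} (hr : 0 ≤ r) :
    volume.real (ball x₀ r) = r ^ d * volume.real (ball (0 : EE d) 1) := by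
  haveI := nontriv hd
  have := Measure.addHaar_ball (volume : Measure (EE d)) x₀ hr
  unfold Measure.real
  rw [this, ENNReal.toReal_mul, ENNReal.toReal_ofReal (by positivity)]; simp

lemma phw_integrable {d : ℕ} (x₀ : EE d) {R : ℝ} (hR : 1 ≤ R) {g : EE d → ℝ} (hg : Continuous g) :
    Integrable (fun x => ph x₀ R x * g x) := (ph_CLip x₀ hR).integrable_mul hg

lemma S_bound {d : ℕ} {u : EE d → ℝ} (huc : Continuous u)
    (hb : ∀ x, |u x| ≤ 1) (x₀ : EE d) {R : ℝ} (hR : 1 ≤ R) (e : EE d) (he : ‖e‖ ≤ 1) :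
    |∫ x, ph x₀ R x * (u (x + e) - u x)| ≤ 8 * (‖e‖ / R) * volume.real (ball x₀ (3*R)) := by
  have hR0 : 0 < R := by linarith
  have i1 := phw_integrable x₀ hR huc
  have i2 := phw_integrable x₀ hR (huc.comp (continuous_add_const e))
  have i3 : Integrable (fun x => ph x₀ R (x - e) * u x) := by
    have := i2.comp_sub_right e
    simpa using this
  have e1 : ∫ x, ph x₀ R x * (u (x + e) - u x) = ∫ x, (ph x₀ R (x - e) * u x - ph x₀ R x * u x) := by
    rw [integral_sub i3 i1]
    simp_rw [mul_sub]
    have i2' : Integrable (fun x => ph x₀ R x * u (x + e)) := i2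
    rw [integral_sub i2' i1]
    congr 1
    rw [← integral_sub_right_eq_self (fun x => ph x₀ R x * u (x + e)) e]
    simp
  rw [e1]
  have bnd : ∀ x, ‖ph x₀ R (x - e) * u x - ph x₀ R x * u x‖ ≤
      (ball x₀ (3*R)).indicator (fun _ => 8 * (‖e‖ / R)) x := by
    intro x
    rw [Real.norm_eq_abs, ← sub_mul, abs_mul]
    by_cases hx : x ∈ ball x₀ (3*R)
    · rw [indicator_of_mem hx]
      have h1 := ph_lip x₀ hR0 (x - e) x
      have h2 : min 1 (‖x - e - x‖ / R) ≤ ‖e‖ / R := by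
        refine (min_le_right _ _).trans (by simp)
      have h3 := zt_le x₀ hR0 x
      have h4 := zt_le x₀ hR0 (x - e)
      have h5 := zt_nonneg x₀ R x
      have h6 := zt_nonneg x₀ R (x - e)
      have h7 : 0 ≤ ‖e‖ / R := by positivity
      calc _ ≤ |ph x₀ R (x - e) - ph x₀ R x| * 1 := by gcongr; exact hb x
        _ ≤ 2 * min 1 (‖x - e - x‖ / R) * (zt x₀ R (x - e) + zt x₀ R x) := by linarith
        _ ≤ 2 * (‖e‖ / R) * (2 + 2) := by gcongr
        _ = _ := by ring
    · rw [indicator_of_notMem hx]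
      rw [mem_ball, dist_eq_norm, not_lt] at hx
      have h1 : x ∉ ball x₀ (2*R) := by
        rw [mem_ball, dist_eq_norm]; linarith
      have h2 : x - e ∉ ball x₀ (2*R) := by
        rw [mem_ball, dist_eq_norm]
        have := norm_sub_norm_le (x - x₀) e
        rw [show x - x₀ - e = x - e - x₀ by abel] at this
        linarith
      rw [ph_supp x₀ hR0 h1, ph_supp x₀ hR0 h2]; simp
  rw [← Real.norm_eq_abs]
  refine (norm_integral_le_of_norm_le ?_ (Eventually.of_forall bnd)).trans (le_of_eq ?_)
  · exact (integrable_indicator_iff measurableSet_ball).2 (integrableOn_const (measure_ball_lt_top.ne))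
  · rw [integral_indicator_const _ measurableSet_ball, smul_eq_mul]; ring

lemma PS_bound {d : ℕ} {s : ℝ} (hs0 : 0 < s) {w : EE d → ℝ} (hw : Continuous w)
    (x₀ : EE d) {R : ℝ} (hR : 1 ≤ R)
    (hi : Integrable (fun p : EE d × EE d => 2 * (ph x₀ R p.1 * ph x₀ R p.2 *
        (|w p.1| * |w p.2| - w p.1 * w p.2)) * frk d s (p.1 - p.2))) :
    2 * ((4*R) ^ ((d:ℝ) + 2*s))⁻¹ * ((∫ x, ph x₀ R x * |w x|)^2 - (∫ x, ph x₀ R x * w x)^2) ≤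
      ∫ p : EE d × EE d, 2 * (ph x₀ R p.1 * ph x₀ R p.2 *
        (|w p.1| * |w p.2| - w p.1 * w p.2)) * frk d s (p.1 - p.2) := by
  have hR0 : 0 < R := by linarith
  have i1 := phw_integrable x₀ hR hw
  have i2 := phw_integrable x₀ hR hw.abs
  have m1 := i1.mul_prod i1
  have m2 := i2.mul_prod i2
  have e1 := integral_prod_mul (μ := (volume : Measure (EE d))) (ν := (volume : Measure (EE d))) (fun x => ph x₀ R x * w x) (fun x => ph x₀ R x * w x)
  have e2 := integral_prod_mul (μ := (volume : Measure (EE d))) (ν := (volume : Measure (EE d))) (fun x => ph x₀ R x * |w x|) (fun x => ph x₀ R x * |w x|)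
  rw [sq, sq, ← e1, ← e2, ← integral_sub m2 m1, ← integral_const_mul]
  refine integral_mono ((m2.sub m1).const_mul _) hi ?_
  intro p
  have hc : 0 ≤ ph x₀ R p.1 * ph x₀ R p.2 * (|w p.1| * |w p.2| - w p.1 * w p.2) := by
    refine mul_nonneg (mul_nonneg (ph_nonneg _ _ _) (ph_nonneg _ _ _)) ?_
    rw [← abs_mul]; linarith [le_abs_self (w p.1 * w p.2)]
  have : 2 * ((4*R) ^ ((d:ℝ) + 2*s))⁻¹ * (ph x₀ R p.1 * |w p.1| * (ph x₀ R p.2 * |w p.2|) - ph x₀ R p.1 * w p.1 * (ph x₀ R p.2 * w p.2))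
    = 2 * (ph x₀ R p.1 * ph x₀ R p.2 * (|w p.1| * |w p.2| - w p.1 * w p.2)) * ((4*R) ^ ((d:ℝ) + 2*s))⁻¹ := by ring
  change 2 * ((4*R) ^ ((d:ℝ) + 2*s))⁻¹ * (ph x₀ R p.1 * |w p.1| * (ph x₀ R p.2 * |w p.2|) - ph x₀ R p.1 * w p.1 * (ph x₀ R p.2 * w p.2)) ≤ 2 * (ph x₀ R p.1 * ph x₀ R p.2 *
        (|w p.1| * |w p.2| - w p.1 * w p.2)) * frk d s (p.1 - p.2)
  rw [this]
  by_cases h1 : p.1 ∈ ball x₀ (2*R)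
  swap
  · rw [ph_supp x₀ hR0 h1]; simp
  by_cases h2 : p.2 ∈ ball x₀ (2*R)
  swap
  · rw [ph_supp x₀ hR0 h2]; simp
  by_cases h3 : p.1 = p.2
  · rw [h3]; rw [abs_mul_abs_self]; simp
  refine mul_le_mul_of_nonneg_left ?_ (by positivity)
  have h4 : 0 < ‖p.1 - p.2‖ := norm_pos_iff.2 (sub_ne_zero.2 h3)
  have h5 : ‖p.1 - p.2‖ ≤ 4 * R := by
    rw [← dist_eq_norm]
    have := dist_triangle_right p.1 p.2 x₀
    rw [mem_ball] at h1 h2; linarith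
  unfold frk
  refine inv_anti₀ (by positivity) ?_
  exact Real.rpow_le_rpow h4.le h5 (by positivity)

set_option maxHeartbeats 400000 in
lemma HQ {d : ℕ} (hd : 1 ≤ d) {s : ℝ} (hs : 1/2 ≤ s) (hs1 : s < 1) : ∃ C : ℝ, 0 < C ∧
    ∀ {α : ℝ} {f f' : ℝ → ℝ} {u : EE d → ℝ}, 0 < α → IsC1Alpha f f' α → IsStableSolution d s f f' u →
    ∀ (x₀ : EE d) {R : ℝ}, 1 ≤ R → ∃ γ Cu : ℝ, 0 < γ ∧ 0 ≤ Cu ∧ ∀ e : EE d, 0 < ‖e‖ → ‖e‖ ≤ 1 →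
      (∫ x, ph x₀ R x * |u (x + e) - u x|)^2 ≤ ‖e‖^2 * (C * ((R ^ ((d:ℝ) + 2*s - 2))^2 +
        R ^ ((d:ℝ) + 2*s - 2) * ∫ p : EE d × EE d, (u p.1 - u p.2)^2 * ph x₀ R p.1 * frk d s (p.1 - p.2))
         + Cu * ‖e‖ ^ γ) := by
  have hs0 : 0 < s := by linarith
  obtain ⟨C, hC, h4b⟩ := step4b hd hs0 hs1
  set ω := volume.real (ball (0 : EE d) 1) with hω
  have hω0 : 0 ≤ ω := measureReal_nonneg
  refine ⟨(8 * 3^d * ω)^2 + 4 ^ ((d:ℝ) + 2*s) * C / 2 + 1, by positivity, ?_⟩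
  intro α f f' u hα hf hu x₀ R hR
  have hR0 : 0 < R := by linarith
  have hb := hu.2.1
  have huc : Continuous u := hu.1.continuous
  have huL : LL u := LL_of_C1 (hu.1.of_le (by norm_num)) hb
  obtain ⟨C3, hC3, h3⟩ := step3 hd hs0 hs1 hα hf hu x₀ hR
  obtain ⟨C4, hC4, h4a⟩ := step4a hd hs0 hs1 huL huc hb x₀ hR
  obtain ⟨C5, hC5, h4b⟩ := h4b huL huc hb x₀ hR
  set J := ∫ p : EE d × EE d, (u p.1 - u p.2)^2 * ph x₀ R p.1 * frk d s (p.1 - p.2) with hJ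
  have hJ0 : 0 ≤ J := integral_nonneg fun p => mul_nonneg (mul_nonneg (sq_nonneg _) (ph_nonneg _ _ _)) (frk_nonneg _ _ _)
  refine ⟨min (1-s) α, (4*R) ^ ((d:ℝ) + 2*s) / 2 * (C3 + C4 + C5), lt_min (by linarith) hα, by positivity, ?_⟩
  intro e he he1
  set γ := min (1-s) α with hγ
  set w : EE d → ℝ := fun x => u (x + e) - u x with hwd
  have hwc : Continuous w := by rw [hwd]; fun_prop
  have hw2 : ∀ x, |w x| ≤ 2 := by
    intro x
    have := abs_le.1 (hb (x+e)); have := abs_le.1 (hb x)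
    rw [abs_le]; constructor <;> simp only [hwd] <;> linarith
  obtain ⟨i3, h3⟩ := h3 e w (fun x => rfl)
  have h4a := h4a e w he he1 (fun x => rfl)
  obtain ⟨i4, h4b⟩ := h4b e w he he1 (fun x => rfl)
  have hS := S_bound huc hb x₀ hR e he1
  have hP := PS_bound hs0 hwc x₀ hR i3
  have hφ := ph_CLip x₀ hR
  have hk := frk_meas d s
  have hφc := ph_cont x₀ R
  have i5 : Integrable (fun p : EE d × EE d =>
      (ph x₀ R p.1 - ph x₀ R p.2)^2 * (w p.1 * w p.2) * frk d s (p.1 - p.2)) := by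
    refine int_of_dom hd hs0 hs1 x₀ (2*R) (4 * 8^2) ?_ ?_
    · exact (by fun_prop : Measurable _).aestronglyMeasurable
    · intro p
      have hs := hφ.sq_dom hs0 hs1 p
      have hk0 := frk_nonneg d s (p.1 - p.2)
      have : |(ph x₀ R p.1 - ph x₀ R p.2)^2 * (w p.1 * w p.2) * frk d s (p.1 - p.2)| =
        (|w p.1| * |w p.2|) * ((ph x₀ R p.1 - ph x₀ R p.2)^2 * frk d s (p.1 - p.2)) := by
        rw [abs_mul, abs_mul, abs_mul, abs_of_nonneg hk0, abs_of_nonneg (sq_nonneg _)]; ring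
      rw [this, mul_assoc 4]
      refine mul_le_mul ?_ hs (mul_nonneg (sq_nonneg _) hk0) (by norm_num)
      nlinarith [hw2 p.1, hw2 p.2, abs_nonneg (w p.1), abs_nonneg (w p.2)]
  have hsplit : ∫ p : EE d × EE d, (ph x₀ R p.1 - ph x₀ R p.2)^2 * (w p.1 * w p.2) * (frk d s (p.1 - p.2) - kh d s ‖e‖ (p.1 - p.2)) =
      (∫ p : EE d × EE d, (ph x₀ R p.1 - ph x₀ R p.2)^2 * (w p.1 * w p.2) * frk d s (p.1 - p.2)) -
      ∫ p : EE d × EE d, (ph x₀ R p.1 - ph x₀ R p.2)^2 * (w p.1 * w p.2) * kh d s ‖e‖ (p.1 - p.2) := by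
    rw [← integral_sub i5 i4]; simp_rw [mul_sub]
  rw [hsplit] at h4a
  set P := ∫ x, ph x₀ R x * |w x| with hPd
  set S := ∫ x, ph x₀ R x * w x with hSd
  change P^2 ≤ _
  change |S| ≤ _ at hS
  rw [vol_ball hd x₀ (by positivity : (0:ℝ) ≤ 3*R), ← hω] at hS
  set h := ‖e‖ with hh
  have e1 : h ^ (2 + α) ≤ h^2 * h ^ γ := by
    rw [← Real.rpow_two, ← Real.rpow_add he]
    exact Real.rpow_le_rpow_of_exponent_ge he he1 (by linarith [min_le_right (1-s) α])
  have e2 : h ^ (2 + (1-s)) ≤ h^2 * h ^ γ := by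
    rw [← Real.rpow_two, ← Real.rpow_add he]
    exact Real.rpow_le_rpow_of_exponent_ge he he1 (by linarith [min_le_left (1-s) α])
  have e3 : h ^ 4 ≤ h^2 * h ^ γ := by
    rw [← Real.rpow_two, ← Real.rpow_add he, ← Real.rpow_natCast]
    exact Real.rpow_le_rpow_of_exponent_ge he he1 (by push_cast; linarith [min_le_left (1-s) α])
  set H := h^2 * h^γ with hH
  set K := (4*R) ^ ((d:ℝ) + 2*s) with hK
  have hK0 : 0 < K := by positivity
  set Y := R ^ ((d:ℝ) + 2*s - 2) with hY
  have hY0 : 0 < Y := by positivity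
  have hKY : K / R^2 = 4 ^ ((d:ℝ) + 2*s) * Y := by
    rw [hK, hY, Real.mul_rpow (by norm_num) hR0.le, Real.rpow_sub hR0, Real.rpow_two]; ring
  have hRd : R ^ d / R ≤ Y := by
    have : R ^ d / R = R ^ ((d:ℝ) - 1) := by
      rw [Real.rpow_sub hR0, Real.rpow_natCast, Real.rpow_one]
    rw [this, hY]
    exact Real.rpow_le_rpow_of_exponent_le hR (by linarith)
  have hS2 : S^2 ≤ h^2 * ((8 * 3^d * ω)^2 * Y^2) := by
    have : |S| ≤ h * (8 * 3^d * ω * Y) := by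
      refine hS.trans ?_
      rw [mul_pow]
      calc _ = h * (8 * 3^d * ω * (R^d / R)) := by ring
        _ ≤ _ := by gcongr
    calc S^2 = |S|^2 := (sq_abs _).symm
      _ ≤ (h * (8 * 3^d * ω * Y))^2 := by gcongr
      _ = _ := by ring
  have hmain : 2 * K⁻¹ * (P^2 - S^2) ≤ C * (h^2/R^2) * J + (C3 + C4 + C5) * H := by
    nlinarith [mul_le_mul_of_nonneg_left e1 hC3, mul_le_mul_of_nonneg_left e2 hC4, mul_le_mul_of_nonneg_left e3 hC5]
  have hmain2 : P^2 - S^2 ≤ K/2 * (C * (h^2/R^2) * J + (C3 + C4 + C5) * H) := by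
    have := mul_le_mul_of_nonneg_left hmain (by positivity : 0 ≤ K/2)
    calc P^2 - S^2 = K/2 * (2 * K⁻¹ * (P^2 - S^2)) := by field_simp
      _ ≤ _ := this
  have h6 : K/2 * (C * (h^2/R^2) * J) = h^2 * (4 ^ ((d:ℝ) + 2*s) * C / 2 * (Y * J)) := by
    calc _ = h^2 * ((K/R^2) * C / 2 * J) := by ring
      _ = _ := by rw [hKY]; ring
  have h7 : 0 ≤ h^2 * ((8 * 3^d * ω)^2 * (Y * J)) := by positivity
  have h8 : 0 ≤ h^2 * (4 ^ ((d:ℝ) + 2*s) * C / 2 * Y^2) := by positivity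
  have h9 : 0 ≤ h^2 * (Y^2 + Y * J) := by positivity
  calc P^2 ≤ S^2 + K/2 * (C * (h^2/R^2) * J) + K/2 * ((C3+C4+C5)*H) := by linarith
    _ ≤ h^2 * ((8 * 3^d * ω)^2 * Y^2) + h^2 * (4 ^ ((d:ℝ) + 2*s) * C / 2 * (Y * J)) + K/2 * ((C3+C4+C5)*H) := by
      rw [h6]; gcongr
    _ ≤ h^2 * ((8 * 3^d * ω)^2 * Y^2) + h^2 * (4 ^ ((d:ℝ) + 2*s) * C / 2 * (Y * J)) + K/2 * ((C3+C4+C5)*H)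
       + (h^2 * ((8 * 3^d * ω)^2 * (Y * J)) + h^2 * (4 ^ ((d:ℝ) + 2*s) * C / 2 * Y^2) + h^2 * (Y^2 + Y * J)) := by linarith
    _ = _ := by rw [hH]; ring


lemma tele {d : ℕ} {u : EE d → ℝ} (huc : Continuous u)
    (hb : ∀ x, |u x| ≤ 1) (x₀ : EE d) {R : ℝ} (hR : 1 ≤ R) (N : ℕ) (e : EE d) :
    ∫ x, ph x₀ R x * |u (x + (N:ℝ) • e) - u x| ≤
      2 * (N * ∫ x, ph x₀ R x * |u (x + e) - u x|) + 4 * (‖(N:ℝ) • e‖ / R)^2 * volume.real (ball x₀ (2*R)) := by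
  have hR0 : 0 < R := by linarith
  set z := (N:ℝ) • e with hz
  set t := ‖z‖ / R with ht
  have ht0 : 0 ≤ t := by positivity
  set G : EE d → ℝ := fun x => ph x₀ R x * |u (x + e) - u x| with hG
  have hGi : Integrable G := phw_integrable x₀ hR (by fun_prop)
  have hGk : ∀ k : ℕ, Integrable (fun x => G (x + (k:ℝ) • e)) := fun k => hGi.comp_add_right _
  have hsum : Integrable (fun x => ∑ k ∈ Finset.range N, G (x + (k:ℝ) • e)) :=
    integrable_finsetSum _ fun k _ => hGk k
  have hind : Integrable ((ball x₀ (2*R)).indicator (fun _ => 4 * t^2)) :=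
    (integrable_indicator_iff measurableSet_ball).2 (integrableOn_const (measure_ball_lt_top.ne))
  have key : ∀ x, ph x₀ R x * |u (x + z) - u x| ≤
      2 * (∑ k ∈ Finset.range N, G (x + (k:ℝ) • e)) + (ball x₀ (2*R)).indicator (fun _ => 4 * t^2) x := by
    intro x
    have hG0 : ∀ y, 0 ≤ G y := fun y => mul_nonneg (ph_nonneg _ _ _) (abs_nonneg _)
    by_cases hx : x ∈ ball x₀ (2*R)
    · rw [indicator_of_mem hx]
      have hw2 : |u (x + z) - u x| ≤ 2 := by
        have := abs_le.1 (hb (x+z)); have := abs_le.1 (hb x)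
        rw [abs_le]; constructor <;> linarith
      set m := max 0 (zt x₀ R x - t) with hm
      have hm0 : 0 ≤ m := le_max_left _ _
      have hζ0 := zt_nonneg x₀ R x
      have h1 : ph x₀ R x ≤ 2 * m^2 + 2 * t^2 := by
        have : zt x₀ R x ≤ m + t := by linarith [le_max_right 0 (zt x₀ R x - t)]
        unfold ph
        nlinarith [sq_nonneg (m - t)]
      have h2 : m^2 * |u (x + z) - u x| ≤ ∑ k ∈ Finset.range N, G (x + (k:ℝ) • e) := by
        have e1 : u (x + z) - u x = ∑ k ∈ Finset.range N, (u (x + ((k+1 : ℕ):ℝ) • e) - u (x + (k:ℝ) • e)) := by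
          rw [Finset.sum_range_sub (fun k : ℕ => u (x + (k:ℝ) • e))]; simp [hz]
        rw [e1]
        refine (mul_le_mul_of_nonneg_left (Finset.abs_sum_le_sum_abs _ _) (sq_nonneg m)).trans ?_
        rw [Finset.mul_sum]
        refine Finset.sum_le_sum fun k hk => ?_
        have hk' : (k:ℝ) ≤ N := by exact_mod_cast (Finset.mem_range.1 hk).le
        have e2 : x + ((k+1 : ℕ):ℝ) • e = x + (k:ℝ) • e + e := by
          push_cast; rw [add_smul, one_smul, add_assoc]
        rw [e2]
        refine mul_le_mul_of_nonneg_right ?_ (abs_nonneg _)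
        unfold ph
        refine pow_le_pow_left₀ hm0 ?_ 2
        refine max_le (zt_nonneg _ _ _) ?_
        have h3 := (abs_le.1 (zt_lip x₀ hR0 x (x + (k:ℝ) • e))).2
        have h4 : ‖x - (x + (k:ℝ) • e)‖ / R ≤ t := by
          rw [ht, hz, sub_add_cancel_left, norm_neg, norm_smul, norm_smul]
          simp only [RCLike.norm_natCast]
          gcongr
        linarith
      calc _ ≤ (2 * m^2 + 2 * t^2) * |u (x + z) - u x| := by gcongr
        _ = 2 * (m^2 * |u (x + z) - u x|) + 2 * t^2 * |u (x + z) - u x| := by ring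
        _ ≤ 2 * (∑ k ∈ Finset.range N, G (x + (k:ℝ) • e)) + 2 * t^2 * 2 := by gcongr
        _ = _ := by ring
    · rw [indicator_of_notMem hx, ph_supp x₀ hR0 hx]
      have := Finset.sum_nonneg (s := Finset.range N) (fun k _ => hG0 (x + (k:ℝ) • e))
      linarith
  refine (integral_mono (phw_integrable x₀ hR (by fun_prop)) ((hsum.const_mul 2).add hind) key).trans (le_of_eq ?_)
  rw [integral_add' (hsum.const_mul 2) hind, integral_const_mul, integral_finsetSum _ (fun k _ => hGk k),
    integral_indicator_const _ measurableSet_ball, smul_eq_mul]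
  simp_rw [integral_add_right_eq_self G]
  simp only [Finset.sum_const, Finset.card_range, nsmul_eq_mul]
  ring

lemma T_lem {d : ℕ} {u : EE d → ℝ} (huc : Continuous u)
    (hb : ∀ x, |u x| ≤ 1) (x₀ : EE d) {R : ℝ} (hR : 1 ≤ R) {Q2 Cu γ : ℝ} (hQ2 : 0 ≤ Q2) (hγ : 0 < γ)
    (H : ∀ e : EE d, 0 < ‖e‖ → ‖e‖ ≤ 1 →
      (∫ x, ph x₀ R x * |u (x + e) - u x|)^2 ≤ ‖e‖^2 * (Q2 + Cu * ‖e‖ ^ γ)) (z : EE d) :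
    ∫ x, ph x₀ R x * |u (x + z) - u x| ≤
      2 * ‖z‖ * √Q2 + 4 * (‖z‖ / R)^2 * volume.real (ball x₀ (2*R)) := by
  by_cases hz : z = 0
  · subst hz; simp
  have hz0 : 0 < ‖z‖ := norm_pos_iff.2 hz
  have lim : Tendsto (fun N : ℕ => 2 * ‖z‖ * √(Q2 + Cu * (‖z‖ / N) ^ γ) + 4 * (‖z‖ / R)^2 * volume.real (ball x₀ (2*R)))
      atTop (𝓝 (2 * ‖z‖ * √(Q2 + Cu * 0 ^ γ) + 4 * (‖z‖ / R)^2 * volume.real (ball x₀ (2*R)))) := by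
    have h1 : Tendsto (fun N : ℕ => ‖z‖ / N) atTop (𝓝 0) := tendsto_const_div_atTop_nhds_zero_nat _
    have h2 := h1.rpow_const (p := γ) (Or.inr hγ.le)
    exact (((h2.const_mul Cu).const_add Q2).sqrt.const_mul (2 * ‖z‖)).add_const _
  rw [Real.zero_rpow hγ.ne', mul_zero, add_zero] at lim
  refine ge_of_tendsto lim ?_
  filter_upwards [eventually_ge_atTop (Nat.ceil ‖z‖ + 1)] with N hN
  have hN1 : ‖z‖ ≤ N := (Nat.le_ceil _).trans (by exact_mod_cast (by omega : Nat.ceil ‖z‖ ≤ N))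
  have hN0 : (0:ℝ) < N := lt_of_lt_of_le hz0 hN1
  set e := (N:ℝ)⁻¹ • z with he
  have hen : ‖e‖ = ‖z‖ / N := by
    rw [he, norm_smul, norm_inv, RCLike.norm_natCast]; field_simp
  have hNe : (N:ℝ) • e = z := by rw [he, smul_smul, mul_inv_cancel₀ hN0.ne', one_smul]
  have ht := tele huc hb x₀ hR N e
  rw [hNe] at ht
  refine ht.trans ?_
  have h1 := H e (by rw [hen]; positivity) (by rw [hen, div_le_one hN0]; exact hN1)
  rw [hen] at h1
  have h2 : ∫ x, ph x₀ R x * |u (x + e) - u x| ≤ ‖z‖ / N * √(Q2 + Cu * (‖z‖ / N) ^ γ) := by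
    have := Real.le_sqrt_of_sq_le h1
    rwa [Real.sqrt_mul (sq_nonneg _), Real.sqrt_sq (by positivity)] at this
  have h3 : (N:ℝ) * ∫ x, ph x₀ R x * |u (x + e) - u x| ≤ ‖z‖ * √(Q2 + Cu * (‖z‖ / N) ^ γ) := by
    calc _ ≤ (N:ℝ) * (‖z‖ / N * √(Q2 + Cu * (‖z‖ / N) ^ γ)) := by gcongr
      _ = _ := by field_simp
  linarith

lemma P_le {d : ℕ} {u : EE d → ℝ} (huc : Continuous u)
    (hb : ∀ x, |u x| ≤ 1) (x₀ : EE d) {R : ℝ} (hR : 1 ≤ R) (z : EE d) :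
    ∫ x, ph x₀ R x * |u (x + z) - u x| ≤ 8 * volume.real (ball x₀ (2*R)) := by
  have hR0 : 0 < R := by linarith
  have hind : Integrable ((ball x₀ (2*R)).indicator (fun _ => (8:ℝ))) :=
    (integrable_indicator_iff measurableSet_ball).2 (integrableOn_const (measure_ball_lt_top.ne))
  refine (integral_mono (phw_integrable x₀ hR (by fun_prop)) hind ?_).trans (le_of_eq ?_)
  · intro x
    simp only
    by_cases hx : x ∈ ball x₀ (2*R)
    · rw [indicator_of_mem hx]
      have hw2 : |u (x + z) - u x| ≤ 2 := by
        have := abs_le.1 (hb (x+z)); have := abs_le.1 (hb x)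
        rw [abs_le]; constructor <;> linarith
      nlinarith [ph_le x₀ hR0 x, ph_nonneg x₀ R x, abs_nonneg (u (x + z) - u x)]
    · rw [indicator_of_notMem hx, ph_supp x₀ hR0 hx]; simp
  · rw [integral_indicator_const _ measurableSet_ball, smul_eq_mul]; ring


lemma moll {d : ℕ} (hd : 1 ≤ d) : ∃ (ρ : EE d → ℝ) (Cρ : ℝ), Continuous ρ ∧ Integrable ρ ∧ (∀ z, 0 ≤ ρ z) ∧
    (∀ z, 1 ≤ ‖z‖ → ρ z = 0) ∧ ∫ z, ρ z = 1 ∧ 0 ≤ Cρ ∧ ∀ u : EE d → ℝ, Continuous u → (∀ x, |u x| ≤ 1) →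
      (∀ x, |∫ z, ρ z * u (x + z)| ≤ 1) ∧
      ∀ x y, |(∫ z, ρ z * u (x + z)) - ∫ z, ρ z * u (y + z)| ≤ Cρ * min 1 ‖x - y‖ := by
  set r0 : EE d → ℝ := fun z => max 0 (1 - ‖z‖) with hr0
  have rc : Continuous r0 := by fun_prop
  have r0n : ∀ z, 0 ≤ r0 z := fun z => le_max_left _ _
  have r0z : ∀ z, 1 ≤ ‖z‖ → r0 z = 0 := fun z hz => max_eq_left (by linarith)
  have r0s : HasCompactSupport r0 := by
    refine HasCompactSupport.intro (isCompact_closedBall (0 : EE d) 1) fun z hz => r0z z ?_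
    rw [mem_closedBall, dist_zero_right, not_le] at hz; exact hz.le
  have r0i : Integrable r0 := rc.integrable_of_hasCompactSupport r0s
  have r0p : 0 < ∫ z, r0 z := by
    rw [integral_pos_iff_support_of_nonneg r0n r0i]
    refine (measure_ball_pos volume (0 : EE d) one_pos).trans_le (measure_mono ?_)
    intro z hz
    rw [mem_ball, dist_zero_right] at hz
    have : 0 < r0 z := lt_max_of_lt_right (by linarith)
    exact this.ne'
  set I := ∫ z, r0 z with hI
  set ω := volume.real (ball (0 : EE d) 1) with hω
  have hω0 : 0 ≤ ω := measureReal_nonneg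
  set ρ : EE d → ℝ := fun z => I⁻¹ * r0 z with hρ
  have ρi : Integrable ρ := r0i.const_mul _
  have ρc : Continuous ρ := by fun_prop
  have ρn : ∀ z, 0 ≤ ρ z := fun z => mul_nonneg (inv_nonneg.2 r0p.le) (r0n z)
  have ρ1 : ∫ z, ρ z = 1 := by
    rw [hρ, integral_const_mul]; exact inv_mul_cancel₀ r0p.ne'
  refine ⟨ρ, 2 + 2 * I⁻¹ * ω, ρc, ρi, ρn, fun z hz => by simp [hρ, r0z z hz], ρ1, by positivity, ?_⟩
  intro u huc hb
  have ui : ∀ x, Integrable (fun z => ρ z * u (x + z)) := by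
    intro x
    refine ρi.mono' (by fun_prop) (Eventually.of_forall fun z => ?_)
    rw [norm_mul, Real.norm_eq_abs, Real.norm_eq_abs, abs_of_nonneg (ρn z)]
    exact mul_le_of_le_one_right (ρn z) (hb _)
  have u1 : ∀ x, |∫ z, ρ z * u (x + z)| ≤ 1 := by
    intro x
    rw [← ρ1, ← Real.norm_eq_abs]
    refine norm_integral_le_of_norm_le ρi (Eventually.of_forall fun z => ?_)
    rw [norm_mul, Real.norm_eq_abs, Real.norm_eq_abs, abs_of_nonneg (ρn z)]
    exact mul_le_of_le_one_right (ρn z) (hb _)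
  refine ⟨u1, fun x y => ?_⟩
  have sh : ∀ x, ∫ z, ρ z * u (x + z) = ∫ z, ρ (z - x) * u z := by
    intro x
    rw [← integral_sub_right_eq_self (fun z => ρ z * u (x + z)) x]
    simp
  have shi : ∀ x, Integrable (fun z => ρ (z - x) * u z) := by
    intro x
    have := (ui x).comp_sub_right x
    simpa using this
  have h2 : |(∫ z, ρ z * u (x + z)) - ∫ z, ρ z * u (y + z)| ≤ 2 * I⁻¹ * ω * ‖x - y‖ := by
    rw [sh, sh, ← integral_sub (shi x) (shi y), ← Real.norm_eq_abs]
    have hin : ∀ a : EE d, Integrable ((ball a 1).indicator (fun _ => I⁻¹ * ‖x - y‖)) := fun a =>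
      (integrable_indicator_iff measurableSet_ball).2 (integrableOn_const (measure_ball_lt_top.ne))
    refine (norm_integral_le_of_norm_le ((hin x).add (hin y)) (Eventually.of_forall fun z => ?_)).trans (le_of_eq ?_)
    · rw [← sub_mul, norm_mul, Real.norm_eq_abs, Real.norm_eq_abs]
      refine (mul_le_of_le_one_right (abs_nonneg _) (hb _)).trans ?_
      have hc : 0 ≤ I⁻¹ * ‖x - y‖ := by positivity
      have g0 : ∀ a : EE d, 0 ≤ (ball a 1).indicator (fun _ => I⁻¹ * ‖x - y‖) z := fun a =>
        indicator_nonneg (fun _ _ => hc) z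
      have hlip : |ρ (z - x) - ρ (z - y)| ≤ I⁻¹ * ‖x - y‖ := by
        simp only [hρ]
        rw [← mul_sub, abs_mul, abs_of_pos (inv_pos.2 r0p)]
        refine mul_le_mul_of_nonneg_left ?_ (inv_nonneg.2 r0p.le)
        have h1 := abs_max_sub_max_le_abs (1 - ‖z - x‖) (1 - ‖z - y‖) 0
        rw [max_comm, max_comm _ (0:ℝ)] at h1
        refine h1.trans ?_
        rw [show 1 - ‖z - x‖ - (1 - ‖z - y‖) = ‖z - y‖ - ‖z - x‖ by ring]
        refine (abs_norm_sub_norm_le _ _).trans (le_of_eq ?_)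
        congr 1; abel
      by_cases hx : z ∈ ball x 1
      · have : (ball x 1).indicator (fun _ => I⁻¹ * ‖x - y‖) z = I⁻¹ * ‖x - y‖ := indicator_of_mem hx _
        simp only [Pi.add_apply]
        linarith [g0 y]
      · by_cases hy : z ∈ ball y 1
        · have : (ball y 1).indicator (fun _ => I⁻¹ * ‖x - y‖) z = I⁻¹ * ‖x - y‖ := indicator_of_mem hy _
          simp only [Pi.add_apply]
          linarith [g0 x]
        · rw [mem_ball, dist_eq_norm, not_lt] at hx hy
          simp only [hρ]
          rw [r0z _ hx, r0z _ hy]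
          simp only [Pi.add_apply]
          have := g0 x; have := g0 y
          simp only [mul_zero, sub_zero, abs_zero]; linarith
    · rw [integral_add' (hin x) (hin y), integral_indicator_const _ measurableSet_ball,
        integral_indicator_const _ measurableSet_ball, vol_ball hd x zero_le_one, vol_ball hd y zero_le_one]
      simp only [one_pow, one_mul, smul_eq_mul]; ring
  rcases le_total 1 ‖x - y‖ with h | h
  · rw [min_eq_left h, mul_one]
    have a := abs_le.1 (u1 x); have b := abs_le.1 (u1 y)
    have : 0 ≤ 2 * I⁻¹ * ω := by positivity
    rw [abs_le]; constructor <;> linarith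
  · rw [min_eq_right h]
    refine h2.trans ?_
    gcongr; linarith

lemma B1_bound {d : ℕ} {u : EE d → ℝ} (huc : Continuous u)
    (hb : ∀ x, |u x| ≤ 1) (x₀ : EE d) {R : ℝ} (hR : 1 ≤ R) {q V : ℝ}
    (hT : ∀ z : EE d, ∫ x, ph x₀ R x * |u (x + z) - u x| ≤ 2 * ‖z‖ * q + 4 * (‖z‖ / R)^2 * V)
    (hq : 0 ≤ q) (hV : 0 ≤ V)
    {ρ u1 : EE d → ℝ} (ρc : Continuous ρ) (ρi : Integrable ρ) (ρn : ∀ z, 0 ≤ ρ z) (ρz : ∀ z, 1 ≤ ‖z‖ → ρ z = 0)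
    (ρ1 : ∫ z, ρ z = 1) (hu1 : ∀ x, u1 x = ∫ z, ρ z * u (x + z)) (hu1c : Continuous u1) :
    ∫ x, ph x₀ R x * |u x - u1 x| ≤ 2 * q + 4 / R^2 * V := by
  have hR0 : 0 < R := by linarith
  set F : EE d × EE d → ℝ := fun p => ph x₀ R p.1 * ρ p.2 * |u (p.1 + p.2) - u p.1| with hF
  have hφc := ph_cont x₀ R
  have phi1 : Integrable (fun x => ph x₀ R x) := by
    simpa using phw_integrable x₀ hR (continuous_const (y := (1:ℝ)))
  have hw2 : ∀ x z, |u (x + z) - u x| ≤ 2 := by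
    intro x z
    have := abs_le.1 (hb (x+z)); have := abs_le.1 (hb x)
    rw [abs_le]; constructor <;> linarith
  have Fi : Integrable F := by
    refine ((phi1.mul_prod ρi).const_mul 2).mono' (by fun_prop) (Eventually.of_forall fun p => ?_)
    have h1 : 0 ≤ ph x₀ R p.1 * ρ p.2 := mul_nonneg (ph_nonneg _ _ _) (ρn _)
    rw [Real.norm_eq_abs, abs_mul, abs_abs, abs_of_nonneg h1]
    nlinarith [hw2 p.1 p.2]
  have e1 : ∫ x, ph x₀ R x * |u x - u1 x| ≤ ∫ x, ∫ z, F (x, z) := by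
    refine integral_mono (phw_integrable x₀ hR (by fun_prop)) Fi.integral_prod_left fun x => ?_
    simp only [hF, mul_assoc]
    rw [integral_const_mul]
    refine mul_le_mul_of_nonneg_left ?_ (ph_nonneg _ _ _)
    have ui : Integrable (fun z => ρ z * u (x + z)) := by
      refine ρi.mono' (by fun_prop) (Eventually.of_forall fun z => ?_)
      rw [norm_mul, Real.norm_eq_abs, Real.norm_eq_abs, abs_of_nonneg (ρn z)]
      exact mul_le_of_le_one_right (ρn z) (hb _)
    have e2 : u1 x - u x = ∫ z, ρ z * (u (x + z) - u x) := by
      simp_rw [mul_sub]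
      rw [integral_sub ui (ρi.mul_const _), integral_mul_const, ρ1, hu1]; ring
    rw [abs_sub_comm, e2]
    refine (abs_integral_le_integral_abs).trans (le_of_eq ?_)
    congr 1; ext z; rw [abs_mul, abs_of_nonneg (ρn z)]
  refine e1.trans ?_
  rw [integral_integral_swap (f := fun x z => F (x, z)) Fi]
  have e3 : ∀ z, ∫ x, F (x, z) ≤ ρ z * (2 * q + 4 / R^2 * V) := by
    intro z
    have : ∫ x, F (x, z) = ρ z * ∫ x, ph x₀ R x * |u (x + z) - u x| := by
      rw [← integral_const_mul]; congr 1; ext x; simp only [hF]; ring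
    rw [this]
    by_cases hz : 1 ≤ ‖z‖
    · rw [ρz z hz]; simp
    · refine mul_le_mul_of_nonneg_left ((hT z).trans ?_) (ρn z)
      have hz' : ‖z‖ ≤ 1 := (not_le.1 hz).le
      have h1 : (‖z‖ / R)^2 ≤ 1 / R^2 := by
        rw [div_pow]
        gcongr
        nlinarith [norm_nonneg z]
      have h2 : 2 * ‖z‖ * q ≤ 2 * q := by nlinarith
      have h3 : 4 * (‖z‖ / R)^2 * V ≤ 4 * (1 / R^2) * V := by gcongr
      calc _ ≤ 2 * q + 4 * (1 / R^2) * V := by linarith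
        _ = _ := by ring
  refine (integral_mono Fi.integral_prod_right (ρi.mul_const _) e3).trans (le_of_eq ?_)
  rw [integral_mul_const, ρ1, one_mul]


lemma indk {d : ℕ} (x₀ : EE d) (r : ℝ) {k : EE d → ℝ} (hk : Integrable k) (hke : ∀ z, k (-z) = k z) :
    Integrable (fun p : EE d × EE d => ((ball x₀ r).indicator 1 p.1 + (ball x₀ r).indicator 1 p.2) * k (p.1 - p.2)) ∧
    ∫ p : EE d × EE d, ((ball x₀ r).indicator 1 p.1 + (ball x₀ r).indicator 1 p.2) * k (p.1 - p.2) =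
      2 * (volume.real (ball x₀ r) * ∫ z, k z) := by
  have hi : Integrable ((ball x₀ r).indicator (1 : EE d → ℝ)) :=
    (integrable_indicator_iff measurableSet_ball).2 (integrableOn_const (measure_ball_lt_top.ne))
  set F : EE d × EE d → ℝ := fun p => (ball x₀ r).indicator 1 p.1 * k (p.1 - p.2) with hF
  have e0 : (fun p : EE d × EE d => F (p.1, p.1 + p.2)) = fun p => (ball x₀ r).indicator 1 p.1 * k p.2 := by
    ext p; simp only [hF, sub_add_cancel_left, hke]
  have Fi : Integrable F := by
    rw [← shear_integrable, e0]; exact hi.mul_prod hk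
  have FI : ∫ p, F p = volume.real (ball x₀ r) * ∫ z, k z := by
    rw [← shear_int, e0]
    refine (integral_prod_mul (μ := (volume : Measure (EE d))) (ν := (volume : Measure (EE d))) ((ball x₀ r).indicator (1 : EE d → ℝ)) k).trans ?_
    rw [integral_indicator_one measurableSet_ball]
  have Fs : Integrable (fun p : EE d × EE d => F (p.2, p.1)) := Fi.swap
  have e1 : (fun p : EE d × EE d => ((ball x₀ r).indicator 1 p.1 + (ball x₀ r).indicator 1 p.2) * k (p.1 - p.2)) =
      fun p => F p + F (p.2, p.1) := by
    ext p; simp only [hF]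
    rw [← hke (p.2 - p.1), neg_sub]; ring
  rw [e1]
  refine ⟨Fi.add Fs, ?_⟩
  rw [integral_add Fi Fs, swap_int F, FI]; ring

lemma B2_integrable {d : ℕ} (hd : 1 ≤ d) {s : ℝ} (hs0 : 0 < s) (hs1 : s < 1) {u : EE d → ℝ}
    (huL : LL u) (huc : Continuous u) (x₀ : EE d) {R : ℝ} (hR : 1 ≤ R) :
    Integrable (fun p : EE d × EE d => |u p.1 - u p.2| * min 1 ‖p.1 - p.2‖ * ph x₀ R p.1 * frk d s (p.1 - p.2)) := by
  have hR0 : 0 < R := by linarith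
  have hk := frk_meas d s
  have hφc := ph_cont x₀ R
  obtain ⟨L, hL, hLu⟩ := huL x₀ (2*R)
  refine int_of_dom hd hs0 hs1 x₀ (2*R) (4 * L) (by fun_prop : Measurable _).aestronglyMeasurable fun p => ?_
  have hk0 := frk_nonneg d s (p.1 - p.2)
  have hφ0 := ph_nonneg x₀ R p.1
  have hm0 : 0 ≤ min 1 ‖p.1 - p.2‖ := by positivity
  rw [abs_of_nonneg (by positivity)]
  by_cases hp : p.1 ∈ ball x₀ (2*R)
  · have h1 := hLu p.1 hp p.2
    have h2 := min_sq_le hs0 hs1 (norm_nonneg (p.1 - p.2))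
    have h3 := ph_le x₀ hR0 p.1
    unfold dom mm
    rw [indicator_of_mem hp]
    have i2 := ind_bounds x₀ p.2 (2*R)
    simp only [Pi.one_apply]
    have hmm : 0 ≤ min 1 (‖p.1 - p.2‖ ^ (1+s)) * frk d s (p.1 - p.2) := mm_nonneg d s _
    calc _ ≤ (L * min 1 ‖p.1 - p.2‖) * min 1 ‖p.1 - p.2‖ * 4 * frk d s (p.1 - p.2) := by gcongr
      _ = 4 * L * ((min 1 ‖p.1 - p.2‖ * min 1 ‖p.1 - p.2‖) * frk d s (p.1 - p.2)) := by ring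
      _ ≤ 4 * L * (min 1 (‖p.1 - p.2‖ ^ (1+s)) * frk d s (p.1 - p.2)) := by gcongr
      _ ≤ _ := by
        refine mul_le_mul_of_nonneg_left ?_ (by positivity)
        nlinarith
  · rw [ph_supp x₀ hR0 hp]
    have := dom_nonneg d s x₀ (2*R) p
    simp only [mul_zero, zero_mul]; positivity

lemma B2_bound {d : ℕ} (hd : 1 ≤ d) {s : ℝ} (hs : 1/2 ≤ s) (hs1 : s < 1) : ∃ C : ℝ, 0 ≤ C ∧
    ∀ {u : EE d → ℝ}, LL u → Continuous u → (∀ x, |u x| ≤ 1) → ∀ (x₀ : EE d) {R : ℝ}, 1 ≤ R →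
    ∀ {q V : ℝ}, 0 ≤ q → 0 ≤ V →
    (∀ z : EE d, ∫ x, ph x₀ R x * |u (x + z) - u x| ≤ 2 * ‖z‖ * q + 4 * (‖z‖ / R)^2 * V) → 
    (∀ z : EE d, ∫ x, ph x₀ R x * |u (x + z) - u x| ≤ 8 * V) → 
    ∫ p : EE d × EE d, |u p.1 - u p.2| * min 1 ‖p.1 - p.2‖ * ph x₀ R p.1 * frk d s (p.1 - p.2) ≤
      C * ((1 + Real.log R) * q + V * R ^ (-2*s)) := by
  have hs0 : 0 < s := by linarith
  obtain ⟨Cl, hCl, hl⟩ := log_int hd hs hs1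
  have hI0 : 0 ≤ ∫ z, mm d s z := integral_nonneg (mm_nonneg d s)
  refine ⟨2 * Cl + 8 * ∫ z, mm d s z, by positivity, ?_⟩
  intro u huL huc hb x₀ R hR q V hq hV hT hT2
  have hR0 : 0 < R := by linarith
  obtain ⟨li, hl⟩ := hl R hR
  have hi := B2_integrable hd hs0 hs1 huL huc x₀ hR
  have mi := mmR_integrable (d := d) hd hs0 hs1 hR0
  have mI := mmR_integral (d := d) (s := s) hR0
  set F : EE d × EE d → ℝ := fun p => |u p.1 - u p.2| * min 1 ‖p.1 - p.2‖ * ph x₀ R p.1 * frk d s (p.1 - p.2) with hF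
  rw [← shear_int F]
  have hi2 := (shear_integrable F).2 hi
  rw [Measure.volume_eq_prod] at hi2 ⊢
  rw [integral_prod_symm _ hi2]
  have bnd : ∀ z : EE d, ∫ x, F (x, x + z) ≤
      2 * q * (Iio R).indicator (fun t => min (t^2) t * (t ^ ((d : ℝ) + 2*s))⁻¹) ‖z‖ +
      8 * V * (min 1 ((‖z‖ / R) ^ (1+s)) * frk d s z) := by
    intro z
    have e1 : ∫ x, F (x, x + z) = min 1 ‖z‖ * frk d s z * ∫ x, ph x₀ R x * |u (x + z) - u x| := by
      rw [← integral_const_mul]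
      congr 1; ext x
      simp only [hF, sub_add_cancel_left, norm_neg, frk_neg]
      rw [abs_sub_comm]; ring
    rw [e1]
    have hk0 := frk_nonneg d s z
    have hm0 : 0 ≤ min 1 ‖z‖ := by positivity
    have hm1 : min 1 ‖z‖ ≤ 1 := min_le_left _ _
    by_cases hz : ‖z‖ < R
    · rw [indicator_of_mem (by exact hz)]
      have ht0 : 0 ≤ ‖z‖ / R := by positivity
      have ht1 : ‖z‖ / R ≤ 1 := by rw [div_le_one hR0]; exact hz.le
      have h1 : (‖z‖ / R)^2 ≤ min 1 ((‖z‖ / R) ^ (1+s)) := by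
        have := min_sq_le hs0 hs1 ht0
        rwa [min_eq_right ht1, ← sq] at this
      have h2 : min 1 ‖z‖ * ‖z‖ = min (‖z‖^2) ‖z‖ := by
        rw [min_mul_of_nonneg _ _ (norm_nonneg z), one_mul, ← sq, min_comm]
      have hmn : 0 ≤ min 1 ((‖z‖ / R) ^ (1+s)) := by positivity
      calc _ ≤ min 1 ‖z‖ * frk d s z * (2 * ‖z‖ * q + 4 * (‖z‖ / R)^2 * V) :=
            mul_le_mul_of_nonneg_left (hT z) (by positivity)
        _ = 2 * q * ((min 1 ‖z‖ * ‖z‖) * frk d s z) + (4 * V * frk d s z * (‖z‖ / R)^2) * min 1 ‖z‖ := by ring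
        _ ≤ 2 * q * ((min 1 ‖z‖ * ‖z‖) * frk d s z) + (4 * V * frk d s z * min 1 ((‖z‖ / R) ^ (1+s))) * 1 := by
          gcongr
        _ ≤ 2 * q * ((min 1 ‖z‖ * ‖z‖) * frk d s z) + 8 * V * (min 1 ((‖z‖ / R) ^ (1+s)) * frk d s z) := by
          have : 0 ≤ V * (min 1 ((‖z‖ / R) ^ (1+s)) * frk d s z) := by positivity
          nlinarith
        _ = _ := by rw [h2]; rfl
    · rw [indicator_of_notMem (by exact hz)]
      push Not at hz
      have : min 1 ((‖z‖ / R) ^ (1+s)) = 1 := by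
        refine min_eq_left (Real.one_le_rpow ?_ (by linarith))
        rwa [one_le_div hR0]
      rw [this]
      calc _ ≤ min 1 ‖z‖ * frk d s z * (8 * V) := mul_le_mul_of_nonneg_left (hT2 z) (by positivity)
        _ ≤ 1 * frk d s z * (8 * V) := by gcongr
        _ = _ := by ring
  refine (integral_mono hi2.integral_prod_right ((li.const_mul (2*q)).add (mi.const_mul (8*V))) bnd).trans ?_
  rw [integral_add' (li.const_mul (2*q)) (mi.const_mul (8*V)), integral_const_mul, integral_const_mul, mI]
  have hlog : 0 ≤ Real.log R := Real.log_nonneg hR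
  have hRs : 0 ≤ R ^ (-2*s) := by positivity
  have h1 := mul_le_mul_of_nonneg_left hl (by positivity : 0 ≤ 2 * q)
  have h2 : 0 ≤ (∫ z, mm d s z) * ((1 + Real.log R) * q) := by positivity
  have h3 : 0 ≤ Cl * (V * R^(-2*s)) := by positivity
  nlinarith


lemma D_pt {a φ φ' g g' b Cρ μ m i i' ζ ζ' K k : ℝ} (hφ : φ = ζ^2) (hφ' : φ' = ζ'^2) 
    (hζ : 0 ≤ ζ) (hζ' : 0 ≤ ζ') (hb : |b| ≤ Cρ * μ) (hgg : g - g' = a - b) (hg' : |g'| ≤ 2)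
    (hlip : |φ - φ'| ≤ 2 * m * (ζ + ζ')) (hm : 0 ≤ m) (hK : 0 ≤ K) (hk : m * m * K ≤ k)
    (hi0 : 0 ≤ i) (hi0' : 0 ≤ i')
    (hi : (i = 0 ∧ ζ = 0) ∨ i = 1) (hi' : (i' = 0 ∧ ζ' = 0) ∨ i' = 1) :
    a^2 * φ * K - a * (φ * g - φ' * g') * K ≤ Cρ * (|a| * μ * φ * K) +
      (1/4 * (a^2 * φ * K + a^2 * φ' * K) + 32 * ((i + i') * k)) := by
  have e1 : a^2 * φ * K - a * (φ * g - φ' * g') * K = a * b * (φ * K) - a * (φ - φ') * g' * K := by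
    have : g = g' + a - b := by linarith
    rw [this]; ring
  rw [e1]
  have hφ0 : 0 ≤ φ := by rw [hφ]; positivity
  have h1 : a * b * (φ * K) ≤ Cρ * (|a| * μ * φ * K) := by
    have : a * b ≤ |a| * (Cρ * μ) := by
      refine (le_abs_self _).trans ?_
      rw [abs_mul]; exact mul_le_mul_of_nonneg_left hb (abs_nonneg a)
    calc _ ≤ |a| * (Cρ * μ) * (φ * K) := mul_le_mul_of_nonneg_right this (by positivity)
      _ = _ := by ring
  have hmK : 0 ≤ m * m * K := by positivity
  have h2 : -(a * (φ - φ') * g') * K ≤ 1/4 * (a^2 * φ * K + a^2 * φ' * K) + 32 * ((i + i') * (m * m * K)) := by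
    have h3 : -(a * (φ - φ') * g') ≤ |a| * (2 * m * (ζ + ζ')) * 2 := by
      refine (neg_le_abs _).trans ?_
      rw [abs_mul, abs_mul]
      gcongr
    have h4 : |a| * (2 * m * (ζ + ζ')) * 2 ≤ 1/4 * (a^2 * φ + a^2 * φ') + 32 * ((i + i') * (m * m)) := by
      have ha : a^2 = |a|^2 := (sq_abs a).symm
      have key : |a| * (2 * m * (ζ + ζ')) * 2 ≤ 1/4 * (a^2 * φ + a^2 * φ') + 32 * (m * m) := by
        rw [ha, hφ, hφ']
        nlinarith [sq_nonneg (|a| * (ζ + ζ') - 16 * m), mul_nonneg (sq_nonneg |a|) (sq_nonneg (ζ - ζ'))]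
      have hmm : 0 ≤ m * m := by positivity
      rcases hi with ⟨h, hz⟩ | h
      · rcases hi' with ⟨h', hz'⟩ | h'
        · rw [h, h', hφ, hφ', hz, hz']; simp
        · rw [h, h']; linarith
      · rw [h]; nlinarith
    calc _ ≤ (1/4 * (a^2 * φ + a^2 * φ') + 32 * ((i + i') * (m * m))) * K :=
          mul_le_mul_of_nonneg_right (h3.trans h4) hK
      _ = _ := by ring
  have h5 : (i + i') * (m * m * K) ≤ (i + i') * k := mul_le_mul_of_nonneg_left hk (by positivity)
  linarith

lemma ind_cases {d : ℕ} (x₀ : EE d) {R : ℝ} (hR0 : 0 < R) (x : EE d) :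
    ((ball x₀ (2*R)).indicator (1 : EE d → ℝ) x = 0 ∧ zt x₀ R x = 0) ∨ (ball x₀ (2*R)).indicator (1 : EE d → ℝ) x = 1 := by
  by_cases hx : x ∈ ball x₀ (2*R)
  · right; rw [indicator_of_mem hx]; rfl
  · left; exact ⟨indicator_of_notMem hx _, zt_supp x₀ hR0 hx⟩

set_option maxHeartbeats 400000 in
lemma stepD {d : ℕ} (hd : 1 ≤ d) {s : ℝ} (hs : 1/2 ≤ s) (hs1 : s < 1) : ∃ C : ℝ, 0 ≤ C ∧
    ∀ {f f' : ℝ → ℝ} {M₀ : ℝ} {u : EE d → ℝ}, ContinuousOn f (Icc (-1) 1) → 0 ≤ M₀ →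
    (∀ x ∈ Set.Icc (-1 : ℝ) 1, |f x| ≤ M₀) → IsStableSolution d s f f' u → ∀ (x₀ : EE d) {R : ℝ}, 1 ≤ R →
    ∀ {q V : ℝ}, 0 ≤ q → V = volume.real (ball x₀ (2*R)) →
    (∀ z : EE d, ∫ x, ph x₀ R x * |u (x + z) - u x| ≤ 2 * ‖z‖ * q + 4 * (‖z‖ / R)^2 * V) → 
    ∫ p : EE d × EE d, (u p.1 - u p.2)^2 * ph x₀ R p.1 * frk d s (p.1 - p.2) ≤
      C * (M₀ * (q + V / R^2) + (1 + Real.log R) * q + V * R ^ (-2*s)) := by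
  have hs0 : 0 < s := by linarith
  obtain ⟨C2, hC2, hB2⟩ := B2_bound hd hs hs1
  obtain ⟨ρ, Cρ, ρc, ρi, ρn, ρz, ρ1, hCρ, hm⟩ := moll hd
  have hI0 : 0 ≤ ∫ z, mm d s z := integral_nonneg (mm_nonneg d s)
  set I := ∫ z, mm d s z with hI
  have hc := fracC_pos d hs0 hs1
  refine ⟨16 / fracC d s + 2 * Cρ * C2 + 128 * I, by positivity, ?_⟩
  intro f f' M₀ u hfc hM hfM hu x₀ R hR q V hq hV hT
  have hR0 : 0 < R := by linarith
  have hb := hu.2.1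
  have huc : Continuous u := hu.1.continuous
  have huL : LL u := LL_of_C1 (hu.1.of_le (by norm_num)) hb
  have hV0 : 0 ≤ V := by rw [hV]; exact measureReal_nonneg
  have hT2 : ∀ z : EE d, ∫ x, ph x₀ R x * |u (x + z) - u x| ≤ 8 * V := by
    rw [hV]; exact P_le huc hb x₀ hR
  obtain ⟨hm1, hm2⟩ := hm u huc hb
  set u1 : EE d → ℝ := fun x => ∫ z, ρ z * u (x + z) with hu1
  have u1L : LL u1 := fun _ _ => ⟨Cρ, hCρ, fun x _ y => hm2 x y⟩
  have u1c : Continuous u1 := by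
    refine (LipschitzWith.of_dist_le_mul (K := ⟨Cρ, hCρ⟩) fun x y => ?_).continuous
    rw [Real.dist_eq, dist_eq_norm]
    exact (hm2 x y).trans (mul_le_mul_of_nonneg_left (min_le_right _ _) hCρ)
  have b1 := B1_bound huc hb x₀ hR hT hq hV0 ρc ρi ρn ρz ρ1 (u1 := u1) (fun x => rfl) u1c
  have b2 := hB2 huL huc hb x₀ hR hq hV0 hT hT2
  set g : EE d → ℝ := fun x => u x - u1 x with hg
  have gL : LL g := huL.sub u1L
  have gc : Continuous g := huc.sub u1c
  have g2 : ∀ x, |g x| ≤ 2 := by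
    intro x
    have := abs_le.1 (hb x); have := abs_le.1 (hm1 x)
    rw [abs_le]; constructor <;> simp only [hg, hu1] <;> linarith
  obtain ⟨L, hψ⟩ := (ph_CLip x₀ hR).mul gL g2
  have wf := weak_form hd hs0 hs1 hu.1 hb hψ
  simp_rw [pde_inner hs0 hs1 hu] at wf
  have i1 := prod_integrable hd hs0 hs1 huL huc hψ
  have iJ := J_integrable hd hs0 hs1 huL huc x₀ hR0
  have iJ' := J_integrable' hd hs0 hs1 huL huc x₀ hR0
  have iB := B2_integrable hd hs0 hs1 huL huc x₀ hR
  have ki := mmR_integrable (d := d) hd hs0 hs1 hR0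
  have kI := mmR_integral (d := d) (s := s) hR0
  set k : EE d → ℝ := fun z => min 1 ((‖z‖ / R) ^ (1+s)) * frk d s z with hk
  obtain ⟨iK, eK⟩ := indk x₀ (2*R) ki (fun z => by simp only [hk, norm_neg, frk_neg])
  have eJ' := J_swap (d := d) (s := s) (u := u) (ph x₀ R)
  set J := ∫ p : EE d × EE d, (u p.1 - u p.2)^2 * ph x₀ R p.1 * frk d s (p.1 - p.2) with hJ
  have pt : ∀ p : EE d × EE d, (u p.1 - u p.2)^2 * ph x₀ R p.1 * frk d s (p.1 - p.2) -
      (u p.1 - u p.2) * (ph x₀ R p.1 * g p.1 - ph x₀ R p.2 * g p.2) * frk d s (p.1 - p.2) ≤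
      Cρ * (|u p.1 - u p.2| * min 1 ‖p.1 - p.2‖ * ph x₀ R p.1 * frk d s (p.1 - p.2)) +
      (1/4 * ((u p.1 - u p.2)^2 * ph x₀ R p.1 * frk d s (p.1 - p.2) + (u p.1 - u p.2)^2 * ph x₀ R p.2 * frk d s (p.1 - p.2))
       + 32 * (((ball x₀ (2*R)).indicator 1 p.1 + (ball x₀ (2*R)).indicator 1 p.2) * k (p.1 - p.2))) := by
    intro p
    refine D_pt (b := u1 p.1 - u1 p.2) (m := min 1 (‖p.1 - p.2‖ / R)) rfl rfl (zt_nonneg x₀ R p.1) (zt_nonneg x₀ R p.2)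
      (hm2 p.1 p.2) (by simp only [hg]; ring) (g2 p.2) (ph_lip x₀ hR0 p.1 p.2) (by positivity) (frk_nonneg _ _ _) ?_
      (ind_bounds _ _ _) (ind_bounds _ _ _) (ind_cases x₀ hR0 _) (ind_cases x₀ hR0 _)
    exact mul_le_mul_of_nonneg_right (min_sq_le hs0 hs1 (by positivity)) (frk_nonneg _ _ _)
  have hint := integral_mono (iJ.sub i1) ((iB.const_mul Cρ).add (((iJ.add iJ').const_mul (1/4)).add (iK.const_mul 32))) pt
  have r1 : ∫ p : EE d × EE d, Cρ * (|u p.1 - u p.2| * min 1 ‖p.1 - p.2‖ * ph x₀ R p.1 * frk d s (p.1 - p.2)) +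
      (1/4 * ((u p.1 - u p.2)^2 * ph x₀ R p.1 * frk d s (p.1 - p.2) + (u p.1 - u p.2)^2 * ph x₀ R p.2 * frk d s (p.1 - p.2))
       + 32 * (((ball x₀ (2*R)).indicator 1 p.1 + (ball x₀ (2*R)).indicator 1 p.2) * k (p.1 - p.2))) =
      Cρ * (∫ p : EE d × EE d, |u p.1 - u p.2| * min 1 ‖p.1 - p.2‖ * ph x₀ R p.1 * frk d s (p.1 - p.2)) +
      (1/4 * (J + J) + 32 * (2 * (V * (R ^ (-2*s) * I)))) := by
    have x1 := integral_add (iB.const_mul Cρ) (((iJ.add iJ').const_mul (1/4)).add (iK.const_mul 32))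
    have x2 := integral_add ((iJ.add iJ').const_mul (1/4)) (iK.const_mul 32)
    have x3 := integral_add iJ iJ'
    rw [eJ', ← hJ] at x3
    rw [kI, ← hV, ← hI] at eK
    refine x1.trans ?_
    rw [integral_const_mul]
    congr 1
    refine x2.trans ?_
    rw [integral_const_mul, integral_const_mul, eK]
    exact congrArg (fun t => 1/4 * t + 32 * (2 * (V * (R ^ (-2*s) * I)))) x3
  have r0 := integral_sub iJ i1
  have hint2 := (le_of_eq r0.symm).trans (hint.trans (le_of_eq r1))
  rw [wf, ← hJ] at hint2
  have r2 : ∫ x, ph x₀ R x * g x * (2 / fracC d s * f (u x)) ≤ 2 / fracC d s * M₀ * (2 * q + 4 / R^2 * V) := by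
    have fuc : Continuous (fun x => f (u x)) := hfc.comp_continuous huc (fun x => abs_le.1 (hb x))
    have j1 : Integrable (fun x => ph x₀ R x * g x * (2 / fracC d s * f (u x))) :=
      hψ.integrable_mul (continuous_const.mul fuc)
    have j2 : Integrable (fun x => ph x₀ R x * |u x - u1 x|) := phw_integrable x₀ hR gc.abs
    calc _ ≤ ∫ x, 2 / fracC d s * M₀ * (ph x₀ R x * |u x - u1 x|) := by
          refine integral_mono j1 (j2.const_mul _) fun x => ?_
          have h1 : g x * f (u x) ≤ |g x| * M₀ := by
            refine (le_abs_self _).trans ?_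
            rw [abs_mul]; exact mul_le_mul_of_nonneg_left (hfM _ (abs_le.1 (hb x))) (abs_nonneg _)
          have h2 : 0 ≤ 2 / fracC d s * ph x₀ R x := mul_nonneg (by positivity) (ph_nonneg _ _ _)
          calc ph x₀ R x * g x * (2 / fracC d s * f (u x)) = 2 / fracC d s * ph x₀ R x * (g x * f (u x)) := by ring
            _ ≤ 2 / fracC d s * ph x₀ R x * (|g x| * M₀) := mul_le_mul_of_nonneg_left h1 h2
            _ = 2 / fracC d s * M₀ * (ph x₀ R x * |g x|) := by ring
      _ = 2 / fracC d s * M₀ * ∫ x, (ph x₀ R x * |u x - u1 x|) := integral_const_mul _ _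
      _ ≤ _ := mul_le_mul_of_nonneg_left b1 (by positivity)
  have r3 := mul_le_mul_of_nonneg_left b2 hCρ
  have hlog : 0 ≤ Real.log R := Real.log_nonneg hR
  have hRs : 0 ≤ R ^ (-2*s) := by positivity
  have key : J ≤ 2 * (2 / fracC d s * M₀ * (2 * q + 4 / R^2 * V)) + 2 * (Cρ * (C2 * ((1 + Real.log R) * q + V * R^(-2*s))))
     + 128 * (V * (R ^ (-2*s) * I)) := by linarith
  refine key.trans ?_
  have y1 : 2 * (2 / fracC d s * M₀ * (2 * q + 4 / R^2 * V)) ≤ 16 / fracC d s * (M₀ * (q + V / R^2)) := by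
    have : 2 * q + 4 / R^2 * V ≤ 4 * (q + V / R^2) := by
      rw [mul_add, div_mul_eq_mul_div, mul_div_assoc]; linarith
    calc _ ≤ 2 * (2 / fracC d s * M₀ * (4 * (q + V / R^2))) := by gcongr
      _ = _ := by ring
  have y2 : 0 ≤ M₀ * (q + V / R^2) := by positivity
  have y3 : 0 ≤ (1 + Real.log R) * q := by positivity
  have y4 : 0 ≤ V * R^(-2*s) := by positivity
  have y5 : 0 ≤ 16 / fracC d s := by positivity
  have y6 : 0 ≤ 2 * Cρ * C2 := by positivity
  set X1 := M₀ * (q + V / R^2)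
  set X2 := (1 + Real.log R) * q
  set X3 := V * R^(-2*s)
  have y7 : 128 * (V * (R ^ (-2*s) * I)) = 128 * I * X3 := by simp only [X3]; ring
  rw [y7]
  have z1 := mul_nonneg y5 (add_nonneg y3 y4)
  have z2 := mul_nonneg y6 y2
  have z3 := mul_nonneg hI0 (add_nonneg y2 y3)
  nlinarith

lemma alg_final {A B C1 l Y J q : ℝ} (hA : 0 ≤ A) (hB : 0 ≤ B) (hC1 : 0 ≤ C1) (hl : 1 ≤ l) (hY : 0 ≤ Y) (hJ : 0 ≤ J)
    (hq : q^2 = C1 * (Y^2 + Y * J)) (h : J ≤ A * l * q + B * Y) :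
    J ≤ (1 + A^2 * C1 + 2 * B) * Y * l^2 := by
  have h1 : A * l * q ≤ ((Y + J) + A^2 * l^2 * C1 * Y) / 2 := by
    refine abs_le_of_sq_le_sq' ?_ (by positivity) |>.2
    have : (A * l * q)^2 = (A^2 * l^2 * C1 * Y) * (Y + J) := by
      rw [mul_pow, hq]; ring
    rw [this]
    nlinarith [sq_nonneg ((Y + J) - A^2 * l^2 * C1 * Y)]
  have hl2 : 1 ≤ l^2 := by nlinarith
  have h2 : J ≤ Y + A^2 * l^2 * C1 * Y + 2 * B * Y := by linarith
  have h3 : (Y + 2 * B * Y) * 1 ≤ (Y + 2 * B * Y) * l^2 := mul_le_mul_of_nonneg_left hl2 (by positivity)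
  nlinarith

lemma J_bound {d : ℕ} (hd : 1 ≤ d) {s : ℝ} (hs : 1/2 ≤ s) (hs1 : s < 1) {α M₀ : ℝ} {f f' : ℝ → ℝ} (hα : 0 < α)
    (hf : IsC1Alpha f f' α) (hM : 0 ≤ M₀) (hfM : ∀ x ∈ Set.Icc (-1 : ℝ) 1, |f x| ≤ M₀) : ∃ C : ℝ, 0 < C ∧
    ∀ {u : EE d → ℝ}, IsStableSolution d s f f' u → ∀ (x₀ : EE d) {R : ℝ}, 1 ≤ R →
    ∫ p : EE d × EE d, (u p.1 - u p.2)^2 * ph x₀ R p.1 * frk d s (p.1 - p.2) ≤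
      C * R ^ ((d:ℝ) + 2*s - 2) * (1 + Real.log R)^2 := by
  have hs0 : 0 < s := by linarith
  obtain ⟨C1, hC1, hQ⟩ := HQ hd hs hs1
  obtain ⟨C, hC, hD⟩ := stepD hd hs hs1
  set ω := volume.real (ball (0 : EE d) 1) with hω
  have hω0 : 0 ≤ ω := measureReal_nonneg
  refine ⟨1 + (C * (M₀ + 1))^2 * C1 + 2 * (C * (M₀ + 1) * (2^d * ω)), by positivity, ?_⟩
  intro u hu x₀ R hR
  have hR0 : 0 < R := by linarith
  have hb := hu.2.1
  have huc : Continuous u := hu.1.continuous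
  obtain ⟨γ, Cu, hγ, hCu, H⟩ := hQ hα hf hu x₀ hR
  set J := ∫ p : EE d × EE d, (u p.1 - u p.2)^2 * ph x₀ R p.1 * frk d s (p.1 - p.2) with hJ
  have hJ0 : 0 ≤ J := integral_nonneg fun p => mul_nonneg (mul_nonneg (sq_nonneg _) (ph_nonneg _ _ _)) (frk_nonneg _ _ _)
  set Y := R ^ ((d:ℝ) + 2*s - 2) with hY
  have hY0 : 0 < Y := by positivity
  have hQ0 : 0 ≤ C1 * (Y^2 + Y * J) := by positivity
  have hT := T_lem huc hb x₀ hR hQ0 hγ H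
  have hfc : ContinuousOn f (Icc (-1) 1) := fun t ht => (hf.1 t ht).continuousAt.continuousWithinAt
  have h := hD hfc hM hfM hu x₀ hR (Real.sqrt_nonneg _) rfl hT
  rw [← hJ, vol_ball hd x₀ (by positivity : (0:ℝ) ≤ 2*R), ← hω] at h
  set q := √(C1 * (Y^2 + Y * J)) with hq
  have hq0 : 0 ≤ q := Real.sqrt_nonneg _
  have hlog : 0 ≤ Real.log R := Real.log_nonneg hR
  set l := 1 + Real.log R with hl
  have hl1 : 1 ≤ l := by linarith
  have v1 : R ^ d / R^2 ≤ Y := by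
    have : R ^ d / R^2 = R ^ ((d:ℝ) - 2) := by
      rw [Real.rpow_sub hR0, Real.rpow_natCast, Real.rpow_two]
    rw [this, hY]
    exact Real.rpow_le_rpow_of_exponent_le hR (by linarith)
  have v2 : R ^ d * R^(-2*s) ≤ Y := by
    rw [← Real.rpow_natCast, ← Real.rpow_add hR0, hY]
    exact Real.rpow_le_rpow_of_exponent_le hR (by linarith)
  refine alg_final (q := q) (by positivity) (by positivity) hC1.le hl1 hY0.le hJ0 (Real.sq_sqrt hQ0) (h.trans ?_)
  have w1 : (2*R)^d * ω / R^2 ≤ 2^d * ω * Y := by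
    rw [mul_pow]
    calc _ = 2^d * ω * (R^d / R^2) := by ring
      _ ≤ _ := by gcongr
  have w2 : (2*R)^d * ω * R^(-2*s) ≤ 2^d * ω * Y := by
    rw [mul_pow]
    calc _ = 2^d * ω * (R^d * R^(-2*s)) := by ring
      _ ≤ _ := by gcongr
  have w3 : q ≤ l * q := by nlinarith
  calc _ ≤ C * (M₀ * (l * q + 2^d * ω * Y) + l * q + 2^d * ω * Y) := by gcongr
    _ = _ := by ring

lemma Js_le {d : ℕ} (hd : 1 ≤ d) {s : ℝ} (hs0 : 0 < s) (hs1 : s < 1) {u : EE d → ℝ}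
    (huL : LL u) (huc : Continuous u) (x₀ : EE d) {R : ℝ} (hR0 : 0 < R) :
    Js d s u (ball x₀ R) ≤ ENNReal.ofReal (2 * ∫ p : EE d × EE d, (u p.1 - u p.2)^2 * ph x₀ R p.1 * frk d s (p.1 - p.2)) := by
  have iJ := J_integrable hd hs0 hs1 huL huc x₀ hR0
  have iJ' := J_integrable' hd hs0 hs1 huL huc x₀ hR0
  have eJ' := J_swap (d := d) (s := s) (u := u) (ph x₀ R)
  have x3 := integral_add iJ iJ'
  rw [eJ', ← two_mul] at x3
  have nn : ∀ (x : EE d) (p : EE d × EE d), 0 ≤ (u p.1 - u p.2)^2 * ph x₀ R x * frk d s (p.1 - p.2) := fun x p =>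
    mul_nonneg (mul_nonneg (sq_nonneg _) (ph_nonneg _ _ _)) (frk_nonneg _ _ _)
  have x4 := ofReal_integral_eq_lintegral_ofReal (iJ.add iJ') (Eventually.of_forall fun p => add_nonneg (nn p.1 p) (nn p.2 p))
  have x5 : ENNReal.ofReal (2 * ∫ p : EE d × EE d, (u p.1 - u p.2)^2 * ph x₀ R p.1 * frk d s (p.1 - p.2)) = _ :=
    (congrArg ENNReal.ofReal x3.symm).trans x4
  rw [x5]
  unfold Js
  have hms : MeasurableSet (((ball x₀ R)ᶜ ×ˢ (ball x₀ R)ᶜ)ᶜ : Set (EE d × EE d)) :=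
    (measurableSet_ball.compl.prod measurableSet_ball.compl).compl
  refine (setLIntegral_mono' hms ?_).trans (setLIntegral_le_lintegral _ _)
  intro p hp
  refine ENNReal.ofReal_le_ofReal ?_
  rw [div_eq_mul_inv]
  change (u p.1 - u p.2)^2 * frk d s (p.1 - p.2) ≤ (u p.1 - u p.2)^2 * ph x₀ R p.1 * frk d s (p.1 - p.2) +
    (u p.1 - u p.2)^2 * ph x₀ R p.2 * frk d s (p.1 - p.2)
  have hA : 0 ≤ (u p.1 - u p.2)^2 * frk d s (p.1 - p.2) := mul_nonneg (sq_nonneg _) (frk_nonneg _ _ _)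
  have one : ∀ x ∈ ball x₀ R, 1 ≤ ph x₀ R x := by
    intro x hx
    have := zt_one x₀ hR0 hx
    unfold ph; nlinarith
  have hp' : p.1 ∈ ball x₀ R ∨ p.2 ∈ ball x₀ R := by
    by_contra hcon
    push Not at hcon
    exact hp ⟨hcon.1, hcon.2⟩
  have n1 := ph_nonneg x₀ R p.1
  have n2 := ph_nonneg x₀ R p.2
  have n3 : 1 ≤ ph x₀ R p.1 + ph x₀ R p.2 := by
    rcases hp' with h | h
    · linarith [one _ h]
    · linarith [one _ h]
  nlinarith [mul_le_mul_of_nonneg_left n3 hA]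

lemma final_thm (d : ℕ) (hd : 1 ≤ d) (s α : ℝ) (hs0 : 1/2 ≤ s) (hs1 : s < 1) (hα : 0 < α)
    (f f' : ℝ → ℝ) (hf : IsC1Alpha f f' α)
    (M₀ : ℝ) (hM₀ : 2 ≤ M₀) (hfM : ∀ x ∈ Set.Icc (-1 : ℝ) 1, |f x| ≤ M₀) :
    ∃ C₂ : ℝ, 0 < C₂ ∧
      ∀ u : EuclideanSpace ℝ (Fin d) → ℝ, IsStableSolution d s f f' u →
      ∀ x₀ : EuclideanSpace ℝ (Fin d), ∀ R : ℝ, 1 ≤ R →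
        Js d s u (ball x₀ R) ≤
          ENNReal.ofReal (C₂ * R ^ ((d : ℝ) + 2*s - 2) * (Real.log (M₀ * R))^2) := by
  obtain ⟨C, hC, h⟩ := J_bound hd hs0 hs1 hα hf (by linarith) hfM
  refine ⟨8 * C, by positivity, fun u hu x₀ R hR => ?_⟩
  have hR0 : 0 < R := by linarith
  have huL : LL u := LL_of_C1 (hu.1.of_le (by norm_num)) hu.2.1
  refine (Js_le hd (by linarith) hs1 huL hu.1.continuous x₀ hR0).trans (ENNReal.ofReal_le_ofReal ?_)
  have h1 := h hu x₀ hR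
  have hlog : 0 ≤ Real.log R := Real.log_nonneg hR
  have h2 : 1 + Real.log R ≤ 2 * Real.log (M₀ * R) := by
    rw [Real.log_mul (by linarith) hR0.ne']
    have h3 : Real.log 2 ≤ Real.log M₀ := Real.log_le_log (by norm_num) hM₀
    have := Real.log_two_gt_d9
    linarith
  have h3 : (1 + Real.log R)^2 ≤ (2 * Real.log (M₀ * R))^2 := pow_le_pow_left₀ (by linarith) h2 2
  have hY : 0 ≤ C * R ^ ((d : ℝ) + 2*s - 2) := by positivity
  have h4 := mul_le_mul_of_nonneg_left h3 hY
  nlinarith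

end Aux

/-- Let `d ≥ 1`, `1/2 ≤ s < 1`, `f` be `C^{1,α}` with `α > 0`, `u` a stable
solution of `(−Δ)^s u = f(u)` in `ℝ^d` with `|u| ≤ 1`, and `M₀ ≥ 2` an upper bound for the
`L^∞` norm of `f` on `[−1,1]`. Then there is `C₂ = C₂(d,s,f)` such that for every `x₀` and
every `R ≥ 1`: `J^s(u,B_R(x₀)) ≤ C₂ · R^{d+2s−2} · (log(M₀R))²`. -/
theorem stmt14 (d : ℕ) (hd : 1 ≤ d) (s α : ℝ) (hs0 : 1/2 ≤ s) (hs1 : s < 1) (hα : 0 < α)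
    (f f' : ℝ → ℝ) (hf : IsC1Alpha f f' α)
    (M₀ : ℝ) (hM₀ : 2 ≤ M₀) (hfM : ∀ x ∈ Set.Icc (-1 : ℝ) 1, |f x| ≤ M₀) :
    ∃ C₂ : ℝ, 0 < C₂ ∧
      ∀ u : EuclideanSpace ℝ (Fin d) → ℝ, IsStableSolution d s f f' u →
      ∀ x₀ : EuclideanSpace ℝ (Fin d), ∀ R : ℝ, 1 ≤ R →
        Js d s u (ball x₀ R) ≤
          ENNReal.ofReal (C₂ * R ^ ((d : ℝ) + 2*s - 2) * (Real.log (M₀ * R))^2) := by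
  exact final_thm d hd s α hs0 hs1 hα f f' hf M₀ hM₀ hfM
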